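/- Assume 0 < p < 1 is real and the family Ψ_n satisfies properties (P1)–(P6). Then for each k ≥ 0, with J₃ = 1/(1+ζ), J₄ = 1/(1−ζ), ζ = (ϑ₁(η,p²)/ϑ₄(η,p²))², and all H's evaluated at this ζ: (ψ_{2k})_{↓⋯↓} = ζ^k · H_{2k} · H_{2(k+1)}(J₃, J₄); (ψ_{2k+1})_{↓⋯↓} = ζ^{k+1} · H_{2(k+1)}(J₃) · H_{2(k+1)}(J₄); (ψ_{2k})_{↑⋯↑↓} = (1/2) ζ^k ((1+ζ) H_{2k}(J₃) H_{2(k+1)}(J₄) + (1−ζ) H_{2k}(J₄) H_{2(k+1)}(J₃)); and (ψ_{2k+1})_{↑⋯↑↓} = (1/2) ζ^k ((1−ζ²) H_{2(k+1)} H_{2(k+1)}(J₃, J₄) + H_{2k} H_{2(k+2)}(J₃, J₄)). Here ↓⋯↓ denotes the fully polarised configuration of length 2n+1 and ↑⋯↑↓ the configuration with a single ↓ at the last site. -/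

import Mathlib

noncomputable section

open Complex
open scoped BigOperators

/-- Jacobi theta function `ϑ₁(z|τ)` with nome `p = e^{iπτ}` (Whittaker–Watson convention). -/
def th1 (z τ : ℂ) : ℂ :=
  -Complex.I * ∑' n : ℤ, (-1 : ℂ) ^ n *
    Complex.exp ((Real.pi : ℂ) * Complex.I * τ * ((n : ℂ) + 1/2) ^ 2 + (2 * (n : ℂ) + 1) * Complex.I * z)

/-- Jacobi theta function `ϑ₂(z|τ)`. -/
def th2 (z τ : ℂ) : ℂ :=
  ∑' n : ℤ,
    Complex.exp ((Real.pi : ℂ) * Complex.I * τ * ((n : ℂ) + 1/2) ^ 2 + (2 * (n : ℂ) + 1) * Complex.I * z)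

/-- Jacobi theta function `ϑ₃(z|τ)`. -/
def th3 (z τ : ℂ) : ℂ :=
  ∑' n : ℤ, Complex.exp ((Real.pi : ℂ) * Complex.I * τ * (n : ℂ) ^ 2 + 2 * (n : ℂ) * Complex.I * z)

/-- Jacobi theta function `ϑ₄(z|τ)`. -/
def th4 (z τ : ℂ) : ℂ :=
  ∑' n : ℤ, (-1 : ℂ) ^ n *
    Complex.exp ((Real.pi : ℂ) * Complex.I * τ * (n : ℂ) ^ 2 + 2 * (n : ℂ) * Complex.I * z)

/-- The crossing parameter `η = π/3`. -/
def ηc : ℂ := (Real.pi : ℂ) / 3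

/-- The elliptic nome `p = e^{iπτ}`. -/
def pnome (τ : ℂ) : ℂ := Complex.exp ((Real.pi : ℂ) * Complex.I * τ)

/-- `ζ = (ϑ₁(η,p²)/ϑ₄(η,p²))²`. -/
def zet (τ : ℂ) : ℂ := (th1 ηc (2 * τ) / th4 ηc (2 * τ)) ^ 2

/-- The nome `p` is real with `0 < p < 1`. -/
def preal (τ : ℂ) : Prop := (pnome τ).im = 0 ∧ 0 < (pnome τ).re ∧ (pnome τ).re < 1

/-- A tuple given by a list of prescribed entries, padded by zeros. -/
def padded {n : ℕ} (l : List ℂ) : Fin n → ℂ := fun j => l.getD (j : ℕ) 0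

/-- Extension of a tuple by a list of prescribed further entries (padded by zeros). -/
def extL {m n : ℕ} (w : Fin m → ℂ) (l : List ℂ) : Fin n → ℂ :=
  fun j => if h : (j : ℕ) < m then w ⟨j, h⟩ else l.getD ((j : ℕ) - m) 0

/-- First `k` entries of a `2k`-tuple. -/
def firstHalf {k : ℕ} (x : Fin (2 * k) → ℂ) : Fin k → ℂ :=
  fun i => x ⟨(i : ℕ), by have := i.2; omega⟩

/-- Last `k` entries of a `2k`-tuple. -/
def secondHalf {k : ℕ} (x : Fin (2 * k) → ℂ) : Fin k → ℂ :=
  fun i => x ⟨k + (i : ℕ), by have := i.2; omega⟩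

/-- `𝕙(x,y) = ϑ₁(x−y+η)ϑ₁(x−y−η)ϑ₁(x+y+η)ϑ₁(x+y−η)`. -/
def hh (τ x y : ℂ) : ℂ :=
  th1 (x - y + ηc) τ * th1 (x - y - ηc) τ * th1 (x + y + ηc) τ * th1 (x + y - ηc) τ

/-- `𝔻(x₁,…,x_k) = ∏_{i<j} ϑ₁(x_j−x_i)ϑ₁(x_j+x_i)`. -/
def vdTheta (τ : ℂ) {k : ℕ} (y : Fin k → ℂ) : ℂ :=
  ∏ i : Fin k, ∏ j : Fin k, if i < j then th1 (y j - y i) τ * th1 (y j + y i) τ else 1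

/-- The elliptic Tsuchiya determinant `ℍ_{2k}(x₁,…,x_k; x_{k+1},…,x_{2k})`. -/
def tsuchiya (τ : ℂ) (k : ℕ) (x : Fin (2 * k) → ℂ) : ℂ :=
  (∏ i : Fin k, ∏ j : Fin k, hh τ (firstHalf x i) (secondHalf x j))
    / (vdTheta τ (firstHalf x) * vdTheta τ (secondHalf x))
    * Matrix.det (Matrix.of fun i j : Fin k => (hh τ (firstHalf x i) (secondHalf x j))⁻¹)

/-- The expression defining the elliptic Tsuchiya determinant is well defined:
the Vandermonde-type denominators and the entries `𝕙(x_i,x_{j+k})` are nonzero. -/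
def tsuDefined (τ : ℂ) (k : ℕ) (x : Fin (2 * k) → ℂ) : Prop :=
  (∀ i j : Fin k, i ≠ j →
    th1 (firstHalf x j - firstHalf x i) τ ≠ 0 ∧ th1 (firstHalf x j + firstHalf x i) τ ≠ 0) ∧
  (∀ i j : Fin k, i ≠ j →
    th1 (secondHalf x j - secondHalf x i) τ ≠ 0 ∧ th1 (secondHalf x j + secondHalf x i) τ ≠ 0) ∧
  (∀ i j : Fin k, hh τ (firstHalf x i) (secondHalf x j) ≠ 0)

/-- `h(w,w') = 1 − (3+ζ²)ww' + (1−ζ²)ww'(w+w')`. -/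
def hpol (ζ w w' : ℂ) : ℂ := 1 - (3 + ζ ^ 2) * w * w' + (1 - ζ ^ 2) * w * w' * (w + w')

/-- Vandermonde product `Δ(w₁,…,w_k) = ∏_{i<j}(w_j − w_i)`. -/
def vdm {k : ℕ} (y : Fin k → ℂ) : ℂ :=
  ∏ i : Fin k, ∏ j : Fin k, if i < j then y j - y i else 1

/-- The determinant-ratio expression defining the polynomial `H_{2k}`. -/
def Hratio (ζ : ℂ) (k : ℕ) (w : Fin (2 * k) → ℂ) : ℂ :=
  (∏ i : Fin k, ∏ j : Fin k, hpol ζ (firstHalf w i) (secondHalf w j))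
    / (vdm (firstHalf w) * vdm (secondHalf w))
    * Matrix.det (Matrix.of fun i j : Fin k => (hpol ζ (firstHalf w i) (secondHalf w j))⁻¹)

/-- The expression `Hratio` is well defined at `w`. -/
def HratioDefined (ζ : ℂ) (k : ℕ) (w : Fin (2 * k) → ℂ) : Prop :=
  (∀ i j : Fin k, i ≠ j → firstHalf w i ≠ firstHalf w j) ∧
  (∀ i j : Fin k, i ≠ j → secondHalf w i ≠ secondHalf w j) ∧
  (∀ i j : Fin k, hpol ζ (firstHalf w i) (secondHalf w j) ≠ 0)

/-- `H` is the family of Rosengren–Zinn-Justin polynomials `H_{2k}` for parameter `ζ`: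
for each `k`, `H k` is a polynomial function of the `2k` variables agreeing with the
determinant-ratio formula wherever the latter is defined, and `H 0 = 1`. -/
def IsHFamily (ζ : ℂ) (H : (k : ℕ) → (Fin (2 * k) → ℂ) → ℂ) : Prop :=
  (∀ w, H 0 w = 1) ∧
  (∀ k : ℕ, ∃ P : MvPolynomial (Fin (2 * k)) ℂ, ∀ w, H k w = MvPolynomial.eval w P) ∧
  (∀ (k : ℕ) (w : Fin (2 * k) → ℂ), HratioDefined ζ k w → H k w = Hratio ζ k w)

/-- Vertex weight `a(u)`. -/
def av (τ u : ℂ) : ℂ := th4 (2*ηc) (2*τ) * th1 (u + 2*ηc) (2*τ) * th4 u (2*τ)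
/-- Vertex weight `b(u)`. -/
def bv (τ u : ℂ) : ℂ := th4 (2*ηc) (2*τ) * th4 (u + 2*ηc) (2*τ) * th1 u (2*τ)
/-- Vertex weight `c(u)`. -/
def cv (τ u : ℂ) : ℂ := th1 (2*ηc) (2*τ) * th4 (u + 2*ηc) (2*τ) * th4 u (2*τ)
/-- Vertex weight `d(u)`. -/
def dv (τ u : ℂ) : ℂ := th1 (2*ηc) (2*τ) * th1 (u + 2*ηc) (2*τ) * th1 u (2*τ)
/-- `r(u) = a(u) + b(u)`. -/
def rv (τ u : ℂ) : ℂ := av τ u + bv τ u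

/-- Entries of the `R`-matrix of the eight-vertex model, in the basis `{↑↑,↑↓,↓↑,↓↓}`
identified with `Fin 2 × Fin 2` (`↑ = 0`, `↓ = 1`). -/
def Rent (τ u : ℂ) (p q : Fin 2 × Fin 2) : ℂ :=
  if p = q then (if p.1 = p.2 then av τ u else bv τ u)
  else if q = (p.2, p.1) then cv τ u
  else if p.1 = p.2 ∧ q.1 = q.2 then dv τ u
  else 0

/-- Entries of `Ř(u) = 𝒫 R(u)`. -/
def Rcheckent (τ u : ℂ) (p q : Fin 2 × Fin 2) : ℂ := Rent τ u (p.2, p.1) q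

/-- The boundary vector `χ(x) ∈ ℂ²⊗ℂ²`. -/
def chiV (τ lam x : ℂ) : Fin 2 × Fin 2 → ℂ := fun p =>
  if p = ((0 : Fin 2), (1 : Fin 2)) then th1 (x + lam) (2*τ) * th4 (x - lam - 2*ηc) (2*τ)
  else if p = ((1 : Fin 2), (0 : Fin 2)) then th1 (x - lam - 2*ηc) (2*τ) * th4 (x + lam) (2*τ)
  else 0

/-- The boundary vector `χ̄(x) ∈ ℂ²⊗ℂ²`. -/
def chibarV (τ lam x : ℂ) : Fin 2 × Fin 2 → ℂ := fun p =>
  if p = ((0 : Fin 2), (0 : Fin 2)) then th1 (x + lam) (2*τ) * th1 (x - lam - 2*ηc) (2*τ)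
  else if p = ((1 : Fin 2), (1 : Fin 2)) then th4 (x - lam - 2*ηc) (2*τ) * th4 (x + lam) (2*τ)
  else 0

/-- A family `Ψ_n(u₁,…,u_{2n+1}) ∈ (ℂ²)^{⊗(2n+1)}`, represented by its components
with respect to spin configurations `α : Fin (2n+1) → Fin 2` (`↑ = 0`, `↓ = 1`). -/
abbrev PsiFam := (n : ℕ) → (Fin (2 * n + 1) → ℂ) → (Fin (2 * n + 1) → Fin 2) → ℂ

/-- The action of `Ř(u)` on tensor factors `i`, `j` of `(ℂ²)^{⊗L}`. -/
def applyRc (τ u : ℂ) {L : ℕ} (i j : Fin L) (ψ : (Fin L → Fin 2) → ℂ) :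
    (Fin L → Fin 2) → ℂ := fun α =>
  ∑ s : Fin 2, ∑ t : Fin 2,
    Rcheckent τ u (α i, α j) (s, t) * ψ (Function.update (Function.update α i s) j t)

/-- Spin flip. -/
def flipS : Fin 2 → Fin 2 := fun s => if s = 0 then 1 else 0

/-- Components of the singlet `s = ↑↓ − ↓↑`. -/
def singletC : Fin 2 → Fin 2 → ℂ := fun s t =>
  if s = 0 ∧ t = 1 then 1 else if s = 1 ∧ t = 0 then -1 else 0

/-- Delete the entries at positions `i`, `i+1` from a tuple. -/
def delTwo {α : Type*} {n : ℕ} (i : ℕ) (u : Fin (2 * (n + 1) + 1) → α) : Fin (2 * n + 1) → α :=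
  fun j => if _h : (j : ℕ) < i then u ⟨j, by have := j.2; omega⟩
           else u ⟨(j : ℕ) + 2, by have := j.2; omega⟩

/-- The components of `Ψ_n` are entire functions of each `u_i`. -/
def PsiEntire (Ψ : PsiFam) : Prop :=
  ∀ (n : ℕ) (u : Fin (2*n+1) → ℂ) (i : Fin (2*n+1)) (α : Fin (2*n+1) → Fin 2),
    Differentiable ℂ fun z => Ψ n (Function.update u i z) α

/-- (P1): the exchange relations. -/
def PsiP1 (τ : ℂ) (Ψ : PsiFam) : Prop :=
  ∀ (n : ℕ) (u : Fin (2*n+1) → ℂ) (i j : Fin (2*n+1)), (j : ℕ) = (i : ℕ) + 1 →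
    applyRc τ (u j - u i) i j (Ψ n u)
      = fun α => rv τ (u j - u i) * Ψ n (fun l => u (Equiv.swap i j l)) α

/-- (P2): local spin flips. -/
def PsiP2 (τ : ℂ) (Ψ : PsiFam) : Prop :=
  ∀ (n : ℕ) (u : Fin (2*n+1) → ℂ) (i : Fin (2*n+1)) (α : Fin (2*n+1) → Fin 2),
    Ψ n u (Function.update α i (flipS (α i)))
      = (-(pnome τ)) ^ n * Complex.exp (-Complex.I * ∑ j, (u j - u i))
        * Ψ n (Function.update u i (u i + Real.pi * τ)) α

/-- (P3): quasi-periodicity of `Ψ_n` in each `u_i`. -/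
def PsiP3 (τ : ℂ) (Ψ : PsiFam) : Prop :=
  ∀ (n : ℕ) (u : Fin (2*n+1) → ℂ) (i : Fin (2*n+1)),
    (Ψ n (Function.update u i (u i + Real.pi))
      = fun α => (∏ j ∈ Finset.univ.erase i, (if α j = 0 then (1:ℂ) else -1)) * Ψ n u α) ∧
    (Ψ n (Function.update u i (u i + 2 * Real.pi * τ))
      = fun α => (pnome τ ^ (4*n))⁻¹ *
          Complex.exp (-2 * Complex.I * ∑ j, (u i - u j)) * Ψ n u α)

/-- (P4): the wheel condition. -/
def PsiP4 (Ψ : PsiFam) : Prop :=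
  ∀ (n : ℕ) (u : Fin (2*n+1) → ℂ),
    (∃ i j k : Fin (2*n+1), i < j ∧ j < k ∧ u j = u i + 2*ηc ∧ u k = u i + 4*ηc) →
    Ψ n u = 0

/-- (P5): the reduction relations. -/
def PsiP5 (τ : ℂ) (Ψ : PsiFam) : Prop :=
  ∀ (n : ℕ) (u : Fin (2*(n+1)+1) → ℂ) (i : ℕ) (hi : i + 1 < 2*(n+1)+1),
    u ⟨i+1, hi⟩ = u ⟨i, by omega⟩ + 2*ηc →
    Ψ (n+1) u = fun α =>
      (∏ j ∈ (Finset.univ.erase (⟨i, by omega⟩ : Fin (2*(n+1)+1))).erase ⟨i+1, hi⟩,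
          th1 (u ⟨i, by omega⟩ - u j - 2*ηc) τ)
        * singletC (α ⟨i, by omega⟩) (α ⟨i+1, hi⟩)
        * Ψ n (delTwo i u) (delTwo i α)

/-- (P6): `Ψ₀ = ↑ + ↓`. -/
def PsiP6 (Ψ : PsiFam) : Prop := ∀ u α, Ψ 0 u α = 1

/-- The inhomogeneity parameters `(x₁,−x₁,…,x_n,−x_n,0)`. -/
def interleave {n : ℕ} (x : Fin n → ℂ) : Fin (2*n+1) → ℂ := fun j =>
  if h : (j : ℕ) < 2*n then
    (if (j : ℕ) % 2 = 0 then x ⟨(j:ℕ)/2, by omega⟩ else -x ⟨(j:ℕ)/2, by omega⟩)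
  else 0

/-- Components of `χ(x)`. -/
def chiC (τ lam x : ℂ) (s t : Fin 2) : ℂ :=
  if s = 0 ∧ t = 1 then th1 (x + lam) (2*τ) * th4 (x - lam - 2*ηc) (2*τ)
  else if s = 1 ∧ t = 0 then th1 (x - lam - 2*ηc) (2*τ) * th4 (x + lam) (2*τ)
  else 0

/-- Components of `χ̄(x)`. -/
def chibarC (τ lam x : ℂ) (s t : Fin 2) : ℂ :=
  if s = 0 ∧ t = 0 then th1 (x + lam) (2*τ) * th1 (x - lam - 2*ηc) (2*τ)
  else if s = 1 ∧ t = 1 then th4 (x - lam - 2*ηc) (2*τ) * th4 (x + lam) (2*τ)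
  else 0

/-- The scalar product `Z_n(x₁,…,x_n) = ⟨ξ_n(x₁,…,x_n), Ψ_n(x₁,−x₁,…,x_n,−x_n,0)⟩`. -/
def Zfun (τ lam : ℂ) (Ψ : PsiFam) (n : ℕ) (x : Fin n → ℂ) : ℂ :=
  ∑ α : Fin (2*n+1) → Fin 2,
    (∏ m : Fin n, chiC τ lam (x m)
        (α ⟨2*(m:ℕ), by have := m.2; omega⟩) (α ⟨2*(m:ℕ)+1, by have := m.2; omega⟩))
      * (if α ⟨2*n, by omega⟩ = 0 then (1:ℂ) else 0)
      * Ψ n (interleave x) α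

/-- The scalar product `Z̄_n^±(x₁,…,x_n)`, with `ε = ±1`. -/
def Zbarfun (τ lam ε : ℂ) (Ψ : PsiFam) (n : ℕ) (x : Fin n → ℂ) : ℂ :=
  ∑ α : Fin (2*n+1) → Fin 2,
    (∏ m : Fin n, chibarC τ lam (x m)
        (α ⟨2*(m:ℕ), by have := m.2; omega⟩) (α ⟨2*(m:ℕ)+1, by have := m.2; omega⟩))
      * (if α ⟨2*n, by omega⟩ = 0 then (1:ℂ) else ε)
      * Ψ n (interleave x) α

/-- The normalisation constant `𝒩_n`. -/
def Ncoef (τ : ℂ) (n : ℕ) : ℂ :=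
  (-1 : ℂ) ^ ((n+1)/2) * (th1 ηc τ ^ (n^2))⁻¹ * (th4 0 (2*τ) / th4 ηc (2*τ)) ^ (n*(n+1)/2)

/-- The vector `ψ_n = 𝒩_n Ψ_n(0,…,0)`. -/
def psiH (τ : ℂ) (Ψ : PsiFam) (n : ℕ) (α : Fin (2*n+1) → Fin 2) : ℂ :=
  Ncoef τ n * Ψ n (fun _ => 0) α

/-- The scalar product `S_n(μ) = ((⟨↑↓| + μ⟨↓↑|)^{⊗n} ⊗ ⟨↑|) ψ_n`. -/
def Sfun (τ : ℂ) (Ψ : PsiFam) (n : ℕ) (μ : ℂ) : ℂ :=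
  ∑ α : Fin (2*n+1) → Fin 2,
    (∏ m : Fin n,
      (if α ⟨2*(m:ℕ), by have := m.2; omega⟩ = 0 ∧ α ⟨2*(m:ℕ)+1, by have := m.2; omega⟩ = 1
        then (1:ℂ)
       else if α ⟨2*(m:ℕ), by have := m.2; omega⟩ = 1 ∧ α ⟨2*(m:ℕ)+1, by have := m.2; omega⟩ = 0
        then μ
       else 0))
      * (if α ⟨2*n, by omega⟩ = 0 then (1:ℂ) else 0) * psiH τ Ψ n α

/-- The scalar product `S̄_n^±(ν) = ((⟨↑↑| + ν⟨↓↓|)^{⊗n} ⊗ (⟨↑| ± ⟨↓|)) ψ_n`, with `ε = ±1`. -/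
def Sbarfun (τ ε : ℂ) (Ψ : PsiFam) (n : ℕ) (ν : ℂ) : ℂ :=
  ∑ α : Fin (2*n+1) → Fin 2,
    (∏ m : Fin n,
      (if α ⟨2*(m:ℕ), by have := m.2; omega⟩ = 0 ∧ α ⟨2*(m:ℕ)+1, by have := m.2; omega⟩ = 0
        then (1:ℂ)
       else if α ⟨2*(m:ℕ), by have := m.2; omega⟩ = 1 ∧ α ⟨2*(m:ℕ)+1, by have := m.2; omega⟩ = 1
        then ν
       else 0))
      * (if α ⟨2*n, by omega⟩ = 0 then (1:ℂ) else ε) * psiH τ Ψ n α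

/-- The alternating spin configuration `↑↓↑↓⋯↑`. -/
def altConf {L : ℕ} : Fin L → Fin 2 := fun j => if (j : ℕ) % 2 = 0 then 0 else 1

/-- The fully polarised spin configuration `↓⋯↓`. -/
def downConf {L : ℕ} : Fin L → Fin 2 := fun _ => 1

/-- The spin configuration `↑⋯↑↓` with a single `↓` at the last site. -/
def lastDownConf {n : ℕ} : Fin (2*n+1) → Fin 2 := fun j => if (j : ℕ) = 2*n then 1 else 0

/-- `J₂ = −1/2`. -/
def J2c : ℂ := -(1/2)
/-- `J₃ = 1/(1+ζ)`. -/
def J3c (ζ : ℂ) : ℂ := 1/(1+ζ)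
/-- `J₄ = 1/(1−ζ)`. -/
def J4c (ζ : ℂ) : ℂ := 1/(1-ζ)
/-- `μ̄ = (μ−1)²/((ζ²−1)μ)`. -/
def mubar (ζ μ : ℂ) : ℂ := (μ - 1)^2 / ((ζ^2 - 1)*μ)
/-- `ν̄ = (ν−ζ)(νζ−1)/((ζ²−1)ν)`. -/
def nubar (ζ ν : ℂ) : ℂ := (ν - ζ)*(ν*ζ - 1) / ((ζ^2 - 1)*ν)

/-- The elliptic function `w(x)`. -/
def wfun (τ x : ℂ) : ℂ :=
  th4 ηc (2*τ) / th4 0 (2*τ) * th1 x τ ^ 2 / (th1 (x - ηc) τ * th1 (x + ηc) τ)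

/-- `β₂ = η + π/2`. -/
def β2c : ℂ := ηc + (Real.pi : ℂ)/2
/-- `β₃ = η + π/2 + πτ/2`. -/
def β3c (τ : ℂ) : ℂ := ηc + (Real.pi : ℂ)/2 + (Real.pi : ℂ)*τ/2
/-- `β₄ = η + πτ/2`. -/
def β4c (τ : ℂ) : ℂ := ηc + (Real.pi : ℂ)*τ/2

/-- `f` is an (even) theta function of degree `m`, nome `p = e^{iπτ}` and norm `0`
with respect to each of its variables. -/
def ThetaLike (τ : ℂ) (m : ℕ) {n : ℕ} (X : (Fin n → ℂ) → ℂ) : Prop :=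
  ∀ (x : Fin n → ℂ) (i : Fin n),
    Differentiable ℂ (fun z => X (Function.update x i z)) ∧
    (∀ z, X (Function.update x i (z + Real.pi)) = X (Function.update x i z)) ∧
    (∀ z, X (Function.update x i (z + Real.pi * τ))
        = ((-(pnome τ)) ^ m)⁻¹ * Complex.exp (-2 * Complex.I * ((m : ℂ) * z))
            * X (Function.update x i z)) ∧
    (∀ z, X (Function.update x i (-z)) = X (Function.update x i z))

namespace EightVertex

/-! ### Zeros of quasi-periodic entire functions -/

/-- Membership in the lattice `πℤ + πτℤ`. -/
def InLat (τ z : ℂ) : Prop := ∃ m n : ℤ, z = m * (Real.pi : ℂ) + n * ((Real.pi : ℂ) * τ)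

lemma iff_add_int_mul {P : ℂ → Prop} {a : ℂ} (h : ∀ z, P (z + a) ↔ P z) (n : ℤ) (z : ℂ) :
    P (z + n * a) ↔ P z := by
  induction n using Int.induction_on with
  | zero => simp
  | succ k ih =>
    rw [← ih, ← h (z + ((k : ℤ) : ℂ) * a)]
    push_cast
    ring_nf
  | pred k ih =>
    rw [← ih, ← h (z + ((-(k : ℤ) - 1 : ℤ) : ℂ) * a)]
    push_cast
    ring_nf

/-- The product `∏ (1 - Q ^ n w)`. -/
def eProd (Q w : ℂ) : ℂ := ∏' n : ℕ, (1 + -(Q ^ n * w))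

lemma summable_eProd {Q : ℂ} (hQ : ‖Q‖ < 1) (w : ℂ) :
    Summable fun n : ℕ => ‖-(Q ^ n * w)‖ := by
  simp only [norm_neg, norm_mul, norm_pow]
  exact (summable_geometric_of_lt_one (norm_nonneg _) hQ).mul_right _

lemma eProd_succ {Q : ℂ} (hQ : ‖Q‖ < 1) (w : ℂ) :
    eProd Q w = (1 - w) * eProd Q (Q * w) := by
  have h : ∀ n : ℕ, 1 + -(Q ^ (n + 1) * w) = 1 + -(Q ^ n * (Q * w)) := fun n => by ring
  have hm : Multipliable fun n : ℕ => 1 + -(Q ^ (n + 1) * w) := by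
    simp only [h]
    exact multipliable_one_add_of_summable (summable_eProd hQ (Q * w))
  have h2 := tprod_eq_zero_mul' (f := fun n : ℕ => 1 + -(Q ^ n * w)) hm
  simp only [h, pow_zero, one_mul, ← sub_eq_add_neg] at h2
  simpa only [eProd, ← sub_eq_add_neg] using h2

lemma eProd_ne_zero {Q : ℂ} (hQ : ‖Q‖ < 1) {w : ℂ} (h : ∀ n : ℕ, Q ^ n * w ≠ 1) :
    eProd Q w ≠ 0 := by
  refine tprod_one_add_ne_zero_of_summable ?_ (summable_eProd hQ w)
  intro n hn
  exact h n (by linear_combination -hn)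

lemma differentiable_eProd {Q : ℂ} (hQ : ‖Q‖ < 1) : Differentiable ℂ (eProd Q) := by
  intro w₀
  have hK : IsOpen (Metric.ball (0 : ℂ) (‖w₀‖ + 1)) := Metric.isOpen_ball
  have hu : Summable fun n : ℕ => ‖Q‖ ^ n * (‖w₀‖ + 1) :=
    (summable_geometric_of_lt_one (norm_nonneg _) hQ).mul_right _
  have h := hu.hasProdLocallyUniformlyOn_nat_one_add (f := fun n w => -(Q ^ n * w)) hK
    (Filter.Eventually.of_forall fun n w hw => by
      rw [norm_neg, norm_mul, norm_pow]
      have : ‖w‖ < ‖w₀‖ + 1 := by simpa using hw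
      gcongr) (fun n => by fun_prop)
  have hd : DifferentiableOn ℂ (eProd Q) (Metric.ball (0 : ℂ) (‖w₀‖ + 1)) :=
    h.differentiableOn (.of_forall fun _ => by
      simpa [Finset.prod_fn] using DifferentiableOn.finsetProd (fun _ _ => by fun_prop)) hK
  exact hd.differentiableAt (hK.mem_nhds (by simp))

/-- An entire function with simple zeros exactly on the lattice `πℤ + πτℤ`. -/
def sProd (τ z : ℂ) : ℂ :=
  exp (-I * z) * (1 - exp (2 * I * z)) *
    (eProd (exp (2 * Real.pi * I * τ)) (exp (2 * Real.pi * I * τ) * exp (2 * I * z)) *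
     eProd (exp (2 * Real.pi * I * τ)) (exp (2 * Real.pi * I * τ) * exp (-2 * I * z)))

lemma norm_exp_two_pi_lt {τ : ℂ} (hτ : 0 < τ.im) : ‖exp (2 * Real.pi * I * τ)‖ < 1 := by
  rw [norm_exp]
  simp only [mul_re, re_ofNat, ofReal_re, im_ofNat, ofReal_im, mul_zero, sub_zero, I_re, mul_im,
    zero_mul, add_zero, I_im, mul_one, zero_sub, Real.exp_lt_one_iff]
  have := Real.pi_pos
  simp
  positivity

lemma exp_ne_one_of_im {n : ℕ} {τ : ℂ} (hτ : 0 < τ.im) :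
    exp (2 * Real.pi * I * τ) ^ n * exp (2 * Real.pi * I * τ) ≠ 1 := by
  intro h
  rw [← pow_succ] at h
  have h2 := congrArg norm h
  rw [norm_pow, norm_one] at h2
  exact (pow_lt_one₀ (norm_nonneg _) (norm_exp_two_pi_lt hτ) (by omega)).ne h2

lemma differentiable_sProd {τ : ℂ} (hτ : 0 < τ.im) : Differentiable ℂ (sProd τ) := by
  have h := differentiable_eProd (norm_exp_two_pi_lt hτ)
  unfold sProd
  fun_prop

lemma sProd_add_pi (τ z : ℂ) : sProd τ (z + Real.pi) = -sProd τ z := by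
  have e1 : exp (-I * (z + Real.pi)) = -exp (-I * z) := by
    rw [mul_add, exp_add, show -I * (Real.pi : ℂ) = -(Real.pi * I) by ring, exp_neg, exp_pi_mul_I]
    norm_num
  have e2 : exp (2 * I * (z + Real.pi)) = exp (2 * I * z) := by
    rw [mul_add, exp_add, show 2 * I * (Real.pi : ℂ) = 2 * Real.pi * I by ring,
      exp_two_pi_mul_I, mul_one]
  have e3 : exp (-2 * I * (z + Real.pi)) = exp (-2 * I * z) := by
    rw [mul_add, exp_add, show -2 * I * (Real.pi : ℂ) = -(2 * Real.pi * I) by ring, exp_neg,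
      exp_two_pi_mul_I]
    norm_num
  simp only [sProd, e1, e2, e3]
  ring

lemma sProd_add_pi_tau {τ : ℂ} (hτ : 0 < τ.im) (z : ℂ) :
    sProd τ (z + Real.pi * τ) = -exp (-(Real.pi * I * τ)) * exp (-2 * I * z) * sProd τ z := by
  have hQ := norm_exp_two_pi_lt hτ
  unfold sProd
  set Q := exp (2 * Real.pi * I * τ) with hQd
  have hQ0 : Q ≠ 0 := exp_ne_zero _
  set w := exp (2 * I * z) with hw
  have hw0 : w ≠ 0 := exp_ne_zero _
  have e1 : exp (2 * I * (z + Real.pi * τ)) = Q * w := by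
    rw [hQd, hw, ← exp_add]; ring_nf
  have e2 : exp (-2 * I * z) = w⁻¹ := by rw [hw, ← exp_neg]; ring_nf
  have e3 : exp (-2 * I * (z + Real.pi * τ)) = Q⁻¹ * w⁻¹ := by
    rw [hQd, hw, ← exp_neg, ← exp_neg, ← exp_add]; ring_nf
  have e4 : exp (-I * (z + Real.pi * τ)) = exp (-(Real.pi * I * τ)) * exp (-I * z) := by
    rw [← exp_add]; ring_nf
  rw [e1, e2, e3, e4, mul_inv_cancel_left₀ hQ0, eProd_succ hQ w⁻¹, eProd_succ hQ (Q * w)]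
  field_simp
  ring

lemma sProd_zero (τ : ℂ) : sProd τ 0 = 0 := by simp [sProd]

lemma deriv_sProd_zero {τ : ℂ} (hτ : 0 < τ.im) : deriv (sProd τ) 0 ≠ 0 := by
  have hE := differentiable_eProd (norm_exp_two_pi_lt hτ)
  have h1 : HasDerivAt (fun z : ℂ => 1 - exp (2 * I * z)) (-(2 * I)) 0 := by
    have := (((hasDerivAt_id (0 : ℂ)).const_mul (2 * I)).cexp).const_sub 1
    simpa using this
  set Q := exp (2 * Real.pi * I * τ) with hQd
  have hg : DifferentiableAt ℂ (fun z => exp (-I * z) * (eProd Q (Q * exp (2 * I * z)) *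
      eProd Q (Q * exp (-2 * I * z)))) 0 := by fun_prop
  have h2 := h1.mul hg.hasDerivAt
  have h3 : HasDerivAt (sProd τ) (-(2 * I) * (eProd Q Q * eProd Q Q)) 0 := by
    have h4 : sProd τ = (fun z => 1 - exp (2 * I * z)) * fun z =>
        exp (-I * z) * (eProd Q (Q * exp (2 * I * z)) * eProd Q (Q * exp (-2 * I * z))) := by
      funext z
      simp only [sProd, Pi.mul_apply, ← hQd]
      ring
    rw [h4]
    simpa using h2
  rw [h3.deriv]
  have h0 : eProd Q Q ≠ 0 := eProd_ne_zero (norm_exp_two_pi_lt hτ) fun n => exp_ne_one_of_im hτ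
  simp [h0]

lemma sProd_simple {τ : ℂ} (hτ : 0 < τ.im) {z : ℂ} (hz : InLat τ z) :
    sProd τ z = 0 ∧ deriv (sProd τ) z ≠ 0 := by
  have hd := differentiable_sProd hτ
  let P : ℂ → Prop := fun z => sProd τ z = 0 ∧ deriv (sProd τ) z ≠ 0
  have hP1 : ∀ z, P (z + Real.pi) ↔ P z := fun z => by
    have h1 : deriv (sProd τ) (z + Real.pi) = -deriv (sProd τ) z := by
      rw [← deriv_comp_add_const, funext fun z => sProd_add_pi τ z, deriv.fun_neg]
    simp only [P, h1, sProd_add_pi, neg_eq_zero, ne_eq]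
  have hP2 : ∀ z, P (z + Real.pi * τ) ↔ P z := fun z => by
    have hm : sProd τ (z + Real.pi * τ) = 0 ↔ sProd τ z = 0 := by
      rw [sProd_add_pi_tau hτ]; simp [exp_ne_zero]
    have h1 : sProd τ z = 0 → deriv (sProd τ) (z + Real.pi * τ) =
        -exp (-(Real.pi * I * τ)) * exp (-2 * I * z) * deriv (sProd τ) z := by
      intro h0
      rw [← deriv_comp_add_const, funext fun z => sProd_add_pi_tau hτ z,
        deriv_fun_mul (by fun_prop) (hd z), h0]
      simp
    constructor
    · rintro ⟨h, h'⟩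
      rw [hm] at h
      exact ⟨h, fun h'' => h' (by rw [h1 h, h'', mul_zero])⟩
    · rintro ⟨h, h'⟩
      refine ⟨hm.2 h, ?_⟩
      rw [h1 h]
      simpa [exp_ne_zero] using h'
  obtain ⟨m, n, rfl⟩ := hz
  have h0 : P 0 := ⟨sProd_zero τ, deriv_sProd_zero hτ⟩
  have := (iff_add_int_mul hP2 n (0 + m * Real.pi)).2 ((iff_add_int_mul hP1 m 0).2 h0)
  simpa [P] using this

lemma sProd_eq_zero_iff {τ : ℂ} (hτ : 0 < τ.im) {z : ℂ} : sProd τ z = 0 ↔ InLat τ z := by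
  refine ⟨fun h => ?_, fun h => (sProd_simple hτ h).1⟩
  by_contra hL
  have key : ∀ n : ℤ, exp (2 * Real.pi * I * τ * n + 2 * I * z) ≠ 1 := by
    intro n hn
    obtain ⟨m, hm⟩ := exp_eq_one_iff.1 hn
    refine hL ⟨m, -n, ?_⟩
    have h2 : (2 * I) ≠ 0 := by simp
    apply mul_left_cancel₀ h2
    push_cast
    linear_combination hm
  have hQ := norm_exp_two_pi_lt hτ
  unfold sProd at h
  have h1 : 1 - exp (2 * I * z) ≠ 0 := by
    intro h1
    apply key 0
    simp only [Int.cast_zero, mul_zero, zero_add]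
    linear_combination -h1
  have h2 : eProd (exp (2 * Real.pi * I * τ)) (exp (2 * Real.pi * I * τ) * exp (2 * I * z)) ≠ 0 := by
    refine eProd_ne_zero hQ fun n hn => key (n + 1) ?_
    rw [← hn, ← exp_nat_mul, ← exp_add, ← exp_add]
    push_cast
    ring_nf
  have h3 : eProd (exp (2 * Real.pi * I * τ)) (exp (2 * Real.pi * I * τ) * exp (-2 * I * z)) ≠ 0 := by
    refine eProd_ne_zero hQ fun n hn => key (-(n + 1)) ?_
    rw [← inv_inj, ← exp_neg, inv_one, ← hn, ← exp_nat_mul, ← exp_add, ← exp_add]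
    push_cast
    ring_nf
  exact mul_ne_zero (mul_ne_zero (exp_ne_zero _) h1) (mul_ne_zero h2 h3) h

lemma exists_entire_quotient {f s : ℂ → ℂ} (hf : Differentiable ℂ f) (hs : Differentiable ℂ s)
    (h : ∀ z, s z = 0 → f z = 0 ∧ deriv s z ≠ 0) :
    ∃ g : ℂ → ℂ, Differentiable ℂ g ∧ ∀ z, f z = g z * s z := by
  classical
  refine ⟨fun z => if s z = 0 then deriv f z / deriv s z else f z / s z, ?_, ?_⟩
  · intro z₀
    by_cases h0 : s z₀ = 0
    · have hdf : DifferentiableAt ℂ (dslope f z₀) z₀ :=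
        ((Complex.differentiableOn_dslope Filter.univ_mem).2 hf.differentiableOn).differentiableAt
          Filter.univ_mem
      have hds : DifferentiableAt ℂ (dslope s z₀) z₀ :=
        ((Complex.differentiableOn_dslope Filter.univ_mem).2 hs.differentiableOn).differentiableAt
          Filter.univ_mem
      have hne : dslope s z₀ z₀ ≠ 0 := by rw [dslope_same]; exact (h z₀ h0).2
      refine (hdf.div hds hne).congr_of_eventuallyEq ?_
      filter_upwards [hds.continuousAt.eventually_ne hne] with z hz
      by_cases hzz : z = z₀
      · subst hzz
        simp [h0]
      · have e1 : s z = (z - z₀) * dslope s z₀ z := by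
          rw [← smul_eq_mul, sub_smul_dslope, h0, sub_zero]
        have e2 : f z = (z - z₀) * dslope f z₀ z := by
          rw [← smul_eq_mul, sub_smul_dslope, (h z₀ h0).1, sub_zero]
        have hz' : z - z₀ ≠ 0 := sub_ne_zero.2 hzz
        have hsz : s z ≠ 0 := by rw [e1]; exact mul_ne_zero hz' hz
        simp only [hsz, if_false, Pi.div_apply]
        rw [e1, e2, mul_div_mul_left _ _ hz']
    · refine ((hf z₀).div (hs z₀) h0).congr_of_eventuallyEq ?_
      filter_upwards [(hs z₀).continuousAt.eventually_ne h0] with z hz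
      simp [hz]
  · intro z
    by_cases h0 : s z = 0
    · simp [h0, (h z h0).1]
    · simp [h0]

lemma eq_zero_of_mul_sProd {τ : ℂ} (hτ : 0 < τ.im) {g : ℂ → ℂ} (hg : Differentiable ℂ g) (c : ℂ)
    (h : ∀ z, g z * sProd τ (z - c) = 0) : g = 0 := by
  have hs : Differentiable ℂ fun z => sProd τ (z - c) :=
    (differentiable_sProd hτ).comp (differentiable_id.sub_const c)
  have h1 : AnalyticOnNhd ℂ g Set.univ := fun z _ => hg.analyticAt z
  have h2 : AnalyticOnNhd ℂ (fun z => sProd τ (z - c)) Set.univ := fun z _ => hs.analyticAt z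
  rcases h1.eq_zero_or_eq_zero_of_mul_eq_zero h2 (fun z _ => h z) isPreconnected_univ with h3 | h3
  · funext z; exact h3 z trivial
  · exfalso
    have h4 : sProd τ = 0 := by
      funext z
      simpa using h3 (z + c) trivial
    apply deriv_sProd_zero hτ
    rw [h4]
    simp

lemma bounded_of_double_periodic {τ : ℂ} (hτ : 0 < τ.im) {F : ℂ → ℝ} (hF : Continuous F)
    (h1 : ∀ z, F (z + Real.pi) = F z) (h2 : ∀ z, F (z + Real.pi * τ) = F z) :
    ∃ M, ∀ z, F z ≤ M := by
  have hpi := Real.pi_pos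
  let φ : ℝ × ℝ → ℂ := fun x => x.1 * (Real.pi : ℂ) + x.2 * ((Real.pi : ℂ) * τ)
  have hφ : Continuous φ := by fun_prop
  have hK : IsCompact (Set.Icc (0 : ℝ) 1 ×ˢ Set.Icc (0 : ℝ) 1) := isCompact_Icc.prod isCompact_Icc
  obtain ⟨M, hM⟩ := hK.bddAbove_image (hF.comp hφ).continuousOn
  refine ⟨M, fun z => ?_⟩
  obtain ⟨y, hy⟩ : ∃ y : ℝ, y * (Real.pi * τ.im) = z.im :=
    ⟨z.im / (Real.pi * τ.im), by field_simp⟩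
  obtain ⟨x, hx⟩ : ∃ x : ℝ, x * Real.pi = z.re - y * (Real.pi * τ.re) :=
    ⟨(z.re - y * (Real.pi * τ.re)) / Real.pi, by field_simp⟩
  have hz : z = φ (x, y) := by
    apply Complex.ext
    · simp [φ]
      linarith
    · simp [φ]
      linarith
  have hP : F (φ (Int.fract x, Int.fract y)) = F z := by
    have e : z = φ (Int.fract x, Int.fract y) + (⌊x⌋ : ℤ) * (Real.pi : ℂ)
        + (⌊y⌋ : ℤ) * ((Real.pi : ℂ) * τ) := by
      rw [hz]
      simp only [φ]
      rw [Int.fract, Int.fract]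
      push_cast
      ring
    conv_rhs => rw [e]
    have a1 := iff_add_int_mul (P := fun z => F z = F (φ (Int.fract x, Int.fract y)))
      (a := (Real.pi : ℂ) * τ) (fun z => by rw [h2]) ⌊y⌋
      (φ (Int.fract x, Int.fract y) + (⌊x⌋ : ℤ) * (Real.pi : ℂ))
    have a2 := iff_add_int_mul (P := fun z => F z = F (φ (Int.fract x, Int.fract y)))
      (a := (Real.pi : ℂ)) (fun z => by rw [h1]) ⌊x⌋ (φ (Int.fract x, Int.fract y))
    exact (a1.2 (a2.2 rfl)).symm
  rw [← hP]
  apply hM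
  refine ⟨(Int.fract x, Int.fract y), ⟨⟨?_, ?_⟩, ⟨?_, ?_⟩⟩, rfl⟩
  · exact Int.fract_nonneg x
  · exact (Int.fract_lt_one x).le
  · exact Int.fract_nonneg y
  · exact (Int.fract_lt_one y).le

lemma eq_zero_of_multiplicative_periods {τ : ℂ} (hτ : 0 < τ.im) {f : ℂ → ℂ}
    (hf : Differentiable ℂ f) {σ C : ℂ} (hσ : ‖σ‖ = 1) (h1 : ∀ z, f (z + Real.pi) = σ * f z)
    (h2 : ∀ z, f (z + Real.pi * τ) = C * f z) {c : ℂ} (hc : f c = 0) : f = 0 := by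
  by_cases hC : C = 0
  · funext z
    have := h2 (z - Real.pi * τ)
    simpa [hC] using this
  have hpi := Real.pi_pos
  set β : ℝ := Real.log ‖C‖ / (Real.pi * τ.im) with hβ
  let g : ℂ → ℂ := fun z => exp (β * I * z) * f z
  have hg : Differentiable ℂ g := by fun_prop
  have hb : ∃ M, ∀ z, ‖g z‖ ≤ M := by
    refine bounded_of_double_periodic hτ (F := fun z => ‖g z‖) hg.continuous.norm ?_ ?_
    · intro z
      simp only [g, h1, norm_mul, hσ, one_mul, norm_exp]
      simp
    · intro z
      have e : Real.exp (-(β * (Real.pi * τ.im))) * ‖C‖ = 1 := by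
        have : β * (Real.pi * τ.im) = Real.log ‖C‖ := by
          rw [hβ]; field_simp
        rw [this, Real.exp_neg, Real.exp_log (norm_pos_iff.2 hC)]
        exact inv_mul_cancel₀ (norm_ne_zero_iff.2 hC)
      simp only [g, h2, norm_mul, norm_exp]
      have e2 : (β * I * (z + Real.pi * τ)).re = (β * I * z).re + -(β * (Real.pi * τ.im)) := by
        simp
        ring
      rw [e2, Real.exp_add]
      linear_combination Real.exp ((β * I * z).re) * ‖f z‖ * e
  obtain ⟨M, hM⟩ := hb
  have hbd : Bornology.IsBounded (Set.range g) :=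
    isBounded_iff_forall_norm_le.2 ⟨M, by rintro _ ⟨z, rfl⟩; exact hM z⟩
  funext z
  have := hg.apply_eq_apply_of_bounded hbd z c
  simpa [g, hc, exp_ne_zero] using this

/-- An entire function with the quasi-periodicity of a theta function of degree `N` that vanishes
at `N + 1` points incongruent modulo the lattice is zero. -/
theorem eq_zero_of_theta_like {τ : ℂ} (hτ : 0 < τ.im) (l : List ℂ) :
    ∀ (N : ℕ) {f : ℂ → ℂ} (_ : Differentiable ℂ f) {σ C : ℂ} (_ : ‖σ‖ = 1)
    (_ : ∀ z, f (z + Real.pi) = σ * f z)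
    (_ : ∀ z, f (z + Real.pi * τ) = C * exp (-2 * I * (N * z)) * f z)
    (_ : N < l.length) (_ : l.Pairwise fun a b => ¬ InLat τ (a - b))
    (_ : ∀ a ∈ l, f a = 0), f = 0 := by
  induction l with
  | nil => intro N f _ _ _ _ _ _ h; simp at h
  | cons c l ih =>
    intro N f hf σ C hσ h1 h2 hN hl hz
    cases N with
    | zero =>
      exact eq_zero_of_multiplicative_periods hτ hf hσ h1 (C := C) (by simpa using h2)
        (hz c (by simp))
    | succ N =>
      by_cases hC : C = 0
      · funext z
        have := h2 (z - Real.pi * τ)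
        simpa [hC] using this
      have hs : Differentiable ℂ fun z => sProd τ (z - c) :=
        (differentiable_sProd hτ).comp (differentiable_id.sub_const c)
      obtain ⟨g, hg, hfg⟩ := exists_entire_quotient hf hs (fun z hz0 => by
        have hL := (sProd_eq_zero_iff hτ).1 hz0
        constructor
        · obtain ⟨m, n, hmn⟩ := hL
          have hσ0 : σ ≠ 0 := by intro h; simp [h] at hσ
          have a1 := iff_add_int_mul (P := fun z => f z = 0) (a := (Real.pi : ℂ) * τ)
            (fun z => by simp [h2, hC, exp_ne_zero]) n (c + m * (Real.pi : ℂ))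
          have a2 := iff_add_int_mul (P := fun z => f z = 0) (a := (Real.pi : ℂ))
            (fun z => by simp [h1, hσ0]) m c
          have := a1.2 (a2.2 (hz c (by simp)))
          rwa [add_assoc, ← hmn, add_sub_cancel] at this
        · rw [deriv_comp_sub_const]
          exact (sProd_simple hτ hL).2)
      have hg0 : g = 0 := by
        have p1 : (fun z => g (z + Real.pi) - -σ * g z) = 0 := by
          refine eq_zero_of_mul_sProd hτ (by fun_prop) c fun z => ?_
          have e := h1 z
          rw [hfg, hfg, show z + (Real.pi : ℂ) - c = z - c + Real.pi by ring, sProd_add_pi] at e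
          linear_combination -e
        have p2 : (fun z => g (z + Real.pi * τ) - (-C * exp (Real.pi * I * τ) * exp (-2 * I * c)) *
            exp (-2 * I * (N * z)) * g z) = 0 := by
          refine eq_zero_of_mul_sProd hτ (by fun_prop) c fun z => ?_
          have e := h2 z
          rw [hfg, hfg, show z + (Real.pi : ℂ) * τ - c = z - c + Real.pi * τ by ring,
            sProd_add_pi_tau hτ] at e
          have e1 : exp (-(Real.pi * I * τ)) = (exp (Real.pi * I * τ))⁻¹ := exp_neg _
          have e2 : exp (-2 * I * (z - c)) = exp (-2 * I * z) * (exp (-2 * I * c))⁻¹ := by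
            rw [← exp_neg, ← exp_add]; ring_nf
          have e3 : exp (-2 * I * ((N + 1 : ℕ) * z)) = exp (-2 * I * (N * z)) * exp (-2 * I * z) := by
            rw [← exp_add]; push_cast; ring_nf
          rw [e1, e2, e3] at e
          have n1 := exp_ne_zero (Real.pi * I * τ)
          have n2 := exp_ne_zero (-2 * I * c)
          have n3 := exp_ne_zero (-2 * I * z)
          set A := exp (Real.pi * I * τ)
          set B := exp (-2 * I * c)
          set D := exp (-2 * I * z)
          set X := exp (-2 * I * (N * z))
          field_simp at e
          linear_combination -e
        refine ih N hg (σ := -σ) (C := -C * exp (Real.pi * I * τ) * exp (-2 * I * c))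
          (by simpa using hσ) (fun z => sub_eq_zero.1 (congrFun p1 z))
          (fun z => sub_eq_zero.1 (congrFun p2 z)) (by simpa using hN)
          (List.pairwise_cons.1 hl).2 fun a ha => ?_
        have h3 := hz a (by simp [ha])
        rw [hfg] at h3
        refine (mul_eq_zero.1 h3).resolve_right fun h4 => ?_
        apply (List.pairwise_cons.1 hl).1 a ha
        obtain ⟨m, n, hmn⟩ := (sProd_eq_zero_iff hτ).1 h4
        exact ⟨-m, -n, by push_cast; linear_combination -hmn⟩
      funext z
      rw [hfg, hg0]
      simp

/-- Interpolation: theta-like functions of a given type are recovered linearly from finitely many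
values. -/
theorem exists_interpolation {τ : ℂ} (hτ : 0 < τ.im) (N : ℕ) {σ C : ℂ} (hσ : ‖σ‖ = 1) :
    ∃ (c : Fin (N + 1) → ℂ) (L : Fin (N + 1) → ℂ → ℂ), (∀ s, Differentiable ℂ (L s)) ∧
      ∀ f : ℂ → ℂ, Differentiable ℂ f → (∀ z, f (z + Real.pi) = σ * f z) →
        (∀ z, f (z + Real.pi * τ) = C * exp (-2 * I * (N * z)) * f z) →
        ∀ z, f z = ∑ s, f (c s) * L s z := by
  let V : Submodule ℂ (ℂ → ℂ) :=
    { carrier := {f | Differentiable ℂ f ∧ (∀ z, f (z + Real.pi) = σ * f z) ∧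
        (∀ z, f (z + Real.pi * τ) = C * exp (-2 * I * (N * z)) * f z)}
      add_mem' := by
        rintro f g ⟨a1, a2, a3⟩ ⟨b1, b2, b3⟩
        refine ⟨a1.add b1, fun z => ?_, fun z => ?_⟩
        · simp only [Pi.add_apply, a2, b2]; ring
        · simp only [Pi.add_apply, a3, b3]; ring
      zero_mem' := ⟨differentiable_const 0, by simp, by simp⟩
      smul_mem' := by
        rintro k f ⟨a1, a2, a3⟩
        refine ⟨a1.const_smul k, fun z => ?_, fun z => ?_⟩
        · simp only [Pi.smul_apply, smul_eq_mul, a2]; ring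
        · simp only [Pi.smul_apply, smul_eq_mul, a3]; ring }
  let c : Fin (N + 1) → ℂ := fun s => (s : ℂ) * Real.pi / (N + 1)
  let ev : V →ₗ[ℂ] (Fin (N + 1) → ℂ) :=
    { toFun := fun f s => f.1 (c s), map_add' := fun _ _ => rfl, map_smul' := fun _ _ => rfl }
  have hinj : LinearMap.ker ev = ⊥ := by
    rw [LinearMap.ker_eq_bot']
    rintro ⟨f, a1, a2, a3⟩ hf
    have hpi : (Real.pi : ℂ) ≠ 0 := by exact_mod_cast Real.pi_ne_zero
    have hN1 : (N : ℂ) + 1 ≠ 0 := by exact_mod_cast Nat.succ_ne_zero N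
    have : f = 0 := by
      refine eq_zero_of_theta_like hτ (List.ofFn c) N a1 hσ a2 a3 (by simp) ?_ ?_
      · rw [List.pairwise_ofFn]
        rintro i j hij ⟨m, n, hmn⟩
        have him := congrArg Complex.im hmn
        have h0 : n = 0 := by
          have e : c i - c j = (((i : ℝ) - j) * Real.pi / (N + 1) : ℝ) := by
            simp only [c]; push_cast; ring
          rw [e, ofReal_im] at him
          simp only [add_im, mul_im, intCast_re, ofReal_im, mul_zero, intCast_im, ofReal_re,
            zero_mul, add_zero, zero_add] at him
          have : (n : ℝ) * (Real.pi * τ.im) = 0 := by linarith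
          rcases mul_eq_zero.1 this with h | h
          · exact_mod_cast h
          · exact absurd h (by have := Real.pi_pos; positivity)
        subst h0
        have e2 : ((i : ℂ) - j) = m * (N + 1) := by
          simp only [c, Int.cast_zero, zero_mul, add_zero] at hmn
          field_simp at hmn
          linear_combination hmn
        have e3 : ((i : ℕ) : ℤ) - (j : ℕ) = m * (N + 1) := by exact_mod_cast e2
        have hi := i.2
        have hj := j.2
        have hij' : (i : ℕ) < j := hij
        have hm0 : m < 0 := by
          by_contra hm
          push Not at hm
          have : 0 ≤ m * ((N : ℤ) + 1) := by positivity
          omega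
        have : m * ((N : ℤ) + 1) ≤ -1 * (N + 1) := by
          apply mul_le_mul_of_nonneg_right <;> omega
        omega
      · intro a ha
        obtain ⟨s, rfl⟩ := (List.mem_ofFn' _ _).1 ha
        exact congrFun hf s
    exact Subtype.ext this
  obtain ⟨L, hL⟩ := ev.exists_leftInverse_of_injective hinj
  refine ⟨c, fun s => (L (Pi.single s 1)).1, fun s => (L (Pi.single s 1)).2.1, ?_⟩
  intro f a1 a2 a3 z
  have h := congrArg Subtype.val (LinearMap.congr_fun hL ⟨f, a1, a2, a3⟩)
  simp only [LinearMap.comp_apply, LinearMap.id_apply] at h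
  rw [LinearMap.pi_apply_eq_sum_univ L] at h
  have h' := congrFun h z
  simp only [Submodule.coe_sum, Submodule.coe_smul, Finset.sum_apply, Pi.smul_apply,
    smul_eq_mul] at h'
  rw [← h']
  refine Finset.sum_congr rfl fun s _ => ?_
  have : (Pi.single s 1 : Fin (N + 1) → ℂ) = fun j => if s = j then 1 else 0 := by
    funext j; simp [Pi.single_apply, eq_comm]
  beta_reduce
  rw [this]
  rfl

lemma neg_one_zpow_eq_exp (n : ℤ) : (-1 : ℂ) ^ n = exp (n * (Real.pi * I)) := by
  rw [exp_int_mul, exp_pi_mul_I]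

lemma th3_eq (z τ : ℂ) : th3 z τ = jacobiTheta₂ (z / Real.pi) τ := by
  have hpi : (Real.pi : ℂ) ≠ 0 := by exact_mod_cast Real.pi_ne_zero
  refine tsum_congr fun n => ?_
  rw [jacobiTheta₂_term]
  congr 1
  field_simp
  ring

lemma th4_eq (z τ : ℂ) : th4 z τ = th3 (z + Real.pi / 2) τ := by
  refine tsum_congr fun n => ?_
  rw [neg_one_zpow_eq_exp, ← exp_add]
  congr 1
  ring

lemma th2_eq (z τ : ℂ) : th2 z τ =
    exp (Real.pi * I * τ / 4 + I * z) * th3 (z + Real.pi * τ / 2) τ := by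
  rw [th3, ← tsum_mul_left]
  refine tsum_congr fun n => ?_
  rw [← exp_add]
  congr 1
  ring

lemma th1_eq_th2 (z τ : ℂ) : th1 z τ = -th2 (z + Real.pi / 2) τ := by
  rw [th1, th2, neg_mul, ← tsum_mul_left]
  congr 1
  refine tsum_congr fun n => ?_
  have hI : I = exp (Real.pi / 2 * I) := exp_pi_div_two_mul_I.symm
  rw [neg_one_zpow_eq_exp]
  nth_rewrite 1 [hI]
  rw [← exp_add, ← exp_add]
  congr 1
  ring

lemma th1_eq (z τ : ℂ) : th1 z τ =
    -I * exp (Real.pi * I * τ / 4 + I * z) * th4 (z + Real.pi * τ / 2) τ := by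
  rw [th1, th4, mul_assoc (-I)]
  refine congrArg (fun x => -I * x) ?_
  rw [← tsum_mul_left]
  refine tsum_congr fun n => ?_
  rw [mul_left_comm, ← exp_add]
  congr 2
  ring

lemma differentiable_th3 {τ : ℂ} (hτ : 0 < τ.im) : Differentiable ℂ fun z => th3 z τ := by
  simp only [th3_eq]
  intro z
  have h : DifferentiableAt ℂ (fun z : ℂ => z / (Real.pi : ℂ)) z := by fun_prop
  exact (differentiableAt_jacobiTheta₂_fst (z / Real.pi) hτ).comp z h

lemma differentiable_th4 {τ : ℂ} (hτ : 0 < τ.im) : Differentiable ℂ fun z => th4 z τ := by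
  simp only [th4_eq]
  exact (differentiable_th3 hτ).comp (differentiable_id.add_const _)

lemma differentiable_th1 {τ : ℂ} (hτ : 0 < τ.im) : Differentiable ℂ fun z => th1 z τ := by
  simp only [th1_eq]
  have := (differentiable_th4 hτ).comp (differentiable_id.add_const (Real.pi * τ / 2))
  simp only [Function.comp_def, id] at this
  fun_prop

lemma th3_neg (z τ : ℂ) : th3 (-z) τ = th3 z τ := by
  rw [th3_eq, th3_eq, neg_div, jacobiTheta₂_neg_left]

lemma th3_add_pi (z τ : ℂ) : th3 (z + Real.pi) τ = th3 z τ := by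
  have hpi : (Real.pi : ℂ) ≠ 0 := by exact_mod_cast Real.pi_ne_zero
  rw [th3_eq, th3_eq, add_div, div_self hpi, jacobiTheta₂_add_left]

lemma th3_add_pi_tau (z τ : ℂ) :
    th3 (z + Real.pi * τ) τ = exp (-(Real.pi * I * τ) - 2 * I * z) * th3 z τ := by
  have hpi : (Real.pi : ℂ) ≠ 0 := by exact_mod_cast Real.pi_ne_zero
  rw [th3_eq, th3_eq, add_div, mul_div_cancel_left₀ _ hpi, jacobiTheta₂_add_left']
  congr 2
  field_simp
  ring

lemma th4_add_pi (z τ : ℂ) : th4 (z + Real.pi) τ = th4 z τ := by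
  rw [th4_eq, th4_eq, add_right_comm, th3_add_pi]

lemma th4_neg (z τ : ℂ) : th4 (-z) τ = th4 z τ := by
  rw [th4_eq, th4_eq, ← th3_neg, ← th3_add_pi]
  congr 1
  ring

lemma th4_add_pi_tau (z τ : ℂ) :
    th4 (z + Real.pi * τ) τ = -exp (-(Real.pi * I * τ) - 2 * I * z) * th4 z τ := by
  rw [th4_eq, th4_eq, add_right_comm, th3_add_pi_tau]
  congr 1
  rw [show -(Real.pi * I * τ) - 2 * I * (z + Real.pi / 2)
    = -(Real.pi * I * τ) - 2 * I * z - Real.pi * I by ring, exp_sub _ (Real.pi * I), exp_pi_mul_I]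
  ring

lemma th1_add_pi (z τ : ℂ) : th1 (z + Real.pi) τ = -th1 z τ := by
  rw [th1_eq, th1_eq, add_right_comm, th4_add_pi,
    show Real.pi * I * τ / 4 + I * (z + Real.pi) = Real.pi * I * τ / 4 + I * z + Real.pi * I by ring,
    exp_add _ (Real.pi * I), exp_pi_mul_I]
  ring

lemma th1_neg (z τ : ℂ) : th1 (-z) τ = -th1 z τ := by
  rw [th1_eq, th1_eq, ← th4_neg (-z + _),
    show z + Real.pi * τ / 2 = -(-z + Real.pi * τ / 2) + Real.pi * τ by ring, th4_add_pi_tau]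
  have : exp (Real.pi * I * τ / 4 + I * -z) =
      exp (Real.pi * I * τ / 4 + I * z) * exp (-(2 * I * z)) := by rw [← exp_add]; ring_nf
  rw [this]
  have : -(Real.pi * I * τ) - 2 * I * -(-z + Real.pi * τ / 2) = -(2 * I * z) := by ring
  rw [this]
  ring

lemma th1_add_pi_tau (z τ : ℂ) :
    th1 (z + Real.pi * τ) τ = -exp (-(Real.pi * I * τ) - 2 * I * z) * th1 z τ := by
  rw [th1_eq, th1_eq, add_right_comm, th4_add_pi_tau]
  have : exp (Real.pi * I * τ / 4 + I * (z + Real.pi * τ)) *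
      exp (-(Real.pi * I * τ) - 2 * I * (z + Real.pi * τ / 2)) =
      exp (Real.pi * I * τ / 4 + I * z) * exp (-(Real.pi * I * τ) - 2 * I * z) := by
    rw [← exp_add, ← exp_add]; ring_nf
  linear_combination (I * th4 (z + Real.pi * τ / 2) τ) * this

lemma th4_add_half (z τ : ℂ) : th4 (z + Real.pi * τ) (2 * τ) =
    I * exp (-(Real.pi * I * τ / 2) - I * z) * th1 z (2 * τ) := by
  rw [th1_eq, show z + Real.pi * (2 * τ) / 2 = z + Real.pi * τ by ring]
  have : exp (-(Real.pi * I * τ / 2) - I * z) * exp (Real.pi * I * (2 * τ) / 4 + I * z) = 1 := by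
    rw [← exp_add, ← exp_zero]; ring_nf
  linear_combination (-(th4 (z + Real.pi * τ) (2 * τ))) * this + (th4 (z + Real.pi * τ) (2 * τ)) *
    exp (-(Real.pi * I * τ / 2) - I * z) * exp (Real.pi * I * (2 * τ) / 4 + I * z) * I_sq

lemma th1_add_half (z τ : ℂ) : th1 (z + Real.pi * τ) (2 * τ) =
    I * exp (-(Real.pi * I * τ / 2) - I * z) * th4 z (2 * τ) := by
  rw [th1_eq, show z + Real.pi * τ + Real.pi * (2 * τ) / 2 = z + Real.pi * (2 * τ) by ring,
    th4_add_pi_tau]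
  have : exp (Real.pi * I * (2 * τ) / 4 + I * (z + Real.pi * τ)) *
      exp (-(Real.pi * I * (2 * τ)) - 2 * I * z) = exp (-(Real.pi * I * τ / 2) - I * z) := by
    rw [← exp_add]; ring_nf
  linear_combination (I * th4 z (2 * τ)) * this

lemma integral_jacobiTheta {τ : ℂ} (hτ : 0 < τ.im) :
    ∫ x in (0 : ℝ)..1, jacobiTheta₂ x τ = 1 := by
  have hc : ∀ n : ℤ, Continuous fun x : ℝ => jacobiTheta₂_term n x τ := by
    intro n; unfold jacobiTheta₂_term; fun_prop
  have hn : ∀ (n : ℤ) (x : ℝ), ‖jacobiTheta₂_term n x τ‖ = ‖jacobiTheta₂_term n 0 τ‖ := by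
    intro n x; simp [norm_jacobiTheta₂_term]
  have h := intervalIntegral.hasSum_intervalIntegral_of_summable_norm (a := 0) (b := 1)
    (f := fun n : ℤ => (⟨fun x : ℝ => jacobiTheta₂_term n x τ, hc n⟩ : C(ℝ, ℂ))) (by
      refine Summable.of_nonneg_of_le (fun n => norm_nonneg _) (fun n => ?_)
        ((summable_jacobiTheta₂_term_iff 0 τ).2 hτ).norm
      refine (ContinuousMap.norm_le _ (norm_nonneg _)).2 fun x => ?_
      simp [hn])
  simp only [ContinuousMap.coe_mk] at h
  have h2 : ∀ n : ℤ, ∫ x in (0 : ℝ)..1, jacobiTheta₂_term n x τ = if n = 0 then 1 else 0 := by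
    intro n
    by_cases h0 : n = 0
    · simp [h0, jacobiTheta₂_term]
    · have hpi : (Real.pi : ℂ) ≠ 0 := by exact_mod_cast Real.pi_ne_zero
      have hne : 2 * Real.pi * I * (n : ℂ) ≠ 0 := by simp [h0, hpi]
      simp only [jacobiTheta₂_term, exp_add, h0, if_false, intervalIntegral.integral_mul_const]
      rw [integral_exp_mul_complex hne]
      have : exp (2 * Real.pi * I * n * (1 : ℝ)) = 1 := by
        rw [ofReal_one, mul_one, mul_comm, exp_int_mul_two_pi_mul_I]
      rw [this]
      simp
  simp only [h2] at h
  have h3 := h.unique (hasSum_ite_eq (0 : ℤ) (1 : ℂ))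
  exact h3

lemma exists_th1_ne_zero {τ : ℂ} (hτ : 0 < τ.im) : ∃ z, th1 z τ ≠ 0 := by
  by_contra hcon
  push Not at hcon
  have h3 : ∀ z, th3 z τ = 0 := by
    intro z
    have := hcon (z - Real.pi * τ / 2 - Real.pi / 2)
    rw [th1_eq_th2, th2_eq] at this
    simpa [exp_ne_zero] using this
  have h4 := integral_jacobiTheta hτ
  have h5 : ∀ x : ℝ, jacobiTheta₂ x τ = 0 := by
    intro x
    have hpi : (Real.pi : ℂ) ≠ 0 := by exact_mod_cast Real.pi_ne_zero
    have := h3 (x * Real.pi)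
    rwa [th3_eq, mul_div_cancel_right₀ _ hpi] at this
  simp [h5] at h4

lemma th1_zero (τ : ℂ) : th1 0 τ = 0 := by
  have := th1_neg 0 τ
  rw [neg_zero] at this
  linear_combination this / 2

lemma th1_eq_sProd {τ : ℂ} (hτ : 0 < τ.im) : ∃ c : ℂ, c ≠ 0 ∧ ∀ z, th1 z τ = c * sProd τ z := by
  obtain ⟨g, hg, hfg⟩ := exists_entire_quotient (differentiable_th1 hτ) (differentiable_sProd hτ)
    (fun z hz => by
      obtain ⟨m, n, hmn⟩ := (sProd_eq_zero_iff hτ).1 hz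
      refine ⟨?_, (sProd_simple hτ ⟨m, n, hmn⟩).2⟩
      have a1 := iff_add_int_mul (P := fun z => th1 z τ = 0) (a := (Real.pi : ℂ) * τ)
        (fun z => by simp [th1_add_pi_tau, exp_ne_zero]) n (0 + m * (Real.pi : ℂ))
      have a2 := iff_add_int_mul (P := fun z => th1 z τ = 0) (a := (Real.pi : ℂ))
        (fun z => by simp [th1_add_pi]) m 0
      have := a1.2 (a2.2 (th1_zero τ))
      rwa [zero_add, ← hmn] at this)
  have p1 : (fun z => g (z + Real.pi) - g z) = 0 := by
    refine eq_zero_of_mul_sProd hτ (by fun_prop) 0 fun z => ?_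
    have e := th1_add_pi z τ
    rw [hfg, hfg, sProd_add_pi] at e
    rw [sub_zero]
    linear_combination -e
  have p2 : (fun z => g (z + Real.pi * τ) - g z) = 0 := by
    refine eq_zero_of_mul_sProd hτ (by fun_prop) 0 fun z => ?_
    have e := th1_add_pi_tau z τ
    rw [hfg, hfg, sProd_add_pi_tau hτ, exp_sub, show -2 * I * z = -(2 * I * z) by ring,
      exp_neg (2 * I * z)] at e
    have n1 := exp_ne_zero (-(Real.pi * I * τ))
    have n2 := exp_ne_zero (2 * I * z)
    set A := exp (-(Real.pi * I * τ))
    set B := exp (2 * I * z)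
    rw [sub_zero]
    field_simp at e
    linear_combination -e
  have p3 : (fun z => g z - g 0) = 0 := by
    refine eq_zero_of_multiplicative_periods hτ (by fun_prop) (σ := 1) (C := 1) (by simp) ?_ ?_
      (c := 0) (by simp)
    · intro z
      have := congrFun p1 z
      simp only [Pi.zero_apply] at this
      linear_combination this
    · intro z
      have := congrFun p2 z
      simp only [Pi.zero_apply] at this
      linear_combination this
  have p4 : ∀ z, th1 z τ = g 0 * sProd τ z := by
    intro z
    rw [hfg]
    have := congrFun p3 z
    simp only [Pi.zero_apply] at this
    linear_combination sProd τ z * this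
  refine ⟨g 0, fun h0 => ?_, p4⟩
  obtain ⟨z, hz⟩ := exists_th1_ne_zero hτ
  apply hz
  rw [p4, h0, zero_mul]

theorem th1_eq_zero_iff {τ : ℂ} (hτ : 0 < τ.im) {z : ℂ} : th1 z τ = 0 ↔ InLat τ z := by
  obtain ⟨c, hc, h⟩ := th1_eq_sProd hτ
  rw [h, mul_eq_zero, sProd_eq_zero_iff hτ]
  simp [hc]

theorem th4_eq_zero_iff {τ : ℂ} (hτ : 0 < τ.im) {z : ℂ} :
    th4 z τ = 0 ↔ InLat τ (z - Real.pi * τ / 2) := by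
  rw [← th1_eq_zero_iff hτ, th1_eq, sub_add_cancel]
  simp [exp_ne_zero]

/-- `(a, b) ↦ (a + b, a - b)` and `(a, b) ↦ (a + b + 1, a - b)` together cover `ℤ × ℤ`. -/
def parityEquiv : (ℤ × ℤ) ⊕ (ℤ × ℤ) ≃ ℤ × ℤ :=
  Equiv.ofBijective
    (Sum.elim (fun q => (q.1 + q.2, q.1 - q.2)) (fun q => (q.1 + q.2 + 1, q.1 - q.2))) (by
      constructor
      · rintro (⟨a, b⟩ | ⟨a, b⟩) (⟨c, d⟩ | ⟨c, d⟩) h <;>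
          simp only [Sum.elim_inl, Sum.elim_inr, Prod.mk.injEq] at h
        · simp only [Sum.inl.injEq, Prod.mk.injEq]; omega
        · omega
        · omega
        · simp only [Sum.inr.injEq, Prod.mk.injEq]; omega
      · rintro ⟨m, n⟩
        rcases Int.even_or_odd' (m + n) with ⟨k, hk | hk⟩
        · exact ⟨Sum.inl (k, m - k), by simp only [Sum.elim_inl, Prod.mk.injEq]; omega⟩
        · exact ⟨Sum.inr (k, m - k - 1), by simp only [Sum.elim_inr, Prod.mk.injEq]; omega⟩)

lemma parityEquiv_inl (q : ℤ × ℤ) : parityEquiv (Sum.inl q) = (q.1 + q.2, q.1 - q.2) := rfl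

lemma parityEquiv_inr (q : ℤ × ℤ) : parityEquiv (Sum.inr q) = (q.1 + q.2 + 1, q.1 - q.2) := rfl

lemma summable_th3 {τ : ℂ} (hτ : 0 < τ.im) (z : ℂ) : Summable fun n : ℤ =>
    exp ((Real.pi : ℂ) * I * τ * (n : ℂ) ^ 2 + 2 * (n : ℂ) * I * z) := by
  have hpi : (Real.pi : ℂ) ≠ 0 := by exact_mod_cast Real.pi_ne_zero
  refine ((summable_jacobiTheta₂_term_iff (z / Real.pi) τ).2 hτ).congr fun n => ?_
  rw [jacobiTheta₂_term]
  congr 1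
  field_simp
  ring

lemma summable_th2 {τ : ℂ} (hτ : 0 < τ.im) (z : ℂ) : Summable fun n : ℤ =>
    exp ((Real.pi : ℂ) * I * τ * ((n : ℂ) + 1/2) ^ 2 + (2 * (n : ℂ) + 1) * I * z) := by
  refine ((summable_th3 hτ (z + Real.pi * τ / 2)).mul_left
    (exp (Real.pi * I * τ / 4 + I * z))).congr fun n => ?_
  rw [← exp_add]
  congr 1
  ring

lemma two_mul_im {τ : ℂ} (hτ : 0 < τ.im) : 0 < (2 * τ).im := by simpa using hτ

theorem th3_mul_th3 {τ : ℂ} (hτ : 0 < τ.im) (x y : ℂ) :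
    th3 (x + y) τ * th3 (x - y) τ =
      th3 (2 * x) (2 * τ) * th3 (2 * y) (2 * τ) + th2 (2 * x) (2 * τ) * th2 (2 * y) (2 * τ) := by
  have h2 := two_mul_im hτ
  have e1 := tsum_mul_tsum_of_summable_norm (summable_th3 hτ (x + y)).norm
    (summable_th3 hτ (x - y)).norm
  have e2 := tsum_mul_tsum_of_summable_norm (summable_th3 h2 (2 * x)).norm
    (summable_th3 h2 (2 * y)).norm
  have e3 := tsum_mul_tsum_of_summable_norm (summable_th2 h2 (2 * x)).norm
    (summable_th2 h2 (2 * y)).norm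
  have s2 := summable_mul_of_summable_norm (summable_th3 h2 (2 * x)).norm
    (summable_th3 h2 (2 * y)).norm
  have s3 := summable_mul_of_summable_norm (summable_th2 h2 (2 * x)).norm
    (summable_th2 h2 (2 * y)).norm
  rw [th3, th3, th3, th3, th2, th2, e1, e2, e3, ← parityEquiv.tsum_eq]
  refine (HasSum.sum ?_ ?_).tsum_eq
  · refine s2.hasSum.congr_fun ?_
    intro q
    simp only [parityEquiv_inl, Function.comp, ← exp_add]
    congr 1
    push_cast
    ring
  · refine s3.hasSum.congr_fun ?_
    intro q
    simp only [parityEquiv_inr, Function.comp, ← exp_add]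
    congr 1
    push_cast
    ring

lemma th2_neg (z τ : ℂ) : th2 (-z) τ = th2 z τ := by
  have h : ∀ z, th2 z τ = -th1 (z - Real.pi / 2) τ := by
    intro z; rw [th1_eq_th2, sub_add_cancel, neg_neg]
  rw [h, h, ← th1_neg, ← th1_add_pi]
  congr 1
  ring

lemma th2_add_pi (z τ : ℂ) : th2 (z + Real.pi) τ = -th2 z τ := by
  have h : ∀ z, th2 z τ = -th1 (z - Real.pi / 2) τ := by
    intro z; rw [th1_eq_th2, sub_add_cancel, neg_neg]
  rw [h, h, add_sub_right_comm, th1_add_pi]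

lemma th3_add_half (z τ : ℂ) : th3 (z + Real.pi * τ) (2 * τ) =
    exp (-(Real.pi * I * τ / 2) - I * z) * th2 z (2 * τ) := by
  rw [th2_eq, show z + Real.pi * (2 * τ) / 2 = z + Real.pi * τ by ring, ← mul_assoc, ← exp_add,
    show -(Real.pi * I * τ / 2) - I * z + (Real.pi * I * (2 * τ) / 4 + I * z) = 0 by ring,
    exp_zero, one_mul]

lemma th2_add_half (z τ : ℂ) : th2 (z + Real.pi * τ) (2 * τ) =
    exp (-(Real.pi * I * τ / 2) - I * z) * th3 z (2 * τ) := by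
  rw [th2_eq, show z + Real.pi * τ + Real.pi * (2 * τ) / 2 = z + Real.pi * (2 * τ) by ring,
    th3_add_pi_tau, ← mul_assoc, ← exp_add]
  congr 2
  ring

theorem th2_mul_th2 {τ : ℂ} (hτ : 0 < τ.im) (x y : ℂ) :
    th2 (x + y) τ * th2 (x - y) τ =
      th2 (2 * x) (2 * τ) * th3 (2 * y) (2 * τ) + th3 (2 * x) (2 * τ) * th2 (2 * y) (2 * τ) := by
  have h := th3_mul_th3 hτ (x + Real.pi * τ / 2) y
  rw [show 2 * (x + Real.pi * τ / 2) = 2 * x + Real.pi * τ by ring, th3_add_half, th2_add_half] at h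
  rw [th2_eq, th2_eq, show x + y + Real.pi * τ / 2 = x + Real.pi * τ / 2 + y by ring,
    show x - y + Real.pi * τ / 2 = x + Real.pi * τ / 2 - y by ring]
  have e : exp (Real.pi * I * τ / 4 + I * (x + y)) * exp (Real.pi * I * τ / 4 + I * (x - y)) *
      exp (-(Real.pi * I * τ / 2) - I * (2 * x)) = 1 := by
    rw [← exp_add, ← exp_add, ← exp_zero]; ring_nf
  linear_combination exp (Real.pi * I * τ / 4 + I * (x + y)) *
    exp (Real.pi * I * τ / 4 + I * (x - y)) * h + (th2 (2 * x) (2 * τ) * th3 (2 * y) (2 * τ) +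
    th3 (2 * x) (2 * τ) * th2 (2 * y) (2 * τ)) * e

theorem th1_mul_th1 {τ : ℂ} (hτ : 0 < τ.im) (x y : ℂ) :
    th1 (x + y) τ * th1 (x - y) τ =
      th3 (2 * x) (2 * τ) * th2 (2 * y) (2 * τ) - th2 (2 * x) (2 * τ) * th3 (2 * y) (2 * τ) := by
  have h := th2_mul_th2 hτ (x + Real.pi / 2) y
  rw [show 2 * (x + (Real.pi : ℂ) / 2) = 2 * x + Real.pi by ring, th3_add_pi, th2_add_pi] at h
  rw [th1_eq_th2, th1_eq_th2, show x + y + (Real.pi : ℂ) / 2 = x + Real.pi / 2 + y by ring,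
    show x - y + (Real.pi : ℂ) / 2 = x + Real.pi / 2 - y by ring]
  linear_combination h

theorem th4_mul_th4 {τ : ℂ} (hτ : 0 < τ.im) (x y : ℂ) :
    th4 (x + y) τ * th4 (x - y) τ =
      th3 (2 * x) (2 * τ) * th3 (2 * y) (2 * τ) - th2 (2 * x) (2 * τ) * th2 (2 * y) (2 * τ) := by
  have h := th3_mul_th3 hτ (x + Real.pi / 2) y
  rw [show 2 * (x + (Real.pi : ℂ) / 2) = 2 * x + Real.pi by ring, th3_add_pi, th2_add_pi] at h
  rw [th4_eq, th4_eq, show x + y + (Real.pi : ℂ) / 2 = x + Real.pi / 2 + y by ring,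
    show x - y + (Real.pi : ℂ) / 2 = x + Real.pi / 2 - y by ring]
  linear_combination h

theorem th1_mul_th2 {τ : ℂ} (hτ : 0 < τ.im) (x y : ℂ) :
    th1 x τ * th2 y τ =
      th1 (x + y) (2 * τ) * th4 (x - y) (2 * τ) + th4 (x + y) (2 * τ) * th1 (x - y) (2 * τ) := by
  have h := th2_mul_th2 hτ ((x + y) / 2 + Real.pi / 4) ((x - y) / 2 + Real.pi / 4)
  rw [show 2 * ((x + y) / 2 + (Real.pi : ℂ) / 4) = x + y + Real.pi / 2 by ring,
    show 2 * ((x - y) / 2 + (Real.pi : ℂ) / 4) = x - y + Real.pi / 2 by ring,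
    show (x + y) / 2 + (Real.pi : ℂ) / 4 + ((x - y) / 2 + Real.pi / 4) = x + Real.pi / 2 by ring,
    show (x + y) / 2 + (Real.pi : ℂ) / 4 - ((x - y) / 2 + Real.pi / 4) = y by ring] at h
  rw [th1_eq_th2, th1_eq_th2, th1_eq_th2, th4_eq, th4_eq]
  linear_combination -h

theorem th4_mul_th3 {τ : ℂ} (hτ : 0 < τ.im) (x y : ℂ) :
    th4 x τ * th3 y τ =
      th4 (x + y) (2 * τ) * th4 (x - y) (2 * τ) + th1 (x + y) (2 * τ) * th1 (x - y) (2 * τ) := by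
  have h := th3_mul_th3 hτ ((x + y) / 2 + Real.pi / 4) ((x - y) / 2 + Real.pi / 4)
  rw [show 2 * ((x + y) / 2 + (Real.pi : ℂ) / 4) = x + y + Real.pi / 2 by ring,
    show 2 * ((x - y) / 2 + (Real.pi : ℂ) / 4) = x - y + Real.pi / 2 by ring,
    show (x + y) / 2 + (Real.pi : ℂ) / 4 + ((x - y) / 2 + Real.pi / 4) = x + Real.pi / 2 by ring,
    show (x + y) / 2 + (Real.pi : ℂ) / 4 - ((x - y) / 2 + Real.pi / 4) = y by ring] at h
  rw [th1_eq_th2, th1_eq_th2, th4_eq, th4_eq, th4_eq]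
  linear_combination h

/-! ### Zeros at rational points -/

lemma inLat_real_iff {τ : ℂ} (hτ : 0 < τ.im) (a b : ℝ) :
    InLat τ (a * (Real.pi : ℂ) + b * ((Real.pi : ℂ) * τ)) ↔
      (∃ m : ℤ, a = m) ∧ (∃ n : ℤ, b = n) := by
  have hpi := Real.pi_pos
  constructor
  · rintro ⟨m, n, h⟩
    have him := congrArg Complex.im h
    have hre := congrArg Complex.re h
    simp at him hre
    have hb : b = n := by
      rcases him with h | h
      · exact h
      · exact absurd h hτ.ne'
    subst hb
    refine ⟨⟨m, ?_⟩, n, rfl⟩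
    have : (a - m) * Real.pi = 0 := by linarith
    rcases mul_eq_zero.1 this with h | h
    · linarith
    · exact absurd h hpi.ne'
  · rintro ⟨⟨m, rfl⟩, n, rfl⟩
    exact ⟨m, n, by push_cast; ring⟩

/-- A point with a non-integral rational coordinate along `π` is not in the lattice. -/
lemma not_inLat_of_fst {τ z : ℂ} (hτ : 0 < τ.im) (a b d : ℤ) (hd : d ≠ 0) (had : ¬ d ∣ a)
    (hz : d * z = a * (Real.pi : ℂ) + b * ((Real.pi : ℂ) * τ)) : ¬ InLat τ z := by
  have hdR : (d : ℝ) ≠ 0 := by exact_mod_cast hd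
  have hdC : (d : ℂ) ≠ 0 := by exact_mod_cast hd
  have e : z = ((a / d : ℝ) : ℂ) * (Real.pi : ℂ) + ((b / d : ℝ) : ℂ) * ((Real.pi : ℂ) * τ) := by
    push_cast
    field_simp
    linear_combination hz
  rw [e, inLat_real_iff hτ]
  rintro ⟨⟨m, hm⟩, -⟩
  rw [div_eq_iff hdR] at hm
  exact had ⟨m, by rw [mul_comm]; exact_mod_cast hm⟩

lemma not_inLat_of_snd {τ z : ℂ} (hτ : 0 < τ.im) (a b d : ℤ) (hd : d ≠ 0) (had : ¬ d ∣ b)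
    (hz : d * z = a * (Real.pi : ℂ) + b * ((Real.pi : ℂ) * τ)) : ¬ InLat τ z := by
  have hdR : (d : ℝ) ≠ 0 := by exact_mod_cast hd
  have hdC : (d : ℂ) ≠ 0 := by exact_mod_cast hd
  have e : z = ((a / d : ℝ) : ℂ) * (Real.pi : ℂ) + ((b / d : ℝ) : ℂ) * ((Real.pi : ℂ) * τ) := by
    push_cast
    field_simp
    linear_combination hz
  rw [e, inLat_real_iff hτ]
  rintro ⟨-, ⟨m, hm⟩⟩
  rw [div_eq_iff hdR] at hm
  exact had ⟨m, by rw [mul_comm]; exact_mod_cast hm⟩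

/-- `ϑ₁(x,p²)ϑ₁(x−2η,p²)`. -/
def Aw (τ x : ℂ) : ℂ := th1 x (2 * τ) * th1 (x - 2 * ηc) (2 * τ)

/-- `ϑ₄(x,p²)ϑ₄(x−2η,p²)`. -/
def Dw (τ x : ℂ) : ℂ := th4 x (2 * τ) * th4 (x - 2 * ηc) (2 * τ)

/-- `ϑ₁(x−η)ϑ₁(x+η)`. -/
def rhoF (τ x : ℂ) : ℂ := th1 (x - ηc) τ * th1 (x + ηc) τ

/-- `ϑ₄(η,p²)/ϑ₄(0,p²)`. -/
def Cc (τ : ℂ) : ℂ := th4 ηc (2 * τ) / th4 0 (2 * τ)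

lemma three_ηc : 3 * ηc = Real.pi := by rw [ηc]; ring

lemma Aw_eq {τ : ℂ} (hτ : 0 < τ.im) (x : ℂ) : Aw τ x =
    th3 (2 * (x - ηc)) (2 * (2 * τ)) * th2 (2 * ηc) (2 * (2 * τ)) -
      th2 (2 * (x - ηc)) (2 * (2 * τ)) * th3 (2 * ηc) (2 * (2 * τ)) := by
  rw [← th1_mul_th1 (two_mul_im hτ), Aw]
  congr 2 <;> ring

lemma Dw_eq {τ : ℂ} (hτ : 0 < τ.im) (x : ℂ) : Dw τ x =
    th3 (2 * (x - ηc)) (2 * (2 * τ)) * th3 (2 * ηc) (2 * (2 * τ)) -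
      th2 (2 * (x - ηc)) (2 * (2 * τ)) * th2 (2 * ηc) (2 * (2 * τ)) := by
  rw [← th4_mul_th4 (two_mul_im hτ), Dw]
  congr 2 <;> ring

lemma weights_exchange {τ : ℂ} (hτ : 0 < τ.im) (x y : ℂ) :
    th4 (y - x) (2 * τ) * th4 (2 * ηc - x - y) (2 * τ) * (Aw τ y * Dw τ x - Aw τ x * Dw τ y) =
      th1 (y - x) (2 * τ) * th1 (2 * ηc - x - y) (2 * τ) *
        (Aw τ x * Aw τ y - Dw τ x * Dw τ y) := by
  have h2 := two_mul_im hτ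
  have e4 := th4_mul_th4 h2 (ηc - x) (ηc - y)
  have e1 := th1_mul_th1 h2 (ηc - x) (ηc - y)
  rw [show ηc - x + (ηc - y) = 2 * ηc - x - y by ring, show ηc - x - (ηc - y) = y - x by ring,
    show 2 * (ηc - x) = -(2 * (x - ηc)) by ring, show 2 * (ηc - y) = -(2 * (y - ηc)) by ring,
    th2_neg, th2_neg, th3_neg, th3_neg] at e1 e4
  rw [mul_comm (th4 (y - x) _), mul_comm (th1 (y - x) _), e1, e4, Aw_eq hτ, Aw_eq hτ, Dw_eq hτ,
    Dw_eq hτ]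
  ring

lemma weights_reflect {τ : ℂ} (hτ : 0 < τ.im) (x : ℂ) :
    th4 (2 * ηc) (2 * τ) * th4 (2 * x) (2 * τ) * Aw τ (-x) -
      th1 (2 * ηc) (2 * τ) * th1 (2 * x) (2 * τ) * Dw τ (-x) =
      th4 0 (2 * τ) * th4 (2 * x + 2 * ηc) (2 * τ) * Aw τ x ∧
    th4 (2 * ηc) (2 * τ) * th4 (2 * x) (2 * τ) * Dw τ (-x) -
      th1 (2 * ηc) (2 * τ) * th1 (2 * x) (2 * τ) * Aw τ (-x) =
      th4 0 (2 * τ) * th4 (2 * x + 2 * ηc) (2 * τ) * Dw τ x := by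
  have h2 := two_mul_im hτ
  have e4 := th4_mul_th4 h2 (x + ηc) (x - ηc)
  have e1 := th1_mul_th1 h2 (x + ηc) (x - ηc)
  have e0 := th4_mul_th4 h2 (x + ηc) (x + ηc)
  rw [show x + ηc + (x - ηc) = 2 * x by ring, show x + ηc - (x - ηc) = 2 * ηc by ring] at e1 e4
  rw [show x + ηc + (x + ηc) = 2 * x + 2 * ηc by ring, sub_self] at e0
  rw [mul_comm (th4 (2 * ηc) _), mul_comm (th1 (2 * ηc) _), mul_comm (th4 0 _), e0, e1, e4,
    Aw_eq hτ, Aw_eq hτ, Dw_eq hτ, Dw_eq hτ, show 2 * (-x - ηc) = -(2 * (x + ηc)) by ring, th2_neg,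
    th3_neg]
  constructor <;> ring

lemma rv_eq {τ : ℂ} (hτ : 0 < τ.im) (u : ℂ) : rv τ u = th4 (2 * ηc) (2 * τ) * (th1 (u + ηc) τ * th2 ηc τ) := by
  rw [rv, av, bv, th1_mul_th2 hτ, show u + ηc + ηc = u + 2 * ηc by ring,
    show u + ηc - ηc = u by ring]
  ring

lemma Dw_add_Aw {τ : ℂ} (hτ : 0 < τ.im) (x : ℂ) : Dw τ x + Aw τ x = th4 (x - ηc) τ * th3 ηc τ := by
  rw [th4_mul_th3 hτ, Dw, Aw]
  congr 2 <;> congr 1 <;> ring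

lemma Dw_sub_Aw {τ : ℂ} (hτ : 0 < τ.im) (x : ℂ) : Dw τ x - Aw τ x = th4 ηc τ * th3 (x - ηc) τ := by
  rw [th4_mul_th3 hτ, Dw, Aw, show ηc + (x - ηc) = x by ring,
    show ηc - (x - ηc) = -(x - 2 * ηc) by ring, th4_neg, th1_neg]
  ring

lemma th4_two_eta (τ : ℂ) : th4 (2 * ηc) τ = th4 ηc τ := by
  rw [← th4_neg, ← th4_add_pi, ← three_ηc]
  congr 1
  ring

lemma th1_two_eta (τ : ℂ) : th1 (2 * ηc) τ = th1 ηc τ := by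
  rw [← neg_neg (th1 _ τ), ← th1_neg, ← th1_add_pi, ← three_ηc]
  congr 1
  ring

lemma th3_two_eta (τ : ℂ) : th3 (2 * ηc) τ = th3 ηc τ := by
  rw [← th3_neg, ← th3_add_pi, ← three_ηc]
  congr 1
  ring

lemma th1_eta_ne {τ : ℂ} (hτ : 0 < τ.im) : th1 ηc τ ≠ 0 := fun h =>
  not_inLat_of_fst hτ 1 0 3 (by norm_num) (by norm_num) (by push_cast; rw [three_ηc]; ring)
    ((th1_eq_zero_iff hτ).1 h)

lemma th2_ne_of {τ : ℂ} (hτ : 0 < τ.im) {z : ℂ} (h : ¬ InLat τ (z - Real.pi / 2)) : th2 z τ ≠ 0 := by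
  intro h0
  apply h
  rw [← th1_eq_zero_iff hτ, th1_eq_th2, sub_add_cancel, h0, neg_zero]

lemma th2_eta_ne {τ : ℂ} (hτ : 0 < τ.im) : th2 ηc τ ≠ 0 :=
  th2_ne_of hτ (not_inLat_of_fst hτ (-1) 0 6 (by norm_num) (by norm_num)
    (by push_cast; linear_combination 2 * three_ηc))

lemma th2_zero_ne {τ : ℂ} (hτ : 0 < τ.im) : th2 0 τ ≠ 0 :=
  th2_ne_of hτ (not_inLat_of_fst hτ (-1) 0 2 (by norm_num) (by norm_num) (by push_cast; ring))

lemma th4_zero_ne {τ : ℂ} (hτ : 0 < τ.im) : th4 0 τ ≠ 0 := fun h =>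
  not_inLat_of_snd hτ 0 (-1) 2 (by norm_num) (by norm_num) (by push_cast; ring)
    ((th4_eq_zero_iff hτ).1 h)

lemma th4_eta_ne {τ : ℂ} (hτ : 0 < τ.im) : th4 ηc τ ≠ 0 := fun h =>
  not_inLat_of_fst hτ 2 (-3) 6 (by norm_num) (by norm_num)
    (by push_cast; linear_combination 2 * three_ηc) ((th4_eq_zero_iff hτ).1 h)

lemma th3_zero_ne {τ : ℂ} (hτ : 0 < τ.im) : th3 0 τ ≠ 0 := by
  have h := th4_eq_zero_iff hτ (z := -(Real.pi / 2))
  rw [th4_eq, neg_add_cancel] at h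
  intro h0
  refine not_inLat_of_snd hτ (-1) (-1) 2 (by norm_num) (by norm_num) ?_ (h.1 h0)
  push_cast; ring

lemma Cc_ne {τ : ℂ} (hτ : 0 < τ.im) : Cc τ ≠ 0 := div_ne_zero (th4_eta_ne (two_mul_im hτ)) (th4_zero_ne (two_mul_im hτ))

lemma th1_double {τ : ℂ} (hτ : 0 < τ.im) (z : ℂ) : th2 0 τ * th1 z τ = 2 * (th1 z (2 * τ) * th4 z (2 * τ)) := by
  have := th1_mul_th2 hτ z 0
  rw [add_zero, sub_zero] at this
  linear_combination this

lemma plucker {τ : ℂ} (hτ : 0 < τ.im) (x y : ℂ) :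
    Cc τ * th1 x τ ^ 2 * rhoF τ y - Cc τ * th1 y τ ^ 2 * rhoF τ x =
      -(Cc τ * th1 ηc τ ^ 2 * (th1 (x - y) τ * th1 (x + y) τ)) := by
  have r : ∀ z, rhoF τ z = th3 (2 * z) (2 * τ) * th2 (2 * ηc) (2 * τ) -
      th2 (2 * z) (2 * τ) * th3 (2 * ηc) (2 * τ) := by
    intro z; rw [← th1_mul_th1 hτ, rhoF, mul_comm]
  have s : ∀ z, th1 z τ ^ 2 = th3 (2 * z) (2 * τ) * th2 0 (2 * τ) -
      th2 (2 * z) (2 * τ) * th3 0 (2 * τ) := by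
    intro z
    have := th1_mul_th1 hτ z 0
    rw [add_zero, sub_zero, mul_zero] at this
    rw [← this, sq]
  have e := th1_mul_th1 hτ x y
  have e0 := th1_mul_th1 hτ 0 ηc
  rw [zero_add, zero_sub, th1_neg, mul_zero] at e0
  rw [mul_comm (th1 (x - y) τ), e, r, r, s, s]
  linear_combination (-Cc τ) * (th3 (2 * x) (2 * τ) * th2 (2 * y) (2 * τ) -
    th2 (2 * x) (2 * τ) * th3 (2 * y) (2 * τ)) * e0

lemma Cc_cube {τ : ℂ} (hτ : 0 < τ.im) : Cc τ ^ 3 * (1 - zet τ ^ 2) = 1 := by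
  have h2 := two_mul_im hτ
  have n0 := th4_zero_ne h2
  have n1 := th4_eta_ne h2
  have a := th4_mul_th4 h2 ηc 0
  have b := th1_mul_th1 h2 ηc 0
  have c := th4_mul_th4 h2 ηc ηc
  have d := th4_mul_th4 h2 0 0
  rw [add_zero, sub_zero, mul_zero] at a b d
  rw [← two_mul, th4_two_eta, sub_self] at c
  have key : th4 ηc (2 * τ) ^ 4 - th1 ηc (2 * τ) ^ 4 = th4 ηc (2 * τ) * th4 0 (2 * τ) ^ 3 := by
    have : th4 ηc (2 * τ) ^ 4 - th1 ηc (2 * τ) ^ 4 = (th4 ηc (2 * τ) * th4 ηc (2 * τ)) ^ 2 -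
      (th1 ηc (2 * τ) * th1 ηc (2 * τ)) ^ 2 := by ring
    rw [this, a, b, show th4 ηc (2 * τ) * th4 0 (2 * τ) ^ 3 =
      (th4 ηc (2 * τ) * th4 0 (2 * τ)) * (th4 0 (2 * τ) * th4 0 (2 * τ)) by ring, c, d]
    ring
  rw [Cc, zet]
  field_simp
  linear_combination key

lemma zet_ne {τ : ℂ} (hτ : 0 < τ.im) : zet τ ≠ 0 :=
  pow_ne_zero _ (div_ne_zero (th1_eta_ne (two_mul_im hτ)) (th4_eta_ne (two_mul_im hτ)))

lemma one_sub_zet_sq_ne {τ : ℂ} (hτ : 0 < τ.im) : 1 - zet τ ^ 2 ≠ 0 := fun h => by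
  have := Cc_cube hτ
  simp [h] at this

lemma one_sub_zet_ne {τ : ℂ} (hτ : 0 < τ.im) : 1 - zet τ ≠ 0 := fun h => one_sub_zet_sq_ne hτ (by
  linear_combination (1 + zet τ) * h)

lemma one_add_zet_ne {τ : ℂ} (hτ : 0 < τ.im) : 1 + zet τ ≠ 0 := fun h => one_sub_zet_sq_ne hτ (by
  linear_combination (1 - zet τ) * h)

lemma th1_add_quarter (z τ : ℂ) : th1 (z + Real.pi * τ / 2) τ =
    I * exp (-(Real.pi * I * τ / 4) - I * z) * th4 z τ := by
  have h := th1_add_half z (τ / 2)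
  rw [show 2 * (τ / 2) = τ by ring, show Real.pi * (τ / 2) = Real.pi * τ / 2 by ring,
    show Real.pi * I * (τ / 2) / 2 = Real.pi * I * τ / 4 by ring] at h
  exact h

lemma th3_add_quarter (z τ : ℂ) : th3 (z + Real.pi * τ / 2) τ =
    exp (-(Real.pi * I * τ / 4) - I * z) * th2 z τ := by
  have h := th3_add_half z (τ / 2)
  rw [show 2 * (τ / 2) = τ by ring, show Real.pi * (τ / 2) = Real.pi * τ / 2 by ring,
    show Real.pi * I * (τ / 2) / 2 = Real.pi * I * τ / 4 by ring] at h
  exact h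

lemma th4_add_half_pi (z τ : ℂ) : th4 (z + Real.pi / 2) τ = th3 z τ := by
  rw [th4_eq, ← th3_add_pi z]
  congr 1
  ring

lemma wfun_eq (τ x : ℂ) : wfun τ x = Cc τ * th1 x τ ^ 2 / rhoF τ x := rfl

lemma rhoF_neg (τ x : ℂ) : rhoF τ (-x) = rhoF τ x := by
  rw [rhoF, rhoF, show -x - ηc = -(x + ηc) by ring, show -x + ηc = -(x - ηc) by ring, th1_neg,
    th1_neg]
  ring

lemma wfun_neg (τ x : ℂ) : wfun τ (-x) = wfun τ x := by
  rw [wfun_eq, wfun_eq, rhoF_neg, th1_neg, neg_sq]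

lemma wfun_zero (τ : ℂ) : wfun τ 0 = 0 := by
  rw [wfun_eq, th1_zero]
  simp

lemma wfun_add_pi (τ x : ℂ) : wfun τ (x + Real.pi) = wfun τ x := by
  rw [wfun_eq, wfun_eq, rhoF, rhoF, add_sub_right_comm, add_right_comm, th1_add_pi, th1_add_pi,
    th1_add_pi]
  ring

lemma exp_eta : exp (I * ηc) ^ 3 = -1 := by
  rw [← exp_nat_mul, ← exp_pi_mul_I, ← three_ηc]
  congr 1
  push_cast
  ring

lemma th4_eta_eq {τ : ℂ} (hτ : 0 < τ.im) : th4 ηc τ = Cc τ ^ 2 * (1 + zet τ) * th4 0 τ := by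
  have a := th4_mul_th3 hτ ηc 0
  have b := th4_mul_th3 hτ 0 0
  have n0 := th3_zero_ne hτ
  have n1 := th4_zero_ne (two_mul_im hτ)
  have n2 := th4_eta_ne (two_mul_im hτ)
  simp only [add_zero, sub_zero, th1_zero] at a b
  apply mul_right_cancel₀ n0
  rw [mul_assoc, b, a, Cc, zet]
  field_simp
  ring

lemma th3_eta_eq {τ : ℂ} (hτ : 0 < τ.im) : th3 ηc τ = Cc τ ^ 2 * (1 - zet τ) * th3 0 τ := by
  have a := th4_mul_th3 hτ 0 ηc
  have b := th4_mul_th3 hτ 0 0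
  have n0 := th4_zero_ne hτ
  have n1 := th4_zero_ne (two_mul_im hτ)
  have n2 := th4_eta_ne (two_mul_im hτ)
  simp only [add_zero, sub_zero, zero_add, zero_sub, th1_zero, th1_neg, th4_neg] at a b
  apply mul_left_cancel₀ n0
  rw [mul_left_comm, b, a, Cc, zet]
  field_simp
  ring

lemma wfun_add_quarter {τ : ℂ} (z : ℂ) : wfun τ (z + Real.pi * τ / 2) =
    Cc τ * th4 z τ ^ 2 / (th4 (z - ηc) τ * th4 (z + ηc) τ) := by
  rw [wfun_eq, rhoF, add_sub_right_comm, add_right_comm, th1_add_quarter, th1_add_quarter,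
    th1_add_quarter]
  have e : exp (-(Real.pi * I * τ / 4) - I * (z - ηc)) *
      exp (-(Real.pi * I * τ / 4) - I * (z + ηc)) = exp (-(Real.pi * I * τ / 4) - I * z) ^ 2 := by
    rw [sq, ← exp_add, ← exp_add]; ring_nf
  have n := exp_ne_zero (-(Real.pi * I * τ / 4) - I * z)
  have e2 : I * exp (-(Real.pi * I * τ / 4) - I * (z - ηc)) * th4 (z - ηc) τ *
      (I * exp (-(Real.pi * I * τ / 4) - I * (z + ηc)) * th4 (z + ηc) τ) =
      (I * exp (-(Real.pi * I * τ / 4) - I * z)) ^ 2 * (th4 (z - ηc) τ * th4 (z + ηc) τ) := by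
    linear_combination (I ^ 2 * th4 (z - ηc) τ * th4 (z + ηc) τ) * e
  rw [e2, mul_pow _ (th4 z τ), mul_left_comm, mul_div_mul_left]
  exact pow_ne_zero _ (mul_ne_zero I_ne_zero n)

lemma wfun_β4 {τ : ℂ} (hτ : 0 < τ.im) : wfun τ (β4c τ) = J4c (zet τ) := by
  rw [β4c, wfun_add_quarter, sub_self, ← two_mul, th4_two_eta, J4c]
  have n1 := one_sub_zet_ne hτ
  have n2 := th4_eta_ne hτ
  have n0 := th4_zero_ne hτ
  have : Cc τ * th4 ηc τ ^ 2 / (th4 0 τ * th4 ηc τ) = Cc τ * th4 ηc τ / th4 0 τ := by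
    field_simp
  rw [this, th4_eta_eq hτ]
  field_simp
  linear_combination Cc_cube hτ

lemma wfun_β3 {τ : ℂ} (hτ : 0 < τ.im) : wfun τ (β3c τ) = J3c (zet τ) := by
  rw [β3c, wfun_add_quarter, show ηc + (Real.pi : ℂ) / 2 - ηc = 0 + Real.pi / 2 by ring,
    show ηc + (Real.pi : ℂ) / 2 + ηc = 2 * ηc + Real.pi / 2 by ring, th4_add_half_pi,
    th4_add_half_pi, th4_add_half_pi, th3_two_eta, J3c]
  have n1 := one_add_zet_ne hτ
  have n3 := one_sub_zet_ne hτ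
  have n0 := th3_zero_ne hτ
  have n4 := Cc_ne hτ
  have n2 : th3 ηc τ ≠ 0 := by
    rw [th3_eta_eq hτ]; simp [n0, n3, n4]
  have : Cc τ * th3 ηc τ ^ 2 / (th3 0 τ * th3 ηc τ) = Cc τ * th3 ηc τ / th3 0 τ := by
    field_simp
  rw [this, th3_eta_eq hτ]
  field_simp
  linear_combination Cc_cube hτ

lemma wfun_half_period {τ : ℂ} (hτ : 0 < τ.im) :
    wfun τ (Real.pi * τ / 2) = (1 - zet τ) / (1 + zet τ) := by
  have h := wfun_add_quarter (τ := τ) 0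
  rw [zero_add] at h
  rw [h, zero_sub, zero_add, th4_neg, th4_eta_eq hτ]
  have n1 := one_add_zet_ne hτ
  have n0 := th4_zero_ne hτ
  have n4 := Cc_ne hτ
  field_simp
  linear_combination -Cc_cube hτ

/-- The cubic relation between `ϑ₁(x)`, `ϑ₁(x+η)` and `ϑ₁(x−η)`. -/
theorem th1_cubic {τ : ℂ} (hτ : 0 < τ.im) (x : ℂ) :
    (1 - zet τ ^ 2) * Cc τ * (th1 x τ ^ 3 - th1 (x + ηc) τ ^ 3 - th1 (x - ηc) τ ^ 3) =
      (3 + zet τ ^ 2) * (th1 x τ * th1 (x + ηc) τ * th1 (x - ηc) τ) := by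
  let f : ℂ → ℂ := fun x => (1 - zet τ ^ 2) * Cc τ *
    (th1 x τ ^ 3 - th1 (x + ηc) τ ^ 3 - th1 (x - ηc) τ ^ 3) -
      (3 + zet τ ^ 2) * (th1 x τ * th1 (x + ηc) τ * th1 (x - ηc) τ)
  have hshift : ∀ x, f (x + ηc) = -f x := by
    intro x
    have : th1 (x + ηc + ηc) τ = -th1 (x - ηc) τ := by
      rw [← th1_add_pi, ← three_ηc]; congr 1; ring
    simp only [f]
    rw [this, add_sub_cancel_right]
    ring
  have hquart : ∀ z, f (z + Real.pi * τ / 2) = (I * exp (-(Real.pi * I * τ / 4) - I * z)) ^ 3 *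
      ((1 - zet τ ^ 2) * Cc τ * (th4 z τ ^ 3 + th4 (z + ηc) τ ^ 3 + th4 (z - ηc) τ ^ 3) -
      (3 + zet τ ^ 2) * (th4 z τ * th4 (z + ηc) τ * th4 (z - ηc) τ)) := by
    intro z
    simp only [f]
    rw [add_sub_right_comm, add_right_comm, th1_add_quarter, th1_add_quarter, th1_add_quarter]
    have e1 : exp (-(Real.pi * I * τ / 4) - I * (z + ηc)) =
      exp (-(Real.pi * I * τ / 4) - I * z) * (exp (I * ηc))⁻¹ := by
      rw [← exp_neg, ← exp_add]; ring_nf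
    have e2 : exp (-(Real.pi * I * τ / 4) - I * (z - ηc)) =
      exp (-(Real.pi * I * τ / 4) - I * z) * exp (I * ηc) := by
      rw [← exp_add]; ring_nf
    rw [e1, e2]
    have n := exp_ne_zero (I * ηc)
    have e := exp_eta
    set E := exp (I * ηc)
    have e' : E⁻¹ ^ 3 = -1 := by rw [inv_pow, e]; norm_num
    have e3 : E * E⁻¹ = 1 := mul_inv_cancel₀ n
    set E' := E⁻¹
    set X := exp (-(Real.pi * I * τ / 4) - I * z)
    linear_combination (-(1 - zet τ ^ 2) * Cc τ * I ^ 3 * X ^ 3 * th4 (z + ηc) τ ^ 3) * e' +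
      (-(1 - zet τ ^ 2) * Cc τ * I ^ 3 * X ^ 3 * th4 (z - ηc) τ ^ 3) * e -
      ((3 + zet τ ^ 2) * (th4 z τ * th4 (z + ηc) τ * th4 (z - ηc) τ)) * I ^ 3 * X ^ 3 * e3
  have h1 : f (Real.pi * τ / 2) = 0 := by
    have := hquart 0
    rw [zero_add] at this
    rw [this, zero_sub, zero_add, th4_neg, th4_eta_eq hτ]
    have hC := Cc_cube hτ
    set C := Cc τ
    set ζ := zet τ
    linear_combination (I * exp (-(Real.pi * I * τ / 4) - I * 0)) ^ 3 * th4 0 τ ^ 3 *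
      C * (2 * C ^ 3 * (1 + ζ) ^ 3 - (1 - ζ ^ 2)) * hC
  have h2 : f (Real.pi / 2 + Real.pi * τ / 2) = 0 := by
    rw [hquart, show (Real.pi : ℂ) / 2 - ηc = -ηc + Real.pi / 2 by ring,
      show (Real.pi : ℂ) / 2 + ηc = ηc + Real.pi / 2 by ring, th4_add_half_pi, th4_add_half_pi,
      th3_neg, th3_eta_eq hτ]
    have := th4_add_half_pi 0 τ
    rw [zero_add] at this
    rw [this]
    have hC := Cc_cube hτ
    set C := Cc τ
    set ζ := zet τ
    linear_combination (I * exp (-(Real.pi * I * τ / 4) - I * (Real.pi / 2))) ^ 3 * th3 0 τ ^ 3 *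
      C * (2 * C ^ 3 * (1 - ζ) ^ 3 - (1 - ζ ^ 2)) * hC
  have hd := differentiable_th1 hτ
  have hd1 : Differentiable ℂ fun z => th1 (z + ηc) τ := hd.comp (differentiable_id.add_const ηc)
  have hd2 : Differentiable ℂ fun z => th1 (z - ηc) τ := hd.comp (differentiable_id.sub_const ηc)
  have hf : f = 0 := by
    refine eq_zero_of_theta_like hτ [Real.pi * τ / 2, Real.pi * τ / 2 + ηc, Real.pi * τ / 2 - ηc,
      Real.pi / 2 + Real.pi * τ / 2] 3 (f := f) (by fun_prop) (σ := -1)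
      (C := -exp (-(3 * (Real.pi * I * τ)))) (by simp) ?_ ?_ (by simp) ?_ ?_
    · intro z
      simp only [f]
      rw [add_sub_right_comm, add_right_comm, th1_add_pi, th1_add_pi, th1_add_pi]
      ring
    · intro z
      simp only [f]
      rw [add_sub_right_comm, add_right_comm, th1_add_pi_tau, th1_add_pi_tau, th1_add_pi_tau]
      have e1 : exp (-(Real.pi * I * τ) - 2 * I * (z + ηc)) =
        exp (-(Real.pi * I * τ) - 2 * I * z) * (exp (I * ηc))⁻¹ ^ 2 := by
        rw [← exp_neg, ← exp_nat_mul, ← exp_add]; push_cast; ring_nf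
      have e2 : exp (-(Real.pi * I * τ) - 2 * I * (z - ηc)) =
        exp (-(Real.pi * I * τ) - 2 * I * z) * exp (I * ηc) ^ 2 := by
        rw [← exp_nat_mul, ← exp_add]; push_cast; ring_nf
      have e4 : exp (-(3 * (Real.pi * I * τ))) * exp (-2 * I * ((3 : ℕ) * z)) =
        exp (-(Real.pi * I * τ) - 2 * I * z) ^ 3 := by
        rw [← exp_nat_mul, ← exp_add]; push_cast; ring_nf
      rw [e1, e2, neg_mul (exp _) (exp _), e4]
      have n := exp_ne_zero (I * ηc)
      have e := exp_eta
      set E := exp (I * ηc)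
      have e' : E⁻¹ ^ 3 = -1 := by rw [inv_pow, e]; norm_num
      have e3 : E * E⁻¹ = 1 := mul_inv_cancel₀ n
      set E' := E⁻¹
      set X := exp (-(Real.pi * I * τ) - 2 * I * z)
      linear_combination ((1 - zet τ ^ 2) * Cc τ * X ^ 3 * th1 (z + ηc) τ ^ 3) * (E' ^ 3 - 1) * e' +
        ((1 - zet τ ^ 2) * Cc τ * X ^ 3 * th1 (z - ηc) τ ^ 3) * (E ^ 3 - 1) * e +
        ((3 + zet τ ^ 2) * (th1 z τ * th1 (z + ηc) τ * th1 (z - ηc) τ)) * X ^ 3 *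
          (E * E' + 1) * e3
    · simp only [List.pairwise_cons, List.mem_cons, List.not_mem_nil, or_false, forall_eq_or_imp,
        forall_eq, List.Pairwise.nil, and_true, IsEmpty.forall_iff, implies_true]
      refine ⟨⟨?_, ?_, ?_⟩, ⟨?_, ?_⟩, ?_⟩
      · exact not_inLat_of_fst hτ (-1) 0 3 (by norm_num) (by norm_num)
          (by push_cast; linear_combination -three_ηc)
      · exact not_inLat_of_fst hτ 1 0 3 (by norm_num) (by norm_num)
          (by push_cast; linear_combination three_ηc)
      · exact not_inLat_of_fst hτ (-1) 0 2 (by norm_num) (by norm_num) (by push_cast; ring)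
      · exact not_inLat_of_fst hτ 2 0 3 (by norm_num) (by norm_num)
          (by push_cast; linear_combination 2 * three_ηc)
      · exact not_inLat_of_fst hτ (-1) 0 6 (by norm_num) (by norm_num)
          (by push_cast; linear_combination 2 * three_ηc)
      · exact not_inLat_of_fst hτ (-5) 0 6 (by norm_num) (by norm_num)
          (by push_cast; linear_combination -2 * three_ηc)
    · simp only [List.mem_cons, List.not_mem_nil, or_false, forall_eq_or_imp, forall_eq]
      refine ⟨h1, ?_, ?_, h2⟩
      · rw [hshift, h1, neg_zero]
      · have := hshift (Real.pi * τ / 2 - ηc)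
        rw [sub_add_cancel, h1] at this
        simpa using this.symm
  have := congrFun hf x
  simp only [f, Pi.zero_apply] at this
  linear_combination this

lemma th1_add_two_eta (x τ : ℂ) : th1 (x + 2 * ηc) τ = -th1 (x - ηc) τ := by
  rw [← th1_add_pi, ← three_ηc]; congr 1; ring

lemma th1_sub_two_eta (x τ : ℂ) : th1 (x - 2 * ηc) τ = -th1 (x + ηc) τ := by
  have := th1_add_pi (x - 2 * ηc) τ
  rw [← three_ηc, show x - 2 * ηc + 3 * ηc = x + ηc by ring] at this
  rw [this, neg_neg]

lemma wfun_add_two_eta (x τ : ℂ) : wfun τ (x + 2 * ηc) = wfun τ (x - ηc) := by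
  rw [← wfun_add_pi τ (x - ηc), ← three_ηc]
  congr 1
  ring

lemma rhoF_add_eta (x τ : ℂ) : rhoF τ (x + ηc) = -(th1 x τ * th1 (x - ηc) τ) := by
  rw [rhoF, add_sub_cancel_right, add_assoc, ← two_mul, th1_add_two_eta]
  ring

lemma rhoF_sub_eta (x τ : ℂ) : rhoF τ (x - ηc) = -(th1 x τ * th1 (x + ηc) τ) := by
  rw [rhoF, sub_add_cancel, sub_sub, ← two_mul, th1_sub_two_eta]
  ring

lemma wfun_sum {τ : ℂ} (hτ : 0 < τ.im) {x : ℂ} (h0 : th1 x τ ≠ 0) (hp : th1 (x + ηc) τ ≠ 0)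
    (hm : th1 (x - ηc) τ ≠ 0) :
    wfun τ x + wfun τ (x + ηc) + wfun τ (x - ηc) = (3 + zet τ ^ 2) / (1 - zet τ ^ 2) := by
  have h := th1_cubic hτ x
  have n := one_sub_zet_sq_ne hτ
  rw [wfun_eq, wfun_eq, wfun_eq, rhoF_add_eta, rhoF_sub_eta, rhoF]
  field_simp
  linear_combination h

lemma wfun_prod {τ : ℂ} (hτ : 0 < τ.im) {x : ℂ} (h0 : th1 x τ ≠ 0) (hp : th1 (x + ηc) τ ≠ 0)
    (hm : th1 (x - ηc) τ ≠ 0) :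
    wfun τ x * wfun τ (x + ηc) * wfun τ (x - ηc) = 1 / (1 - zet τ ^ 2) := by
  have h := Cc_cube hτ
  have n := one_sub_zet_sq_ne hτ
  rw [wfun_eq, wfun_eq, wfun_eq, rhoF_add_eta, rhoF_sub_eta, rhoF]
  field_simp
  linear_combination h

lemma wfun_sub {τ : ℂ} (hτ : 0 < τ.im) {x y : ℂ} (hx : rhoF τ x ≠ 0) (hy : rhoF τ y ≠ 0) :
    wfun τ x - wfun τ y = -(Cc τ * th1 ηc τ ^ 2 * (th1 (x - y) τ * th1 (x + y) τ)) /
      (rhoF τ x * rhoF τ y) := by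
  have h := plucker hτ x y
  rw [wfun_eq, wfun_eq]
  field_simp
  linear_combination h

/-- A function given by a polynomial. -/
def IsPolyFun {ι : Type*} (f : (ι → ℂ) → ℂ) : Prop :=
  ∃ P : MvPolynomial ι ℂ, ∀ w, f w = MvPolynomial.eval w P

/-- A property that holds away from the zero set of a nonzero polynomial. -/
def Generically {ι : Type*} (p : (ι → ℂ) → Prop) : Prop :=
  ∃ Q : MvPolynomial ι ℂ, Q ≠ 0 ∧ ∀ w, MvPolynomial.eval w Q ≠ 0 → p w

namespace IsPolyFun

variable {ι : Type*} {f g : (ι → ℂ) → ℂ}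

lemma const (c : ℂ) : IsPolyFun (fun _ : ι → ℂ => c) := ⟨MvPolynomial.C c, by simp⟩

lemma proj (i : ι) : IsPolyFun (fun w : ι → ℂ => w i) := ⟨MvPolynomial.X i, by simp⟩

lemma add (hf : IsPolyFun f) (hg : IsPolyFun g) : IsPolyFun (fun w => f w + g w) := by
  obtain ⟨P, hP⟩ := hf
  obtain ⟨Q, hQ⟩ := hg
  exact ⟨P + Q, by simp [hP, hQ]⟩

lemma sub (hf : IsPolyFun f) (hg : IsPolyFun g) : IsPolyFun (fun w => f w - g w) := by
  obtain ⟨P, hP⟩ := hf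
  obtain ⟨Q, hQ⟩ := hg
  exact ⟨P - Q, by simp [hP, hQ]⟩

lemma mul (hf : IsPolyFun f) (hg : IsPolyFun g) : IsPolyFun (fun w => f w * g w) := by
  obtain ⟨P, hP⟩ := hf
  obtain ⟨Q, hQ⟩ := hg
  exact ⟨P * Q, by simp [hP, hQ]⟩

lemma sum {α : Type*} (s : Finset α) {F : α → (ι → ℂ) → ℂ} (h : ∀ a, IsPolyFun (F a)) :
    IsPolyFun (fun w => ∑ a ∈ s, F a w) := by
  choose P hP using h
  exact ⟨∑ a ∈ s, P a, fun w => by simp [map_sum, hP]⟩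

lemma prod {α : Type*} (s : Finset α) {F : α → (ι → ℂ) → ℂ} (h : ∀ a, IsPolyFun (F a)) :
    IsPolyFun (fun w => ∏ a ∈ s, F a w) := by
  choose P hP using h
  exact ⟨∏ a ∈ s, P a, fun w => by simp [map_prod, hP]⟩

lemma det {n : Type*} [Fintype n] [DecidableEq n] {M : (ι → ℂ) → Matrix n n ℂ}
    (h : ∀ i j, IsPolyFun fun w => M w i j) : IsPolyFun (fun w => (M w).det) := by
  have : (fun w => (M w).det) = fun w => ∑ σ : Equiv.Perm n,
      ((Equiv.Perm.sign σ : ℤ) : ℂ) * ∏ i, M w (σ i) i := by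
    funext w
    rw [Matrix.det_apply']
  rw [this]
  exact sum _ fun σ => (const _).mul (prod _ fun i => h _ _)

lemma hpol (ζ : ℂ) (hf : IsPolyFun f) (hg : IsPolyFun g) :
    IsPolyFun (fun w => hpol ζ (f w) (g w)) := by
  unfold _root_.hpol
  exact ((const 1).sub (((const _).mul hf).mul hg)).add
    ((((const _).mul hf).mul hg).mul (hf.add hg))

lemma vdm {k : ℕ} {F : Fin k → (ι → ℂ) → ℂ} (h : ∀ i, IsPolyFun (F i)) :
    IsPolyFun (fun w => vdm fun i => F i w) := by
  unfold _root_.vdm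
  refine prod _ fun i => prod _ fun j => ?_
  split_ifs
  · exact (h j).sub (h i)
  · exact const 1

lemma comp {κ : Type*} {f : (κ → ℂ) → ℂ} (hf : IsPolyFun f) {F : κ → (ι → ℂ) → ℂ}
    (h : ∀ i, IsPolyFun (F i)) : IsPolyFun (fun w => f fun i => F i w) := by
  obtain ⟨P, hP⟩ := hf
  choose Q hQ using h
  refine ⟨MvPolynomial.bind₁ Q P, fun w => ?_⟩
  change f _ = _
  rw [hP, ← MvPolynomial.aeval_eq_eval w, MvPolynomial.aeval_bind₁, MvPolynomial.aeval_def,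
    MvPolynomial.eval₂_eq_eval_map]
  simp only [MvPolynomial.aeval_eq_eval, hQ]
  simp

lemma eq_of_generically {p : (ι → ℂ) → Prop} (hp : Generically p) (hf : IsPolyFun f)
    (hg : IsPolyFun g) (h : ∀ w, p w → f w = g w) (w : ι → ℂ) : f w = g w := by
  obtain ⟨Q, hQ, hp⟩ := hp
  obtain ⟨P, hP⟩ := hf.sub hg
  have : P * Q = 0 := MvPolynomial.funext fun w => by
    rw [map_mul, map_zero]
    by_cases hw : MvPolynomial.eval w Q = 0
    · rw [hw, mul_zero]
    · rw [← hP]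
      change (f w - g w) * _ = 0
      rw [h w (hp w hw), sub_self, zero_mul]
  rcases mul_eq_zero.1 this with h0 | h0
  · have := hP w
    rw [h0, map_zero] at this
    exact sub_eq_zero.1 this
  · exact absurd h0 hQ

lemma generically_ne (hf : IsPolyFun f) (h : ∃ w, f w ≠ 0) : Generically fun w => f w ≠ 0 := by
  obtain ⟨P, hP⟩ := hf
  obtain ⟨w, hw⟩ := h
  refine ⟨P, ?_, fun v hv => by change f v ≠ 0; rwa [hP]⟩
  rintro rfl
  exact hw (by rw [hP, map_zero])

end IsPolyFun

namespace Generically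

variable {ι : Type*} {p q : (ι → ℂ) → Prop}

lemma and (hp : Generically p) (hq : Generically q) : Generically fun w => p w ∧ q w := by
  obtain ⟨P, hP, hp⟩ := hp
  obtain ⟨Q, hQ, hq⟩ := hq
  refine ⟨P * Q, mul_ne_zero hP hQ, fun w hw => ?_⟩
  rw [map_mul] at hw
  exact ⟨hp w (left_ne_zero_of_mul hw), hq w (right_ne_zero_of_mul hw)⟩

lemma mono (hp : Generically p) (h : ∀ w, p w → q w) : Generically q := by
  obtain ⟨P, hP, hp⟩ := hp
  exact ⟨P, hP, fun w hw => h w (hp w hw)⟩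

lemma of_forall (h : ∀ w, p w) : Generically p := ⟨1, one_ne_zero, fun w _ => h w⟩

lemma forall_fintype {α : Type*} [Fintype α] {p : α → (ι → ℂ) → Prop}
    (h : ∀ a, Generically (p a)) : Generically fun w => ∀ a, p a w := by
  choose Q hQ hp using h
  refine ⟨∏ a, Q a, Finset.prod_ne_zero_iff.2 fun a _ => hQ a, fun w hw a => hp a w ?_⟩
  rw [map_prod] at hw
  exact Finset.prod_ne_zero_iff.1 hw a (Finset.mem_univ a)

lemma imp {r : Prop} (h : r → Generically p) : Generically fun w => r → p w := by
  by_cases hr : r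
  · exact (h hr).mono fun w hw _ => hw
  · exact of_forall fun w h' => absurd h' hr

lemma injective [Fintype ι] : Generically fun w : ι → ℂ => Function.Injective w := by
  classical
  have h : Generically fun w : ι → ℂ => ∀ i j : ι, i ≠ j → w i - w j ≠ 0 :=
    forall_fintype fun i => forall_fintype fun j => imp fun hij =>
      ((IsPolyFun.proj i).sub (IsPolyFun.proj j)).generically_ne ⟨Pi.single i 1, by
        simp [Pi.single_eq_of_ne (Ne.symm hij)]⟩
  refine h.mono fun w hw i j hij => ?_
  by_contra hne
  exact hw i j hne (sub_eq_zero.2 hij)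

end Generically

lemma vdm_eq_det {k : ℕ} (y : Fin k → ℂ) : vdm y = (Matrix.vandermonde y).det := by
  rw [Matrix.det_vandermonde, vdm]
  refine Finset.prod_congr rfl fun i _ => ?_
  rw [← Finset.prod_filter]
  refine Finset.prod_congr ?_ fun _ _ => rfl
  ext j
  simp

lemma vdm_ne_zero {k : ℕ} {y : Fin k → ℂ} (h : Function.Injective y) : vdm y ≠ 0 := by
  rw [vdm_eq_det]
  exact Matrix.det_vandermonde_ne_zero_iff.2 h

lemma vdm_cons {k : ℕ} (a : ℂ) (y : Fin k → ℂ) :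
    vdm (Fin.cons a y : Fin (k + 1) → ℂ) = (∏ i, (y i - a)) * vdm y := by
  rw [vdm, vdm, Fin.prod_univ_succ]
  congr 1
  · rw [Fin.prod_univ_succ]
    simp
  · refine Finset.prod_congr rfl fun i _ => ?_
    rw [Fin.prod_univ_succ]
    simp

lemma vdm_append {k : ℕ} (x y : Fin k → ℂ) :
    vdm (Fin.append x y) = vdm x * vdm y * ∏ i, ∏ j, (y j - x i) := by
  rw [vdm, Fin.prod_univ_add]
  simp only [Fin.prod_univ_add, Fin.append_left, Fin.append_right]
  have h1 (i j : Fin k) : Fin.castAdd k i < Fin.natAdd k j := by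
    rw [Fin.lt_def]; simp; omega
  have h2 (i j : Fin k) : ¬ Fin.natAdd k i < Fin.castAdd k j := by
    rw [Fin.lt_def]; simp; omega
  have h3 (i j : Fin k) : Fin.castAdd k i < Fin.castAdd k j ↔ i < j := by
    rw [Fin.lt_def, Fin.lt_def]; simp
  have h4 (i j : Fin k) : Fin.natAdd k i < Fin.natAdd k j ↔ i < j := by
    rw [Fin.lt_def, Fin.lt_def]; simp
  simp only [h1, h2, h3, h4, if_true, if_false, Finset.prod_const_one, one_mul,
    Finset.prod_mul_distrib]
  rw [vdm, vdm]
  ring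

/-- The matrix of Lagrange interpolation from the nodes `E` to the nodes `F`. -/
def lagrangeMatrix {k : ℕ} (E F : Fin k → ℂ) : Matrix (Fin k) (Fin k) ℂ :=
  Matrix.of fun i j => (Lagrange.basis Finset.univ E j).eval (F i)

lemma lagrangeMatrix_mul_vandermonde {k : ℕ} {E : Fin k → ℂ} (hE : Function.Injective E)
    (F : Fin k → ℂ) :
    lagrangeMatrix E F * Matrix.vandermonde E = Matrix.vandermonde F := by
  ext i p
  have h := Lagrange.eq_interpolate (s := Finset.univ) (v := E) (f := Polynomial.X ^ (p : ℕ))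
    hE.injOn (by
      rw [Polynomial.degree_X_pow]
      simp)
  have h2 := congrArg (Polynomial.eval (F i)) h
  rw [Polynomial.eval_pow, Polynomial.eval_X, Lagrange.interpolate_apply,
    Polynomial.eval_finsetSum] at h2
  rw [Matrix.mul_apply, Matrix.vandermonde_apply, h2]
  refine Finset.sum_congr rfl fun j _ => ?_
  simp [lagrangeMatrix, Matrix.vandermonde_apply, mul_comm]

lemma lagrangeMatrix_apply {k : ℕ} (E F : Fin k → ℂ) (hEF : ∀ i j, F i ≠ E j) (i j : Fin k) :
    lagrangeMatrix E F i j = (∏ l, (F i - E l)) *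
      ((∏ l, if l ≠ j then E j - E l else 1)⁻¹ * (F i - E j)⁻¹) := by
  have hne : F i - E j ≠ 0 := sub_ne_zero.2 (hEF i j)
  rw [lagrangeMatrix, Matrix.of_apply, Lagrange.basis, Polynomial.eval_prod,
    ← Finset.mul_prod_erase _ _ (Finset.mem_univ j), ← Finset.prod_filter]
  have : (Finset.univ.filter fun l => l ≠ j) = Finset.univ.erase j := by
    ext; simp
  rw [this]
  simp only [Lagrange.basisDivisor, Polynomial.eval_mul, Polynomial.eval_C, Polynomial.eval_sub,
    Polynomial.eval_X, Finset.prod_mul_distrib, Finset.prod_inv_distrib]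
  field_simp

/-- The sign relating the discriminant to the square of the Vandermonde product. -/
def discSign (k : ℕ) : ℂ := ∏ i : Fin k, ∏ j : Fin k, if i < j then -1 else 1

lemma prod_ne_sub {k : ℕ} (E : Fin k → ℂ) :
    ∏ j, ∏ l, (if l ≠ j then E j - E l else 1) = discSign k * vdm E ^ 2 := by
  have h (j l : Fin k) : (if l ≠ j then E j - E l else 1) =
      (if j < l then -1 else 1) * (if j < l then E l - E j else 1) *
        (if l < j then E j - E l else 1) := by
    rcases lt_trichotomy j l with h | h | h
    · simp [h, h.ne', h.not_gt]
    · simp [h]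
    · simp [h, h.ne, h.not_gt]
  simp only [h, Finset.prod_mul_distrib]
  rw [sq, discSign, vdm, mul_assoc]
  congr 2
  rw [Finset.prod_comm]

/-- The block matrix with rows `(Eᵢʲ, xᵢEᵢʲ)`. -/
def bigMatrix {k : ℕ} (E z : Fin k ⊕ Fin k → ℂ) : Matrix (Fin k ⊕ Fin k) (Fin k ⊕ Fin k) ℂ :=
  Matrix.of fun a b => Sum.elim (fun j : Fin k => E a ^ (j : ℕ)) (fun j : Fin k => z a * E a ^ (j : ℕ)) b

lemma det_bigMatrix {k : ℕ} (E F a b : Fin k → ℂ) (hE : Function.Injective E)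
    (hEF : ∀ i j, F i ≠ E j) :
    discSign k * (bigMatrix (Sum.elim E F) (Sum.elim a b)).det =
      (∏ i, ∏ l, (F i - E l)) *
        (Matrix.of fun i j => (b i - a j) * (F i - E j)⁻¹).det := by
  have hV : (Matrix.vandermonde E).det ≠ 0 := Matrix.det_vandermonde_ne_zero_iff.2 hE
  have hblock : bigMatrix (Sum.elim E F) (Sum.elim a b) =
      Matrix.fromBlocks (Matrix.vandermonde E) (Matrix.diagonal a * Matrix.vandermonde E)
        (Matrix.vandermonde F) (Matrix.diagonal b * Matrix.vandermonde F) := by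
    ext (i | i) (j | j) <;> simp [bigMatrix, Matrix.vandermonde_apply, Matrix.diagonal_mul]
  let _ : Invertible (Matrix.vandermonde E) :=
    Matrix.invertibleOfIsUnitDet _ (isUnit_iff_ne_zero.2 hV)
  have hN := lagrangeMatrix_mul_vandermonde hE F
  set V := Matrix.vandermonde E with hVdef
  set N := lagrangeMatrix E F with hNdef
  have hschur : Matrix.diagonal b * Matrix.vandermonde F -
      Matrix.vandermonde F * ⅟ V * (Matrix.diagonal a * V) =
      (Matrix.diagonal b * N - N * Matrix.diagonal a) * V := by
    rw [← hN, Matrix.sub_mul, Matrix.mul_assoc N V, mul_invOf_self, Matrix.mul_one]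
    simp only [Matrix.mul_assoc]
  have hdet : Matrix.diagonal b * N - N * Matrix.diagonal a = Matrix.of fun i j =>
      (∏ l, (F i - E l)) * ((∏ l, if l ≠ j then E j - E l else 1)⁻¹ *
        (Matrix.of fun i j => (b i - a j) * (F i - E j)⁻¹) i j) := by
    ext i j
    rw [Matrix.sub_apply, Matrix.diagonal_mul, Matrix.mul_diagonal, Matrix.of_apply,
      Matrix.of_apply, hNdef, lagrangeMatrix_apply E F hEF]
    ring
  rw [hblock, Matrix.det_fromBlocks₁₁, hschur, Matrix.det_mul, hdet]
  have e1 := Matrix.det_mul_column (fun i => ∏ l, (F i - E l)) (Matrix.of fun i j =>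
    (∏ l, if l ≠ j then E j - E l else 1)⁻¹ *
        (Matrix.of fun i j => (b i - a j) * (F i - E j)⁻¹) i j)
  have e2 := Matrix.det_mul_row (fun j => (∏ l, if l ≠ j then E j - E l else 1)⁻¹)
    (Matrix.of fun i j => (b i - a j) * (F i - E j)⁻¹)
  rw [e2] at e1
  simp only [Matrix.of_apply] at e1 ⊢
  rw [e1]
  have e3 := prod_ne_sub E
  rw [vdm_eq_det, ← hVdef] at e3
  rw [Finset.prod_inv_distrib, e3]
  have hs : discSign k ≠ 0 := by
    rw [discSign]
    refine Finset.prod_ne_zero_iff.2 fun i _ => Finset.prod_ne_zero_iff.2 fun j _ => ?_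
    split_ifs <;> norm_num
  field_simp

/-- `H_{2k}` as a function of `k + k` variables. -/
def Hz (H : (k : ℕ) → (Fin (2 * k) → ℂ) → ℂ) (k : ℕ) (z : Fin (k + k) → ℂ) : ℂ :=
  H k fun j => z (Fin.cast (two_mul k) j)

/-- The first half of the variables. -/
def lh {k : ℕ} (z : Fin (k + k) → ℂ) : Fin k → ℂ := fun i => z (Fin.castAdd k i)

/-- The second half of the variables. -/
def rh {k : ℕ} (z : Fin (k + k) → ℂ) : Fin k → ℂ := fun i => z (Fin.natAdd k i)

/-- The matrix with entries `∏_{l ≠ j} h(xᵢ,y_l)`. -/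
def Mmat (ζ : ℂ) {k : ℕ} (x y : Fin k → ℂ) : Matrix (Fin k) (Fin k) ℂ :=
  Matrix.of fun i j => ∏ l, if l = j then 1 else hpol ζ (x i) (y l)

lemma isPolyFun_Hz {ζ : ℂ} {H : (k : ℕ) → (Fin (2 * k) → ℂ) → ℂ} (hH : IsHFamily ζ H) (k : ℕ) :
    IsPolyFun (Hz H k) :=
  IsPolyFun.comp (F := fun j z => z (Fin.cast (two_mul k) j)) (hH.2.1 k) fun _ => IsPolyFun.proj _

lemma hpol_symm (ζ x y : ℂ) : hpol ζ x y = hpol ζ y x := by rw [hpol, hpol]; ring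

lemma Hz_eq_ratio {ζ : ℂ} {H : (k : ℕ) → (Fin (2 * k) → ℂ) → ℂ} (hH : IsHFamily ζ H) {k : ℕ}
    {z : Fin (k + k) → ℂ} (hz : Function.Injective z)
    (hh : ∀ i j, hpol ζ (lh z i) (rh z j) ≠ 0) :
    Hz H k z * (vdm (lh z) * vdm (rh z)) = (∏ i, ∏ j, hpol ζ (lh z i) (rh z j)) *
      Matrix.det (Matrix.of fun i j : Fin k => (hpol ζ (lh z i) (rh z j))⁻¹) := by
  have hl : Function.Injective (lh z) := hz.comp (Fin.castAdd_injective k k)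
  have hr : Function.Injective (rh z) := hz.comp (Fin.natAdd_injective k k)
  have n1 := vdm_ne_zero hl
  have n2 := vdm_ne_zero hr
  have := hH.2.2 k (fun j => z (Fin.cast (two_mul k) j))
    ⟨fun i j hij => hl.ne hij, fun i j hij => hr.ne hij, hh⟩
  rw [Hz, this, Hratio]
  change (_ / (vdm (lh z) * vdm (rh z)) * _) * _ = _
  field_simp
  rfl

lemma generically_hpol_ne (ζ : ℂ) {ι : Type*} (i j : ι) :
    Generically fun z : ι → ℂ => hpol ζ (z i) (z j) ≠ 0 :=
  (IsPolyFun.hpol ζ (IsPolyFun.proj i) (IsPolyFun.proj j)).generically_ne ⟨0, by simp [hpol]⟩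

theorem Hz_mul_vdm {ζ : ℂ} {H : (k : ℕ) → (Fin (2 * k) → ℂ) → ℂ} (hH : IsHFamily ζ H) {k : ℕ}
    (z : Fin (k + k) → ℂ) :
    Hz H k z * (vdm (lh z) * vdm (rh z)) = (Mmat ζ (lh z) (rh z)).det := by
  refine IsPolyFun.eq_of_generically (f := fun z => Hz H k z * (vdm (lh z) * vdm (rh z)))
    (g := fun z => (Mmat ζ (lh z) (rh z)).det)
    (Generically.injective.and (Generically.forall_fintype fun i : Fin k =>
      Generically.forall_fintype fun j : Fin k =>
        generically_hpol_ne ζ (Fin.castAdd k i) (Fin.natAdd k j))) ?_ ?_ ?_ z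
  · exact (isPolyFun_Hz hH k).mul ((IsPolyFun.vdm fun i => IsPolyFun.proj _).mul
      (IsPolyFun.vdm fun i => IsPolyFun.proj _))
  · refine IsPolyFun.det fun i j => ?_
    change IsPolyFun fun z => ∏ l, if l = j then (1 : ℂ) else hpol ζ (lh z i) (rh z l)
    refine IsPolyFun.prod _ fun l => ?_
    split_ifs
    · exact IsPolyFun.const 1
    · exact IsPolyFun.hpol ζ (IsPolyFun.proj _) (IsPolyFun.proj _)
  · rintro z ⟨hz, hh⟩
    rw [Hz_eq_ratio hH hz hh, ← Matrix.det_mul_column]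
    congr 1
    ext i j
    rw [Matrix.of_apply, Matrix.of_apply, Mmat, Matrix.of_apply,
      ← Finset.mul_prod_erase _ _ (Finset.mem_univ j),
      ← Finset.mul_prod_erase (Finset.univ) (fun l => if l = j then _ else _) (Finset.mem_univ j)]
    have := hh i j
    rw [if_pos rfl, one_mul, mul_right_comm]
    change hpol ζ (lh z i) (rh z j) ≠ 0 at this
    rw [mul_inv_cancel₀ this, one_mul]
    refine Finset.prod_congr rfl fun l hl => ?_
    rw [if_neg (Finset.ne_of_mem_erase hl)]

/-- The function `(1 + (3+ζ²)x² − (1−ζ²)x³)/x`. -/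
def Efun (ζ x : ℂ) : ℂ := (1 + (3 + ζ ^ 2) * x ^ 2 - (1 - ζ ^ 2) * x ^ 3) / x

lemma Efun_sub (ζ : ℂ) {x y : ℂ} (hx : x ≠ 0) (hy : y ≠ 0) :
    (Efun ζ y - Efun ζ x) * (x * y) = -((y - x) * hpol ζ x y) := by
  rw [Efun, Efun, hpol]
  field_simp
  ring

theorem Hz_mul_vdm_full {ζ : ℂ} {H : (k : ℕ) → (Fin (2 * k) → ℂ) → ℂ} (hH : IsHFamily ζ H) {k : ℕ}
    {z : Fin (k + k) → ℂ} (hz : Function.Injective z) (h0 : ∀ a, z a ≠ 0)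
    (hh : ∀ a b, hpol ζ (z a) (z b) ≠ 0) :
    Hz H k z * vdm z * ∏ a, z a = ((-1) ^ k * (-1) ^ (k * k) * discSign k) * (∏ a, z a ^ k) *
      (bigMatrix (fun a => Efun ζ (z (finSumFinEquiv a))) (fun a => z (finSumFinEquiv a))).det := by
  have hl : ∀ i, lh z i ≠ 0 := fun i => h0 _
  have hr : ∀ i, rh z i ≠ 0 := fun i => h0 _
  have hne : ∀ a b, a ≠ b → Efun ζ (z b) - Efun ζ (z a) ≠ 0 := by
    intro a b hab h
    have := Efun_sub ζ (h0 a) (h0 b)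
    rw [h, zero_mul, zero_eq_neg, mul_eq_zero] at this
    rcases this with h | h
    · exact hab (hz (sub_eq_zero.1 h).symm)
    · exact hh _ _ h
  have hlr (i j : Fin k) : Fin.castAdd k i ≠ Fin.natAdd k j := by
    intro h
    have := congrArg Fin.val h
    simp at this
    omega
  have e := Hz_eq_ratio hH hz fun i j => hh _ _
  have eb := det_bigMatrix (fun i => Efun ζ (lh z i)) (fun i => Efun ζ (rh z i)) (lh z) (rh z)
    (fun i j hij => by
      by_contra hc
      exact hne (Fin.castAdd k i) (Fin.castAdd k j)
        (fun h => hc (Fin.castAdd_injective k k h)) (sub_eq_zero.2 hij.symm))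
    (fun i j => sub_ne_zero.1 (hne _ _ (hlr j i)))
  have hb : bigMatrix (fun a => Efun ζ (z (finSumFinEquiv a))) (fun a => z (finSumFinEquiv a)) =
      bigMatrix (Sum.elim (fun i => Efun ζ (lh z i)) (fun i => Efun ζ (rh z i)))
        (Sum.elim (lh z) (rh z)) := by
    congr 1 <;> funext a <;> rcases a with a | a <;> simp [lh, rh]
  have hv : vdm z = vdm (lh z) * vdm (rh z) * ∏ i, ∏ j, (rh z j - lh z i) := by
    rw [← vdm_append]
    congr 1
    funext a
    refine Fin.addCases (fun i => ?_) (fun i => ?_) a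
    · rw [Fin.append_left, lh]
    · rw [Fin.append_right, rh]
  have hinv (i j : Fin k) : (hpol ζ (lh z i) (rh z j))⁻¹ = -(lh z i)⁻¹ * ((rh z j)⁻¹ *
      ((rh z j - lh z i) * (Efun ζ (rh z j) - Efun ζ (lh z i))⁻¹)) := by
    have h1 := Efun_sub ζ (hl i) (hr j)
    have h2 : Efun ζ (rh z j) - Efun ζ (lh z i) ≠ 0 := hne _ _ (hlr i j)
    have h3 : hpol ζ (lh z i) (rh z j) ≠ 0 := hh _ _
    have h4 := hl i
    have h5 := hr j
    field_simp
    linear_combination h1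
  have hdet : Matrix.det (Matrix.of fun i j : Fin k => (hpol ζ (lh z i) (rh z j))⁻¹) =
      (∏ i, -(lh z i)⁻¹) * ((∏ j, (rh z j)⁻¹) * (Matrix.of fun i j => (rh z i - lh z j) *
        (Efun ζ (rh z i) - Efun ζ (lh z j))⁻¹).det) := by
    rw [← Matrix.det_transpose (Matrix.of fun i j => (rh z i - lh z j) * _),
      ← Matrix.det_mul_row, ← Matrix.det_mul_column]
    congr 1
    ext i j
    simp only [Matrix.of_apply, Matrix.transpose_apply]
    exact hinv i j
  have hprod : (∏ i, ∏ j, hpol ζ (lh z i) (rh z j)) * ∏ i, ∏ j, (rh z j - lh z i) =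
      (-1) ^ (k * k) * ((∏ i, lh z i ^ k) * (∏ i, rh z i ^ k)) *
        ∏ i, ∏ j, (Efun ζ (rh z i) - Efun ζ (lh z j)) := by
    rw [Finset.prod_comm (f := fun i j => Efun ζ (rh z i) - Efun ζ (lh z j))]
    simp only [← Finset.prod_mul_distrib]
    have h1 : ∀ i j, hpol ζ (lh z i) (rh z j) * (rh z j - lh z i) =
        -1 * ((lh z i * rh z j) * (Efun ζ (rh z j) - Efun ζ (lh z i))) := by
      intro i j
      linear_combination Efun_sub ζ (hl i) (hr j)
    simp only [h1, Finset.prod_mul_distrib, Finset.prod_const, Finset.card_univ, Fintype.card_fin,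
      Finset.prod_pow, ← pow_mul]
    ring
  have hz1 : ∏ a, z a = (∏ i, lh z i) * ∏ i, rh z i := Fin.prod_univ_add _
  have hzk : ∏ a, z a ^ k = (∏ i, lh z i ^ k) * ∏ i, rh z i ^ k := Fin.prod_univ_add _
  have hi : (∏ i, -(lh z i)⁻¹) * (∏ i, lh z i) = (-1) ^ k := by
    rw [← Finset.prod_mul_distrib]
    simp [hl]
  have hj : (∏ i, (rh z i)⁻¹) * (∏ i, rh z i) = 1 := by
    rw [← Finset.prod_mul_distrib]
    simp [hr]
  rw [hb, hv, hz1, hzk]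
  rw [hdet] at e
  set P := ∏ i, ∏ j, hpol ζ (lh z i) (rh z j)
  set Q := ∏ i, ∏ j, (rh z j - lh z i)
  set D := (Matrix.of fun i j => (rh z i - lh z j) * (Efun ζ (rh z i) - Efun ζ (lh z j))⁻¹).det
  calc Hz H k z * (vdm (lh z) * vdm (rh z) * Q) * ((∏ i, lh z i) * ∏ i, rh z i)
      = (P * Q) * (((∏ i, -(lh z i)⁻¹) * (∏ i, lh z i)) * ((∏ i, (rh z i)⁻¹) * (∏ i, rh z i)) * D) := by
        linear_combination (Q * ((∏ i, lh z i) * ∏ i, rh z i)) * e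
    _ = _ := by
        rw [hprod, hi, hj]
        linear_combination (-((-1) ^ k * (-1) ^ (k * k) *
          ((∏ i, lh z i ^ k) * ∏ i, rh z i ^ k))) * eb

theorem Hz_perm {ζ : ℂ} {H : (k : ℕ) → (Fin (2 * k) → ℂ) → ℂ} (hH : IsHFamily ζ H) {k : ℕ}
    (σ : Equiv.Perm (Fin (k + k))) (z : Fin (k + k) → ℂ) :
    Hz H k (fun a => z (σ a)) = Hz H k z := by
  refine IsPolyFun.eq_of_generically (f := fun z => Hz H k (fun a => z (σ a))) (g := Hz H k)
    ((Generically.injective (ι := Fin (k + k))).and ((Generically.forall_fintype fun a =>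
      (IsPolyFun.proj a).generically_ne ⟨fun _ => 1, one_ne_zero⟩).and
      (Generically.forall_fintype fun a => Generically.forall_fintype fun b =>
        generically_hpol_ne ζ a b))) ?_ (isPolyFun_Hz hH k) ?_ z
  · exact (isPolyFun_Hz hH k).comp fun a => IsPolyFun.proj (σ a)
  rintro z ⟨hz, h0, hh⟩
  have e1 := Hz_mul_vdm_full hH hz h0 hh
  have e2 := Hz_mul_vdm_full hH (z := fun a => z (σ a)) (hz.comp σ.injective) (fun a => h0 _)
    fun a b => hh _ _
  have p1 : ∏ a, z (σ a) = ∏ a, z a := Equiv.prod_comp σ z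
  have p2 : ∏ a, z (σ a) ^ k = ∏ a, z a ^ k := Equiv.prod_comp σ fun a => z a ^ k
  have v : vdm (fun a => z (σ a)) = (Equiv.Perm.sign σ : ℤ) * vdm z := by
    rw [vdm_eq_det, vdm_eq_det, ← Matrix.det_permute]
    rfl
  set σ' : Equiv.Perm (Fin k ⊕ Fin k) := (finSumFinEquiv.trans σ).trans finSumFinEquiv.symm
  have b : (bigMatrix (fun a => Efun ζ (z (σ (finSumFinEquiv a))))
      (fun a => z (σ (finSumFinEquiv a)))).det = (Equiv.Perm.sign σ : ℤ) *
      (bigMatrix (fun a => Efun ζ (z (finSumFinEquiv a))) (fun a => z (finSumFinEquiv a))).det := by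
    have hs : Equiv.Perm.sign σ' = Equiv.Perm.sign σ :=
      Equiv.Perm.sign_trans_trans_symm σ finSumFinEquiv
    rw [← hs, ← Matrix.det_permute]
    congr 1
    ext a b
    simp [bigMatrix, σ']
  have hp : ∏ a, z a ≠ 0 := Finset.prod_ne_zero_iff.2 fun a _ => h0 a
  have hs : ((Equiv.Perm.sign σ : ℤ) : ℂ) ≠ 0 := by simp
  have hv := vdm_ne_zero hz
  rw [p1, p2, v, b] at e2
  apply mul_right_cancel₀ (mul_ne_zero (mul_ne_zero hs hv) hp)
  linear_combination e2 - ((Equiv.Perm.sign σ : ℤ) : ℂ) * e1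

lemma getD_swap {α : Type*} (pre post : List α) (a b d : α) (j : ℕ) :
    (pre ++ b :: a :: post).getD j d =
      (pre ++ a :: b :: post).getD (Equiv.swap pre.length (pre.length + 1) j) d := by
  rcases lt_trichotomy j pre.length with h | h | h
  · rw [Equiv.swap_apply_of_ne_of_ne (by omega) (by omega)]
    rw [List.getD_append _ _ _ _ h, List.getD_append _ _ _ _ h]
  · subst h
    rw [Equiv.swap_apply_left]
    simp
  · rcases Nat.eq_or_lt_of_le h with h' | h'
    · rw [← h', Equiv.swap_apply_right]
      simp
    · rw [Equiv.swap_apply_of_ne_of_ne (by omega) (by omega)]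
      obtain ⟨i, rfl⟩ : ∃ i, j = pre.length + (i + 2) := ⟨j - pre.length - 2, by omega⟩
      rw [List.getD_append_right _ _ _ _ (by omega), List.getD_append_right _ _ _ _ (by omega),
        Nat.add_sub_cancel_left]
      rfl

lemma swap_val {n : ℕ} (i j l : Fin n) :
    ((Equiv.swap i j l : Fin n) : ℕ) = Equiv.swap (i : ℕ) (j : ℕ) (l : ℕ) := by
  rw [Equiv.swap_apply_def, Equiv.swap_apply_def]
  split_ifs <;> simp_all [Fin.ext_iff]

lemma perm_induction_of_swap {α β : Type*} (f : List α → β) (n : ℕ)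
    (h : ∀ pre post a b, (pre ++ a :: b :: post).length = n →
      f (pre ++ a :: b :: post) = f (pre ++ b :: a :: post)) {l l' : List α} (hp : l.Perm l')
    (hl : l.length = n) : f l = f l' := by
  suffices H : ∀ pre, (pre ++ l).length = n → f (pre ++ l) = f (pre ++ l') by
    simpa using H [] (by simpa using hl)
  clear hl
  induction hp with
  | nil => intro _ _; rfl
  | cons x _ ih =>
    intro pre hpre
    have := ih (pre ++ [x]) (by simpa using hpre)
    simpa using this
  | swap x y l =>
    intro pre hpre
    exact h _ _ _ _ hpre
  | trans h1 _ ih1 ih2 =>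
    intro pre hpre
    rw [ih1 pre hpre, ih2 pre (by rw [List.length_append, ← h1.length_eq, ← List.length_append, hpre])]

/-- `H_{2k}` as a function of a list of length `2k`. -/
def HL (H : (k : ℕ) → (Fin (2 * k) → ℂ) → ℂ) (l : List ℂ) : ℂ := H (l.length / 2) (padded l)

lemma HL_eq_Hz (H : (k : ℕ) → (Fin (2 * k) → ℂ) → ℂ) {l : List ℂ} {k : ℕ} (hl : l.length = 2 * k) :
    HL H l = Hz H k fun a => l.getD a 0 := by
  obtain rfl : k = l.length / 2 := by omega
  rfl

lemma HL_perm {ζ : ℂ} {H : (k : ℕ) → (Fin (2 * k) → ℂ) → ℂ} (hH : IsHFamily ζ H) {k : ℕ}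
    {l l' : List ℂ} (hp : l.Perm l') (hl : l.length = 2 * k) : HL H l = HL H l' := by
  refine perm_induction_of_swap (HL H) (2 * k) (fun pre post a b h => ?_) hp hl
  have h' : (pre ++ b :: a :: post).length = 2 * k := by simpa using h
  rw [HL_eq_Hz H h, HL_eq_Hz H h']
  have hlen : pre.length + 1 < k + k := by simp at h; omega
  rw [← Hz_perm hH (Equiv.swap ⟨pre.length, by omega⟩ ⟨pre.length + 1, hlen⟩)]
  congr 1
  funext j
  rw [swap_val]
  exact (getD_swap pre post a b 0 j).symm

lemma HL_append {H : (k : ℕ) → (Fin (2 * k) → ℂ) → ℂ} {k : ℕ} {w v : List ℂ}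
    (hw : w.length = k) (hv : v.length = k) {x y : Fin k → ℂ} (hx : ∀ i : Fin k, w.getD i 0 = x i)
    (hy : ∀ i : Fin k, v.getD i 0 = y i) : HL H (w ++ v) = Hz H k (Fin.append x y) := by
  rw [HL_eq_Hz H (k := k) (by rw [List.length_append]; omega)]
  congr 1
  funext a
  refine Fin.addCases (fun i => ?_) (fun i => ?_) a
  · rw [Fin.append_left, ← hx, List.getD_append _ _ _ _ (by rw [hw]; exact i.2)]
    rfl
  · rw [Fin.append_right, ← hy, List.getD_append_right _ _ _ _ (by simp [hw])]
    congr 1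
    simp [hw]

lemma lh_append {k : ℕ} (x y : Fin k → ℂ) : lh (Fin.append x y) = x := by
  funext i; rw [lh, Fin.append_left]

lemma rh_append {k : ℕ} (x y : Fin k → ℂ) : rh (Fin.append x y) = y := by
  funext i; rw [rh, Fin.append_right]

lemma HL_nil {ζ : ℂ} {H : (k : ℕ) → (Fin (2 * k) → ℂ) → ℂ} (hH : IsHFamily ζ H) :
    HL H [] = 1 := hH.1 _

lemma HL_pair {ζ : ℂ} {H : (k : ℕ) → (Fin (2 * k) → ℂ) → ℂ} (hH : IsHFamily ζ H) (a b : ℂ) :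
    HL H [a, b] = 1 := by
  have := Hz_mul_vdm hH (k := 1) (Fin.append (fun _ => a) (fun _ => b))
  rw [show [a, b] = [a] ++ [b] from rfl, HL_append (k := 1) rfl rfl (x := fun _ => a)
    (y := fun _ => b) (by simp) (by simp)]
  simpa [vdm, Mmat] using this

lemma HL_four {ζ : ℂ} {H : (k : ℕ) → (Fin (2 * k) → ℂ) → ℂ} (hH : IsHFamily ζ H) (a b c d : ℂ) :
    HL H [a, b, c, d] = 3 + ζ ^ 2 - (1 - ζ ^ 2) * (a + b + c + d) +
      (1 - ζ ^ 2) ^ 2 * (a * b * c * d) := by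
  have key : ∀ z : Fin (2 + 2) → ℂ, Hz H 2 z = 3 + ζ ^ 2 - (1 - ζ ^ 2) * (z 0 + z 1 + z 2 + z 3) +
      (1 - ζ ^ 2) ^ 2 * (z 0 * z 1 * z 2 * z 3) := by
    refine IsPolyFun.eq_of_generically (Generically.injective (ι := Fin (2 + 2)))
      (isPolyFun_Hz hH 2) ?_ ?_
    · have p := fun i : Fin (2 + 2) => IsPolyFun.proj i
      exact ((IsPolyFun.const _).sub ((IsPolyFun.const _).mul
        ((((p 0).add (p 1)).add (p 2)).add (p 3)))).add ((IsPolyFun.const _).mul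
        ((((p 0).mul (p 1)).mul (p 2)).mul (p 3)))
    · intro z hz
      have e := Hz_mul_vdm hH z
      have h1 : z 1 - z 0 ≠ 0 := sub_ne_zero.2 (hz.ne (by decide))
      have h2 : z 3 - z 2 ≠ 0 := sub_ne_zero.2 (hz.ne (by decide))
      have hv1 : vdm (lh z) = z 1 - z 0 := by
        simp [vdm, Fin.prod_univ_two, lh]
      have hv2 : vdm (rh z) = z 3 - z 2 := by
        simp [vdm, Fin.prod_univ_two, rh]
      have hM : (Mmat ζ (lh z) (rh z)).det = hpol ζ (z 0) (z 3) * hpol ζ (z 1) (z 2) -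
          hpol ζ (z 0) (z 2) * hpol ζ (z 1) (z 3) := by
        rw [Matrix.det_fin_two]
        simp [Mmat, Fin.prod_univ_two]
        rfl
      rw [hv1, hv2, hM] at e
      apply mul_right_cancel₀ (mul_ne_zero h1 h2)
      rw [e]
      simp only [hpol]
      ring
  rw [HL_eq_Hz H (k := 2) rfl, key]
  rfl

lemma hpol_factor {ζ a b c : ℂ} (ht : 1 - ζ ^ 2 ≠ 0) (hs : a + b + c = (3 + ζ ^ 2) / (1 - ζ ^ 2))
    (hp : a * b * c = 1 / (1 - ζ ^ 2)) (x : ℂ) :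
    hpol ζ a x = (1 - ζ ^ 2) * a * ((x - b) * (x - c)) := by
  have h1 : (1 - ζ ^ 2) * (a + b + c) = 3 + ζ ^ 2 := by rw [hs]; field_simp
  have h2 : (1 - ζ ^ 2) * (a * b * c) = 1 := by rw [hp]; field_simp
  rw [hpol]
  linear_combination (a * x) * h1 - h2

lemma det_Mmat_cons {ζ a b : ℂ} (hab : hpol ζ a b = 0) {m : ℕ} (x y : Fin m → ℂ) :
    (Mmat ζ (Fin.cons a x : Fin (m + 1) → ℂ) (Fin.cons b y)).det =
      (∏ j, hpol ζ a (y j)) * ((∏ i, hpol ζ (x i) b) * (Mmat ζ x y).det) := by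
  rw [Matrix.det_succ_row_zero, Fin.sum_univ_succ]
  have h0 : ∀ j : Fin m, Mmat ζ (Fin.cons a x : Fin (m + 1) → ℂ) (Fin.cons b y) 0 j.succ = 0 := by
    intro j
    rw [Mmat, Matrix.of_apply, Fin.prod_univ_succ, if_neg (Fin.succ_ne_zero j).symm]
    simp [hab]
  simp only [h0, mul_zero, zero_mul, Finset.sum_const_zero, add_zero, Fin.val_zero, pow_zero,
    one_mul]
  rw [← Matrix.det_mul_column]
  congr 1
  · simp [Mmat, Fin.prod_univ_succ]
  · congr 1
    ext i j
    simp only [Mmat, Fin.prod_univ_succ, Matrix.submatrix_apply, Matrix.of_apply, Fin.cons_succ,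
      Fin.cons_zero, Fin.zero_succAbove, Fin.succ_inj, if_neg (Fin.succ_ne_zero j).symm]

theorem Hz_cons {ζ : ℂ} {H : (k : ℕ) → (Fin (2 * k) → ℂ) → ℂ} (hH : IsHFamily ζ H) {a b c : ℂ}
    (ht : 1 - ζ ^ 2 ≠ 0) (hs : a + b + c = (3 + ζ ^ 2) / (1 - ζ ^ 2))
    (hp : a * b * c = 1 / (1 - ζ ^ 2)) {m : ℕ} (z : Fin (m + m) → ℂ) :
    Hz H (m + 1) (Fin.append (Fin.cons a (lh z)) (Fin.cons b (rh z))) =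
      ((1 - ζ ^ 2) / c) ^ m * ((∏ i, (lh z i - c)) * ∏ i, (rh z i - c)) * Hz H m z := by
  have hp' : (1 - ζ ^ 2) * (a * b * c) = 1 := by rw [hp]; field_simp
  have hc : c ≠ 0 := by
    rintro rfl
    simp at hp'
  have hne : ∀ (u : ℂ) (i : Fin (m + m)), Generically fun z : Fin (m + m) → ℂ => z i - u ≠ 0 :=
    fun u i => ((IsPolyFun.proj i).sub (IsPolyFun.const u)).generically_ne
      ⟨fun _ => u + 1, by simp⟩
  refine IsPolyFun.eq_of_generically
    (f := fun z : Fin (m + m) → ℂ =>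
      Hz H (m + 1) (Fin.append (Fin.cons a (lh z)) (Fin.cons b (rh z))))
    (g := fun z => ((1 - ζ ^ 2) / c) ^ m * ((∏ i, (lh z i - c)) * ∏ i, (rh z i - c)) * Hz H m z)
    ((Generically.injective (ι := Fin (m + m))).and
      ((Generically.forall_fintype (hne a)).and (Generically.forall_fintype (hne b)))) ?_ ?_ ?_ z
  · refine (isPolyFun_Hz hH (m + 1)).comp fun j => ?_
    refine Fin.addCases (fun i => ?_) (fun i => ?_) j
    · simp only [Fin.append_left]
      refine Fin.cases ?_ (fun i => ?_) i
      · exact IsPolyFun.const a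
      · exact IsPolyFun.proj _
    · simp only [Fin.append_right]
      refine Fin.cases ?_ (fun i => ?_) i
      · exact IsPolyFun.const b
      · exact IsPolyFun.proj _
  · refine ((IsPolyFun.const _).mul (IsPolyFun.mul ?_ ?_)).mul (isPolyFun_Hz hH m)
    · exact IsPolyFun.prod _ fun i => (IsPolyFun.proj _).sub (IsPolyFun.const c)
    · exact IsPolyFun.prod _ fun i => (IsPolyFun.proj _).sub (IsPolyFun.const c)
  · rintro z ⟨hz, ha, hb⟩
    have e1 := Hz_mul_vdm hH (Fin.append (Fin.cons a (lh z) : Fin (m + 1) → ℂ) (Fin.cons b (rh z)))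
    have e0 := Hz_mul_vdm hH z
    have hf := hpol_factor ht hs hp
    have hg := hpol_factor (a := b) (b := a) (c := c) ht (by rw [← hs]; ring) (by rw [← hp]; ring)
    rw [lh_append, rh_append, vdm_cons, vdm_cons,
      det_Mmat_cons (by rw [hf]; ring) (lh z) (rh z), ← e0] at e1
    have nl := vdm_ne_zero (hz.comp (Fin.castAdd_injective m m))
    have nr := vdm_ne_zero (hz.comp (Fin.natAdd_injective m m))
    change vdm (lh z) ≠ 0 at nl
    change vdm (rh z) ≠ 0 at nr
    have na : ∏ i, (lh z i - a) ≠ 0 := Finset.prod_ne_zero_iff.2 fun i _ => ha _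
    have nb : ∏ i, (rh z i - b) ≠ 0 := Finset.prod_ne_zero_iff.2 fun i _ => hb _
    simp only [hpol_symm ζ _ b, hf, hg, Finset.prod_mul_distrib, Finset.prod_const,
      Finset.card_univ, Fintype.card_fin] at e1
    have hcoef : ((1 - ζ ^ 2) ^ m * a ^ m) * ((1 - ζ ^ 2) ^ m * b ^ m) =
        ((1 - ζ ^ 2) / c) ^ m := by
      rw [← mul_pow, ← mul_pow, ← mul_pow]
      congr 1
      field_simp
      linear_combination hp'
    apply mul_right_cancel₀ (mul_ne_zero (mul_ne_zero na nl) (mul_ne_zero nb nr))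
    rw [e1, ← hcoef]
    ring

lemma prod_getD_eq {l : List ℂ} {m : ℕ} (hl : l.length = m) (f : ℂ → ℂ) :
    ∏ i : Fin m, f (l.getD i 0) = (l.map f).prod := by
  subst hl
  rw [← List.prod_ofFn]
  congr 1
  apply List.ext_getElem <;> simp

theorem HL_rec {ζ : ℂ} {H : (k : ℕ) → (Fin (2 * k) → ℂ) → ℂ} (hH : IsHFamily ζ H) {a b c : ℂ}
    (ht : 1 - ζ ^ 2 ≠ 0) (hs : a + b + c = (3 + ζ ^ 2) / (1 - ζ ^ 2))
    (hp : a * b * c = 1 / (1 - ζ ^ 2)) {m : ℕ} {l : List ℂ} (hl : l.length = 2 * m) :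
    HL H (a :: b :: l) = ((1 - ζ ^ 2) / c) ^ m * (l.map fun x => x - c).prod * HL H l := by
  obtain ⟨u, v, hu, hv, rfl⟩ : ∃ u v : List ℂ, u.length = m ∧ v.length = m ∧ u ++ v = l :=
    ⟨l.take m, l.drop m, by rw [List.length_take]; omega, by rw [List.length_drop]; omega,
      List.take_append_drop m l⟩
  have h1 : (a :: b :: (u ++ v)).Perm ((a :: u) ++ (b :: v)) :=
    List.Perm.cons a (List.perm_middle.symm)
  rw [HL_perm hH (k := m + 1) h1 (by simp; omega),
    HL_append (k := m + 1) (by simp [hu]) (by simp [hv])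
      (x := Fin.cons a fun i => u.getD i 0) (y := Fin.cons b fun i => v.getD i 0)
      (fun i => by refine Fin.cases ?_ (fun i => ?_) i <;> simp)
      (fun i => by refine Fin.cases ?_ (fun i => ?_) i <;> simp),
    HL_append hu hv (x := fun i => u.getD i 0) (y := fun i => v.getD i 0) (fun _ => rfl)
      (fun _ => rfl)]
  have := Hz_cons hH ht hs hp (Fin.append (fun i : Fin m => u.getD i 0) (fun i => v.getD i 0))
  rw [lh_append, rh_append] at this
  rw [this, List.map_append, List.prod_append, prod_getD_eq hu fun x => x - c,
    prod_getD_eq hv fun x => x - c]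

section

open Filter Topology

lemma IsPolyFun.exists_update {ι : Type*} [DecidableEq ι] {f : (ι → ℂ) → ℂ} (hf : IsPolyFun f)
    (i : ι) : ∃ Q : Polynomial (MvPolynomial ι ℂ), ∀ w y,
      f (Function.update w i y) = (Q.map (MvPolynomial.eval w)).eval y := by
  obtain ⟨P, hP⟩ := hf
  refine ⟨MvPolynomial.aeval (fun j => if j = i then Polynomial.X
    else Polynomial.C (MvPolynomial.X j)) P, fun w y => ?_⟩
  rw [hP]
  clear hP
  induction P using MvPolynomial.induction_on with
  | C a => simp [MvPolynomial.algebraMap_eq]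
  | add p q hp hq => simp [hp, hq]
  | mul_X p j hp =>
    rw [map_mul, hp, map_mul, Polynomial.map_mul, Polynomial.eval_mul]
    congr 1
    by_cases h : j = i
    · subst h
      simp
    · simp [h]

lemma natDegree_map_le_of_generically {ι : Type*} {Q : Polynomial (MvPolynomial ι ℂ)} {m : ℕ}
    (h : Generically fun w => (Q.map (MvPolynomial.eval w)).natDegree ≤ m) (w : ι → ℂ) :
    (Q.map (MvPolynomial.eval w)).natDegree ≤ m := by
  rw [Polynomial.natDegree_le_iff_coeff_eq_zero]
  intro j hj
  rw [Polynomial.coeff_map]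
  refine IsPolyFun.eq_of_generically (f := fun w => MvPolynomial.eval w (Q.coeff j))
    (g := fun _ => 0) h ⟨_, fun _ => rfl⟩ (IsPolyFun.const 0) (fun w hw => ?_) w
  have := Polynomial.natDegree_le_iff_coeff_eq_zero.1 hw j hj
  rwa [Polynomial.coeff_map] at this

/-- `h(X, v)` as a polynomial. -/
def hX (ζ v : ℂ) : Polynomial ℂ :=
  Polynomial.C ((1 - ζ ^ 2) * v) * Polynomial.X ^ 2 +
    Polynomial.C ((1 - ζ ^ 2) * v ^ 2 - (3 + ζ ^ 2) * v) * Polynomial.X + Polynomial.C 1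

lemma eval_hX (ζ v y : ℂ) : (hX ζ v).eval y = hpol ζ y v := by
  simp [hX, hpol]
  ring

lemma natDegree_hX (ζ v : ℂ) : (hX ζ v).natDegree ≤ 2 := Polynomial.natDegree_quadratic_le

theorem Hz_natDegree {ζ : ℂ} {H : (k : ℕ) → (Fin (2 * k) → ℂ) → ℂ} (hH : IsHFamily ζ H) (m : ℕ)
    (w : Fin (m + 1 + (m + 1)) → ℂ) : ∃ q : Polynomial ℂ, q.natDegree ≤ m ∧
      ∀ y, Hz H (m + 1) (Function.update w (Fin.castAdd _ 0) y) = q.eval y := by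
  obtain ⟨Q, hQ⟩ := (isPolyFun_Hz hH (m + 1)).exists_update (Fin.castAdd _ 0)
  refine ⟨_, natDegree_map_le_of_generically (Generically.injective.mono fun w hw => ?_) w,
    fun y => hQ w y⟩
  set q := Q.map (MvPolynomial.eval w) with hq
  by_cases hq0 : q = 0
  · rw [hq0]
    simp
  let x : Fin m → ℂ := fun i => lh w i.succ
  have hx : Function.Injective x :=
    (hw.comp (Fin.castAdd_injective _ _)).comp (Fin.succ_injective m)
  have hl (y : ℂ) : lh (Function.update w (Fin.castAdd _ 0) y) = Fin.cons y x := by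
    funext i
    refine Fin.cases ?_ (fun i => ?_) i
    · simp [lh]
    · rw [lh, Function.update_of_ne, Fin.cons_succ]
      · rfl
      · exact fun h => Fin.succ_ne_zero i (Fin.castAdd_injective _ _ h)
  have hr (y : ℂ) : rh (Function.update w (Fin.castAdd _ 0) y) = rh w := by
    funext i
    rw [rh, Function.update_of_ne, rh]
    intro h
    have := congrArg Fin.val h
    simp at this
  have hpoly : q * ((∏ i, (Polynomial.C (x i) - Polynomial.X)) *
      Polynomial.C (vdm x * vdm (rh w))) =
      ∑ j : Fin (m + 1), (∏ l ∈ Finset.univ.erase j, hX ζ (rh w l)) * Polynomial.C ((-1) ^ (j : ℕ) *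
        (Matrix.of fun (i : Fin m) (j' : Fin m) => ∏ l, if l = j.succAbove j' then 1 else
          hpol ζ (x i) (rh w l)).det) := by
    apply Polynomial.funext
    intro y
    have e := Hz_mul_vdm hH (Function.update w (Fin.castAdd _ 0) y)
    rw [hl, hr, vdm_cons, hQ, ← hq, Matrix.det_succ_row_zero] at e
    simp only [Polynomial.eval_mul, Polynomial.eval_prod, Polynomial.eval_sub, Polynomial.eval_C,
      Polynomial.eval_X, Polynomial.eval_finsetSum, eval_hX]
    rw [← mul_assoc (∏ i, _), e]
    refine Finset.sum_congr rfl fun j _ => ?_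
    rw [mul_comm (∏ l ∈ _, _), mul_right_comm]
    congr 1
    rw [Mmat, Matrix.of_apply, ← Finset.mul_prod_erase _ _ (Finset.mem_univ j), if_pos rfl, one_mul]
    refine Finset.prod_congr rfl fun l hl => ?_
    rw [if_neg (Finset.ne_of_mem_erase hl), Fin.cons_zero]
  have hdeg : (∑ j : Fin (m + 1), (∏ l ∈ Finset.univ.erase j, hX ζ (rh w l)) *
      Polynomial.C ((-1) ^ (j : ℕ) * (Matrix.of fun (i : Fin m) (j' : Fin m) =>
        ∏ l, if l = j.succAbove j' then 1 else hpol ζ (x i) (rh w l)).det)).natDegree ≤ 2 * m := by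
    refine Polynomial.natDegree_sum_le_of_forall_le _ _ fun j _ => ?_
    refine (Polynomial.natDegree_mul_C_le _ _).trans ?_
    refine (Polynomial.natDegree_prod_le _ _).trans ?_
    refine (Finset.sum_le_card_nsmul _ _ 2 fun l _ => natDegree_hX ζ _).trans ?_
    rw [Finset.card_erase_of_mem (Finset.mem_univ j)]
    simp
    omega
  rw [← hpoly] at hdeg
  have hlin : ∀ i, (Polynomial.C (x i) - Polynomial.X).natDegree = 1 := fun i => by
    rw [← Polynomial.natDegree_neg, neg_sub, Polynomial.natDegree_X_sub_C]
  have hlin0 : ∀ i, (Polynomial.C (x i) - Polynomial.X) ≠ 0 := fun i h => by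
    have := hlin i
    rw [h] at this
    simp at this
  have hc : vdm x * vdm (rh w) ≠ 0 :=
    mul_ne_zero (vdm_ne_zero hx) (vdm_ne_zero (hw.comp (Fin.natAdd_injective _ _)))
  have hprod : (∏ i, (Polynomial.C (x i) - Polynomial.X)) ≠ 0 :=
    Finset.prod_ne_zero_iff.2 fun i _ => hlin0 i
  rw [Polynomial.natDegree_mul hq0 (mul_ne_zero hprod (Polynomial.C_ne_zero.2 hc)),
    Polynomial.natDegree_mul_C hc, Polynomial.natDegree_prod _ _ fun i _ => hlin0 i] at hdeg
  simp only [hlin, Finset.sum_const, Finset.card_univ, Fintype.card_fin, smul_eq_mul,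
    mul_one] at hdeg
  omega

theorem HL_natDegree {ζ : ℂ} {H : (k : ℕ) → (Fin (2 * k) → ℂ) → ℂ} (hH : IsHFamily ζ H) {m : ℕ}
    {l : List ℂ} (hl : l.length = 2 * m + 1) : ∃ q : Polynomial ℂ, q.natDegree ≤ m ∧
      ∀ y, HL H (y :: l) = q.eval y := by
  obtain ⟨q, hq, h⟩ := Hz_natDegree hH m fun a => (0 :: l).getD a 0
  refine ⟨q, hq, fun y => ?_⟩
  rw [← h, HL_eq_Hz H (k := m + 1) (by simp [hl]; ring)]
  congr 1
  funext ⟨a, ha⟩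
  rcases a with _ | a
  · rw [show (⟨0, ha⟩ : Fin (m + 1 + (m + 1))) = Fin.castAdd _ 0 from rfl, Function.update_self]
    rfl
  · rw [Function.update_of_ne]
    · rfl
    · intro h
      have := congrArg Fin.val h
      simp at this

/-- The coefficient of degree `m` of the interpolation polynomial of `f` at `0,…,m`. -/
def topCoeff (m : ℕ) (f : ℂ → ℂ) : ℂ := ∑ s : Fin (m + 1), f (s : ℕ) *
  (Lagrange.basis Finset.univ (fun s : Fin (m + 1) => ((s : ℕ) : ℂ)) s).coeff m

lemma natCast_injective (m : ℕ) : Function.Injective fun s : Fin (m + 1) => ((s : ℕ) : ℂ) :=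
  fun _ _ h => Fin.ext (Nat.cast_injective (R := ℂ) h)

lemma eq_sum_basis {m : ℕ} {q : Polynomial ℂ} (hq : q.natDegree ≤ m) :
    q = ∑ s : Fin (m + 1), Polynomial.C (q.eval ((s : ℕ) : ℂ)) *
      Lagrange.basis Finset.univ (fun s : Fin (m + 1) => ((s : ℕ) : ℂ)) s := by
  have := Lagrange.eq_interpolate (s := Finset.univ) (v := fun s : Fin (m + 1) => ((s : ℕ) : ℂ))
    (f := q) (natCast_injective m).injOn (by
      refine lt_of_le_of_lt Polynomial.degree_le_natDegree ?_
      simp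
      exact_mod_cast Nat.lt_succ_of_le hq)
  conv_lhs => rw [this]
  rw [Lagrange.interpolate_apply]

lemma topCoeff_eval {m : ℕ} {q : Polynomial ℂ} (hq : q.natDegree ≤ m) :
    topCoeff m (fun y => q.eval y) = q.coeff m := by
  conv_rhs => rw [eq_sum_basis hq]
  rw [Polynomial.finsetSum_coeff, topCoeff]
  simp only [Polynomial.coeff_C_mul]

end

section

open Filter Topology

/-- The normalised leading coefficient of `y ↦ H_{2m+2}(y, l)` for a list `l` of length `2m+1`. -/
def Hi (H : (k : ℕ) → (Fin (2 * k) → ℂ) → ℂ) (ζ : ℂ) (l : List ℂ) : ℂ :=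
  topCoeff (l.length / 2) (fun y => HL H (y :: l)) / (-(1 - ζ ^ 2)) ^ (l.length / 2)

lemma Hi_eq {H : (k : ℕ) → (Fin (2 * k) → ℂ) → ℂ} {ζ : ℂ} {l : List ℂ} {m : ℕ}
    (hl : l.length = 2 * m + 1) {q : Polynomial ℂ} (hq : q.natDegree ≤ m)
    (h : ∀ y, HL H (y :: l) = q.eval y) : Hi H ζ l = q.coeff m / (-(1 - ζ ^ 2)) ^ m := by
  have : l.length / 2 = m := by omega
  rw [Hi, this, funext h, topCoeff_eval hq]

lemma Hi_perm {ζ : ℂ} {H : (k : ℕ) → (Fin (2 * k) → ℂ) → ℂ} (hH : IsHFamily ζ H) {m : ℕ}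
    {l l' : List ℂ} (hp : l.Perm l') (hl : l.length = 2 * m + 1) : Hi H ζ l = Hi H ζ l' := by
  rw [Hi, Hi, ← hp.length_eq,
    funext fun y => HL_perm hH (k := m + 1) (hp.cons y) (by simp; omega)]

lemma Hi_single {ζ : ℂ} {H : (k : ℕ) → (Fin (2 * k) → ℂ) → ℂ} (hH : IsHFamily ζ H) (a : ℂ) :
    Hi H ζ [a] = 1 := by
  rw [Hi_eq (m := 0) (q := 1) rfl (by simp) fun y => by rw [HL_pair hH]; simp]
  simp

lemma Hi_triple {ζ : ℂ} {H : (k : ℕ) → (Fin (2 * k) → ℂ) → ℂ} (hH : IsHFamily ζ H)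
    (ht : 1 - ζ ^ 2 ≠ 0) (a b c : ℂ) : Hi H ζ [a, b, c] = 1 - (1 - ζ ^ 2) * (a * b * c) := by
  rw [Hi_eq (m := 1) (q := Polynomial.C (-(1 - ζ ^ 2) + (1 - ζ ^ 2) ^ 2 * (a * b * c)) *
    Polynomial.X + Polynomial.C (3 + ζ ^ 2 - (1 - ζ ^ 2) * (a + b + c))) rfl
    Polynomial.natDegree_linear_le fun y => by
      rw [HL_four hH]
      simp
      ring]
  simp only [Polynomial.coeff_add, Polynomial.coeff_C_mul, Polynomial.coeff_X_one,
    Polynomial.coeff_C_succ, pow_one]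
  field_simp
  ring

theorem Hi_natDegree {ζ : ℂ} {H : (k : ℕ) → (Fin (2 * k) → ℂ) → ℂ} (hH : IsHFamily ζ H) {m : ℕ}
    {l : List ℂ} (hl : l.length = 2 * m) : ∃ q : Polynomial ℂ, q.natDegree ≤ m ∧
      ∀ y, Hi H ζ (y :: l) = q.eval y := by
  choose q hq h using fun s : ℂ => HL_natDegree hH (m := m) (l := s :: l) (by simp [hl])
  refine ⟨∑ s : Fin (m + 1), q (s : ℕ) * Polynomial.C ((Lagrange.basis Finset.univ
    (fun s : Fin (m + 1) => ((s : ℕ) : ℂ)) s).coeff m / (-(1 - ζ ^ 2)) ^ m),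
    Polynomial.natDegree_sum_le_of_forall_le _ _ fun s _ =>
      (Polynomial.natDegree_mul_C_le _ _).trans (hq _), fun y => ?_⟩
  have hm : (y :: l).length / 2 = m := by simp [hl]; omega
  rw [Hi, hm, topCoeff, Finset.sum_div, Polynomial.eval_finsetSum]
  refine Finset.sum_congr rfl fun s _ => ?_
  rw [HL_perm hH (k := m + 1) (List.Perm.swap y _ l) (by simp; omega), h, Polynomial.eval_mul,
    Polynomial.eval_C, mul_div_assoc]

theorem Hi_rec {ζ : ℂ} {H : (k : ℕ) → (Fin (2 * k) → ℂ) → ℂ} (hH : IsHFamily ζ H) {a b c : ℂ}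
    (ht : 1 - ζ ^ 2 ≠ 0) (hs : a + b + c = (3 + ζ ^ 2) / (1 - ζ ^ 2))
    (hp : a * b * c = 1 / (1 - ζ ^ 2)) {m : ℕ} {l : List ℂ} (hl : l.length = 2 * m + 1) :
    Hi H ζ (a :: b :: l) =
      -(1 / c) * ((1 - ζ ^ 2) / c) ^ m * (l.map fun x => x - c).prod * Hi H ζ l := by
  obtain ⟨q, hq, h⟩ := HL_natDegree hH hl
  have hc : c ≠ 0 := by
    rintro rfl
    rw [mul_zero, eq_comm, one_div, inv_eq_zero] at hp
    exact ht hp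
  have h' (y : ℂ) : HL H (y :: a :: b :: l) = (Polynomial.C (((1 - ζ ^ 2) / c) ^ (m + 1) *
      (l.map fun x => x - c).prod) * (q * (Polynomial.X - Polynomial.C c))).eval y := by
    have hperm : (y :: a :: b :: l).Perm (a :: b :: y :: l) :=
      (List.Perm.swap a y _).trans ((List.Perm.swap b y l).cons a)
    rw [HL_perm hH (k := m + 2) hperm (by simp; omega),
      HL_rec hH ht hs hp (m := m + 1) (by simp; omega), h]
    simp
    ring
  have hdeg : (Polynomial.C (((1 - ζ ^ 2) / c) ^ (m + 1) *
      (l.map fun x => x - c).prod) * (q * (Polynomial.X - Polynomial.C c))).natDegree ≤ m + 1 := by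
    refine (Polynomial.natDegree_C_mul_le _ _).trans (Polynomial.natDegree_mul_le.trans ?_)
    rw [Polynomial.natDegree_X_sub_C]
    omega
  rw [Hi_eq hl hq h, Hi_eq (m := m + 1) (by simp; omega) hdeg h', Polynomial.coeff_C_mul,
    Polynomial.coeff_mul_X_sub_C, Polynomial.coeff_eq_zero_of_natDegree_lt (p := q) (n := m + 1) (by omega)]
  have ht' : (-(1 - ζ ^ 2)) ≠ 0 := neg_ne_zero.2 ht
  rw [pow_succ, pow_succ]
  field_simp
  ring

lemma tendsto_eval_div_pow {q : Polynomial ℂ} {m : ℕ} (hq : q.natDegree ≤ m) {a : ℕ → ℂ}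
    (ha0 : ∀ n, a n ≠ 0) (ha : Tendsto (fun n => (a n)⁻¹) atTop (𝓝 0)) :
    Tendsto (fun n => q.eval (a n) / a n ^ m) atTop (𝓝 (q.coeff m)) := by
  have h (n : ℕ) : q.eval (a n) / a n ^ m = (q.reflect m).eval (a n)⁻¹ := by
    let _ := invertibleOfNonzero (ha0 n)
    have := Polynomial.eval₂_reflect_mul_pow (RingHom.id ℂ) (a n) m q hq
    rw [invOf_eq_inv, Polynomial.eval₂_id, Polynomial.eval₂_id] at this
    rw [← this, mul_div_cancel_right₀ _ (pow_ne_zero _ (ha0 n))]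
  simp only [h]
  have := ((q.reflect m).continuous.tendsto 0).comp ha
  rwa [← Polynomial.coeff_zero_eq_eval_zero, Polynomial.coeff_reflect,
    Polynomial.revAt_le (Nat.zero_le m), Nat.sub_zero] at this

/-- Sequences `(a_n, b_n, c_n)` with prescribed sum and product, `b_n → 0` and `a_n, c_n → ∞`. -/
lemma exists_escaping (S : ℂ) {T : ℂ} (hT : T ≠ 0) : ∃ a b c : ℕ → ℂ,
    (∀ n, a n + b n + c n = S) ∧ (∀ n, a n * b n * c n = T) ∧ Tendsto b atTop (𝓝 0) ∧
      Tendsto (fun n => (a n)⁻¹) atTop (𝓝 0) ∧ Tendsto (fun n => (c n)⁻¹) atTop (𝓝 0) := by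
  have hb0 (n : ℕ) : ((n : ℂ) + 1) ≠ 0 := Nat.cast_add_one_ne_zero n
  choose s hs using fun n : ℕ => IsAlgClosed.exists_pow_nat_eq
    ((S - 1 / ((n : ℂ) + 1)) ^ 2 - 4 * (T * (n + 1))) (n := 2) (by norm_num)
  have key : ∀ a : ℕ → ℂ, (∀ n : ℕ, a n * (S - 1 / ((n : ℂ) + 1) - a n) = T * (n + 1)) →
      Tendsto (fun n => (a n)⁻¹) atTop (𝓝 0) := by
    intro a ha
    refine tendsto_inv₀_cobounded.comp ?_
    rw [← tendsto_norm_atTop_iff_cobounded, tendsto_atTop]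
    intro M
    have h1 : Tendsto (fun n : ℕ => ‖T‖ * ((n : ℝ) + 1)) atTop atTop :=
      (tendsto_atTop_add_const_right _ _ tendsto_natCast_atTop_atTop).const_mul_atTop
        (norm_pos_iff.2 hT)
    filter_upwards [h1.eventually_gt_atTop (M * (‖S‖ + 1 + M))] with n hn
    by_contra! hM
    have e := congrArg norm (ha n)
    rw [norm_mul, norm_mul] at e
    have e1 : ‖(n : ℂ) + 1‖ = (n : ℝ) + 1 := by
      rw [← Nat.cast_add_one, Complex.norm_natCast]
      push_cast
      rfl
    have e2 : ‖S - 1 / ((n : ℂ) + 1) - a n‖ ≤ ‖S‖ + 1 + M := by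
      refine (norm_sub_le _ _).trans (add_le_add ((norm_sub_le _ _).trans ?_) hM.le)
      gcongr
      rw [norm_div, e1, norm_one, div_le_one (by positivity)]
      linarith [(Nat.cast_nonneg n : (0 : ℝ) ≤ n)]
    rw [e1] at e
    have : ‖a n‖ * ‖S - 1 / ((n : ℂ) + 1) - a n‖ ≤ M * (‖S‖ + 1 + M) :=
      mul_le_mul hM.le e2 (norm_nonneg _) ((norm_nonneg _).trans hM.le)
    linarith
  have hq : ∀ n : ℕ, (S - 1 / ((n : ℂ) + 1) + s n) / 2 *
      (S - 1 / ((n : ℂ) + 1) - (S - 1 / ((n : ℂ) + 1) + s n) / 2) = T * (n + 1) := fun n => by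
    linear_combination (-1 / 4) * hs n
  refine ⟨fun n => (S - 1 / ((n : ℂ) + 1) + s n) / 2, fun n => 1 / ((n : ℂ) + 1),
    fun n => S - 1 / ((n : ℂ) + 1) - (S - 1 / ((n : ℂ) + 1) + s n) / 2, fun n => by ring,
    fun n => ?_, tendsto_one_div_add_atTop_nhds_zero_nat, key _ hq, key _ fun n => ?_⟩
  · rw [mul_right_comm, hq]
    field_simp [hb0 n]
  · rw [← hq n]
    ring

lemma prod_map_sub {l : List ℂ} {c : ℂ} (hc : c ≠ 0) :
    (l.map fun x => x - c).prod = c ^ l.length * (l.map fun x => x * c⁻¹ - 1).prod := by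
  induction l with
  | nil => simp
  | cons x l ih =>
    simp only [List.map_cons, List.prod_cons, List.length_cons, ih, pow_succ]
    field_simp

lemma tendsto_prod_map {l : List ℂ} {c : ℕ → ℂ} (hc : Tendsto c atTop (𝓝 0)) :
    Tendsto (fun n => (l.map fun x => x * c n - 1).prod) atTop (𝓝 ((-1) ^ l.length)) := by
  induction l with
  | nil => simp
  | cons x l ih =>
    simp only [List.map_cons, List.prod_cons, List.length_cons, pow_succ']
    refine Tendsto.mul ?_ ih
    simpa using (hc.const_mul x).sub_const 1

theorem Hi_zero_cons {ζ : ℂ} {H : (k : ℕ) → (Fin (2 * k) → ℂ) → ℂ} (hH : IsHFamily ζ H)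
    (ht : 1 - ζ ^ 2 ≠ 0) {m : ℕ} {l : List ℂ} (hl : l.length = 2 * m) :
    Hi H ζ (0 :: l) = HL H l := by
  obtain ⟨a, b, c, hs, hp, hb, ha, hc⟩ := exists_escaping ((3 + ζ ^ 2) / (1 - ζ ^ 2))
    (one_div_ne_zero ht)
  have hne (n : ℕ) : a n ≠ 0 ∧ c n ≠ 0 := by
    have := one_div_ne_zero ht
    rw [← hp n] at this
    exact ⟨left_ne_zero_of_mul (left_ne_zero_of_mul this), right_ne_zero_of_mul this⟩
  choose q hq h using fun s : ℂ => HL_natDegree hH (m := m) (l := s :: l) (by simp [hl])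
  have hm : (0 :: l).length / 2 = m := by simp [hl]; omega
  have hswap (x y : ℂ) : HL H (x :: y :: l) = HL H (y :: x :: l) :=
    HL_perm hH (k := m + 1) (List.Perm.swap y x l) (by simp; omega)
  have lim1 : Tendsto (fun n => HL H (a n :: b n :: l) / a n ^ m) atTop
      (𝓝 (topCoeff m fun y => HL H (y :: 0 :: l))) := by
    have e (n : ℕ) : HL H (a n :: b n :: l) / a n ^ m = ∑ s : Fin (m + 1),
        HL H ((s : ℕ) :: b n :: l) * ((Lagrange.basis Finset.univ
          (fun s : Fin (m + 1) => ((s : ℕ) : ℂ)) s).eval (a n) / a n ^ m) := by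
      rw [h, eq_sum_basis (hq (b n)), Polynomial.eval_finsetSum, Finset.sum_div]
      refine Finset.sum_congr rfl fun s _ => ?_
      rw [Polynomial.eval_mul, Polynomial.eval_C, h, mul_div_assoc]
    simp only [e, topCoeff]
    refine tendsto_finsetSum _ fun s _ => Tendsto.mul ?_ ?_
    · have h' (y : ℂ) : HL H ((s : ℕ) :: y :: l) = (q (s : ℕ)).eval y := by rw [hswap, h]
      simp only [h']
      exact ((q (s : ℕ)).continuous.tendsto 0).comp hb
    · refine tendsto_eval_div_pow ?_ (fun n => (hne n).1) ha
      rw [Lagrange.natDegree_basis (natCast_injective m).injOn (Finset.mem_univ s)]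
      simp
  have lim2 : Tendsto (fun n => HL H (a n :: b n :: l) / a n ^ m) atTop
      (𝓝 ((-(1 - ζ ^ 2)) ^ m * HL H l)) := by
    have e (n : ℕ) : HL H (a n :: b n :: l) / a n ^ m = (1 - ζ ^ 2) ^ m * (c n / a n) ^ m *
        (l.map fun x => x * (c n)⁻¹ - 1).prod * HL H l := by
      rw [HL_rec hH ht (hs n) (hp n) hl, prod_map_sub (hne n).2, hl, two_mul, pow_add, div_pow, div_pow]
      generalize (l.map fun x => x * (c n)⁻¹ - 1).prod = P
      have := (hne n).1
      have := (hne n).2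
      field_simp
    have hca : Tendsto (fun n => c n / a n) atTop (𝓝 (-1)) := by
      have e (n : ℕ) : c n / a n = ((3 + ζ ^ 2) / (1 - ζ ^ 2) - b n) * (a n)⁻¹ - 1 := by
        rw [← hs n]
        have := (hne n).1
        field_simp
        ring
      simp only [e]
      simpa using ((tendsto_const_nhds.sub hb).mul ha).sub_const 1
    simp only [e]
    have := (((hca.pow m).const_mul ((1 - ζ ^ 2) ^ m)).mul
      (tendsto_prod_map (l := l) hc)).mul_const (HL H l)
    rw [hl, pow_mul (-1 : ℂ) 2 m, neg_one_sq, one_pow, mul_one, ← mul_pow, mul_neg_one] at this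
    exact this
  rw [Hi, hm, tendsto_nhds_unique lim1 lim2, mul_div_cancel_left₀ _
    (pow_ne_zero _ (neg_ne_zero.2 ht))]

end

/-- The polynomials that express the contractions of `Ψ_n` leading to `(ψ_n)_{↓⋯↓}`. -/
def candDown (H : (k : ℕ) → (Fin (2 * k) → ℂ) → ℂ) (ζ : ℂ) (l : List ℂ) : ℂ :=
  if l.length % 2 = 0 then ζ ^ (l.length / 2) * (HL H l * HL H (l ++ [J3c ζ, J4c ζ]))
  else ζ ^ (l.length / 2 + 1) * (HL H (l ++ [J3c ζ]) * HL H (l ++ [J4c ζ]))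

/-- The polynomials that express the contractions of `Ψ_n` leading to `(ψ_n)_{↑⋯↑↓}`. -/
def candUp (H : (k : ℕ) → (Fin (2 * k) → ℂ) → ℂ) (ζ : ℂ) (l : List ℂ) : ℂ :=
  if l.length % 2 = 0 then
    1 / 2 * ζ ^ (l.length / 2) * ((1 + ζ) * (Hi H ζ (l ++ [J3c ζ]) * HL H (l ++ [0, J4c ζ])) +
      (1 - ζ) * (Hi H ζ (l ++ [J4c ζ]) * HL H (l ++ [0, J3c ζ])))
  else
    1 / 2 * ζ ^ (l.length / 2) *
      ((1 - ζ ^ 2) * (HL H (l ++ [0]) * Hi H ζ (l ++ [J3c ζ, J4c ζ])) +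
        Hi H ζ l * HL H (l ++ [0, J3c ζ, J4c ζ]))

lemma candDown_even {H : (k : ℕ) → (Fin (2 * k) → ℂ) → ℂ} {ζ : ℂ} {l : List ℂ} {k : ℕ}
    (hl : l.length = 2 * k) :
    candDown H ζ l = ζ ^ k * (HL H l * HL H (l ++ [J3c ζ, J4c ζ])) := by
  rw [candDown, if_pos (by omega), show l.length / 2 = k by omega]

lemma candDown_odd {H : (k : ℕ) → (Fin (2 * k) → ℂ) → ℂ} {ζ : ℂ} {l : List ℂ} {k : ℕ}
    (hl : l.length = 2 * k + 1) :
    candDown H ζ l = ζ ^ (k + 1) * (HL H (l ++ [J3c ζ]) * HL H (l ++ [J4c ζ])) := by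
  rw [candDown, if_neg (by omega), show l.length / 2 = k by omega]

lemma candUp_even {H : (k : ℕ) → (Fin (2 * k) → ℂ) → ℂ} {ζ : ℂ} {l : List ℂ} {k : ℕ}
    (hl : l.length = 2 * k) :
    candUp H ζ l = 1 / 2 * ζ ^ k * ((1 + ζ) * (Hi H ζ (l ++ [J3c ζ]) * HL H (l ++ [0, J4c ζ])) +
      (1 - ζ) * (Hi H ζ (l ++ [J4c ζ]) * HL H (l ++ [0, J3c ζ]))) := by
  rw [candUp, if_pos (by omega), show l.length / 2 = k by omega]

lemma candUp_odd {H : (k : ℕ) → (Fin (2 * k) → ℂ) → ℂ} {ζ : ℂ} {l : List ℂ} {k : ℕ}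
    (hl : l.length = 2 * k + 1) :
    candUp H ζ l = 1 / 2 * ζ ^ k *
      ((1 - ζ ^ 2) * (HL H (l ++ [0]) * Hi H ζ (l ++ [J3c ζ, J4c ζ])) +
        Hi H ζ l * HL H (l ++ [0, J3c ζ, J4c ζ])) := by
  rw [candUp, if_neg (by omega), show l.length / 2 = k by omega]

/-- The properties of a family of symmetric polynomials used to identify it with the contractions
of `Ψ_n`; the sign `ε` distinguishes the two families of interest. -/
structure IsCandidate (ζ ε : ℂ) (F : List ℂ → ℂ) : Prop where
  perm : ∀ {l l' : List ℂ}, l.Perm l' → F l = F l'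
  natDegree : ∀ l, ∃ q : Polynomial ℂ, q.natDegree ≤ l.length + 1 ∧ ∀ y, F (y :: l) = q.eval y
  recurrence : ∀ {a b c : ℂ} (l : List ℂ), a + b + c = (3 + ζ ^ 2) / (1 - ζ ^ 2) →
    a * b * c = 1 / (1 - ζ ^ 2) → F (a :: b :: l) = ζ * ((1 - ζ ^ 2) / c) ^ (l.length + 1) *
      ((J3c ζ - c) * (J4c ζ - c)) * (l.map fun x => x - c).prod ^ 2 * F l
  nil : F [] = 1
  J3 : F [J3c ζ] = ζ
  J4 : F [J4c ζ] = ε * ζ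
  J4_cons : ∀ w, F [J4c ζ, w] = ε * ζ * (1 + ζ) * (w - (1 - ζ) / (1 + ζ)) * F [w]

lemma ne_zero_of_mul_eq {ζ a b c : ℂ} (ht : 1 - ζ ^ 2 ≠ 0) (hp : a * b * c = 1 / (1 - ζ ^ 2)) :
    c ≠ 0 := by
  rintro rfl
  rw [mul_zero, eq_comm, one_div, inv_eq_zero] at hp
  exact ht hp

lemma isCandidate_candDown {ζ : ℂ} {H : (k : ℕ) → (Fin (2 * k) → ℂ) → ℂ} (hH : IsHFamily ζ H)
    (h3 : 1 + ζ ≠ 0) (h4 : 1 - ζ ≠ 0) : IsCandidate ζ 1 (candDown H ζ) := by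
  have ht : 1 - ζ ^ 2 ≠ 0 := by
    rw [show 1 - ζ ^ 2 = (1 + ζ) * (1 - ζ) by ring]
    exact mul_ne_zero h3 h4
  refine ⟨fun {l l'} hp => ?_, fun l => ?_, fun {a b c} l hs hp => ?_, ?_, ?_, ?_, fun w => ?_⟩
  · obtain ⟨k, hk | hk⟩ := Nat.even_or_odd' l.length
    · rw [candDown_even hk, candDown_even (hp.length_eq ▸ hk), HL_perm hH hp hk,
        HL_perm hH (k := k + 1) (hp.append_right _) (by simp; omega)]
    · rw [candDown_odd hk, candDown_odd (hp.length_eq ▸ hk),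
        HL_perm hH (k := k + 1) (hp.append_right _) (by simp; omega),
        HL_perm hH (k := k + 1) (hp.append_right [J4c ζ]) (by simp; omega)]
  · obtain ⟨k, hk | hk⟩ := Nat.even_or_odd' l.length
    · obtain ⟨q, hq, e⟩ := HL_natDegree hH (m := k) (l := l ++ [J3c ζ]) (by simp; omega)
      obtain ⟨q', hq', e'⟩ := HL_natDegree hH (m := k) (l := l ++ [J4c ζ]) (by simp; omega)
      refine ⟨Polynomial.C (ζ ^ (k + 1)) * (q * q'), (Polynomial.natDegree_C_mul_le _ _).trans
        (Polynomial.natDegree_mul_le.trans (by omega)), fun y => ?_⟩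
      rw [candDown_odd (k := k) (by simp; omega), List.cons_append, List.cons_append, e, e']
      simp
    · obtain ⟨q, hq, e⟩ := HL_natDegree hH (m := k) (l := l) hk
      obtain ⟨q', hq', e'⟩ := HL_natDegree hH (m := k + 1) (l := l ++ [J3c ζ, J4c ζ])
        (by simp; omega)
      refine ⟨Polynomial.C (ζ ^ (k + 1)) * (q * q'), (Polynomial.natDegree_C_mul_le _ _).trans
        (Polynomial.natDegree_mul_le.trans (by omega)), fun y => ?_⟩
      rw [candDown_even (k := k + 1) (by simp; omega), List.cons_append, e, e']
      simp
  · obtain ⟨k, hk | hk⟩ := Nat.even_or_odd' l.length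
    · rw [candDown_even (k := k + 1) (by simp; omega), candDown_even hk, List.cons_append,
        List.cons_append, HL_rec hH ht hs hp hk,
        HL_rec hH ht hs hp (m := k + 1) (by simp; omega), List.map_append, List.prod_append, hk]
      simp only [List.map_cons, List.map_nil, List.prod_cons, List.prod_nil]
      ring
    · rw [candDown_odd (k := k + 1) (by simp; omega), candDown_odd hk, List.cons_append,
        List.cons_append, List.cons_append, List.cons_append,
        HL_rec hH ht hs hp (m := k + 1) (by simp; omega),
        HL_rec hH ht hs hp (m := k + 1) (by simp; omega), List.map_append, List.prod_append,
        List.map_append, List.prod_append, hk]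
      simp only [List.map_cons, List.map_nil, List.prod_cons, List.prod_nil]
      ring
  · rw [candDown_even (k := 0) rfl, HL_nil hH, List.nil_append, HL_pair hH]
    simp
  · rw [candDown_odd (k := 0) rfl, List.singleton_append, List.singleton_append, HL_pair hH,
      HL_pair hH]
    simp
  · rw [candDown_odd (k := 0) rfl, List.singleton_append, List.singleton_append, HL_pair hH,
      HL_pair hH]
    simp
  · rw [candDown_odd (l := [w]) (k := 0) rfl, candDown_even (k := 1) rfl, List.singleton_append,
      List.singleton_append, HL_pair hH, HL_pair hH, HL_pair hH, List.cons_append,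
      List.singleton_append, HL_four hH, J3c, J4c, show 1 - ζ ^ 2 = (1 + ζ) * (1 - ζ) by ring]
    field_simp
    ring

lemma isCandidate_candUp {ζ : ℂ} {H : (k : ℕ) → (Fin (2 * k) → ℂ) → ℂ} (hH : IsHFamily ζ H)
    (h3 : 1 + ζ ≠ 0) (h4 : 1 - ζ ≠ 0) : IsCandidate ζ (-1) (candUp H ζ) := by
  have ht : 1 - ζ ^ 2 ≠ 0 := by
    rw [show 1 - ζ ^ 2 = (1 + ζ) * (1 - ζ) by ring]
    exact mul_ne_zero h3 h4
  have one (w : ℂ) : candUp H ζ [w] = 1 - (1 - ζ ^ 2) * w := by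
    rw [candUp_odd (k := 0) rfl, List.singleton_append, List.singleton_append,
      List.singleton_append, HL_pair hH, Hi_single hH, Hi_triple hH ht, HL_four hH, J3c, J4c,
      show 1 - ζ ^ 2 = (1 + ζ) * (1 - ζ) by ring]
    field_simp
    ring
  refine ⟨fun {l l'} hp => ?_, fun l => ?_, fun {a b c} l hs hp => ?_, ?_, ?_, ?_, fun w => ?_⟩
  · obtain ⟨k, hk | hk⟩ := Nat.even_or_odd' l.length
    · rw [candUp_even hk, candUp_even (hp.length_eq ▸ hk),
        Hi_perm hH (m := k) (hp.append_right _) (by simp; omega),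
        Hi_perm hH (m := k) (hp.append_right [J4c ζ]) (by simp; omega),
        HL_perm hH (k := k + 1) (hp.append_right _) (by simp; omega),
        HL_perm hH (k := k + 1) (hp.append_right [0, J3c ζ]) (by simp; omega)]
    · rw [candUp_odd hk, candUp_odd (hp.length_eq ▸ hk), Hi_perm hH hp hk,
        HL_perm hH (k := k + 1) (hp.append_right _) (by simp; omega),
        Hi_perm hH (m := k + 1) (hp.append_right [J3c ζ, J4c ζ]) (by simp; omega),
        HL_perm hH (k := k + 2) (hp.append_right [0, J3c ζ, J4c ζ]) (by simp; omega)]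
  · obtain ⟨k, hk | hk⟩ := Nat.even_or_odd' l.length
    · obtain ⟨q, hq, e⟩ := HL_natDegree hH (m := k) (l := l ++ [0]) (by simp; omega)
      obtain ⟨q', hq', e'⟩ := Hi_natDegree hH (m := k + 1) (l := l ++ [J3c ζ, J4c ζ])
        (by simp; omega)
      obtain ⟨r, hr, f⟩ := Hi_natDegree hH (m := k) (l := l) hk
      obtain ⟨r', hr', f'⟩ := HL_natDegree hH (m := k + 1) (l := l ++ [0, J3c ζ, J4c ζ])
        (by simp; omega)
      refine ⟨Polynomial.C (1 / 2 * ζ ^ k) * (Polynomial.C (1 - ζ ^ 2) * (q * q') + r * r'),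
        (Polynomial.natDegree_C_mul_le _ _).trans
        (Polynomial.natDegree_add_le_of_degree_le ((Polynomial.natDegree_C_mul_le _ _).trans
        (Polynomial.natDegree_mul_le.trans (by omega))) (Polynomial.natDegree_mul_le.trans
          (by omega))), fun y => ?_⟩
      rw [candUp_odd (k := k) (by simp; omega), List.cons_append, List.cons_append,
        List.cons_append, e, e', f, f']
      simp
    · obtain ⟨q, hq, e⟩ := Hi_natDegree hH (m := k + 1) (l := l ++ [J3c ζ]) (by simp; omega)
      obtain ⟨q', hq', e'⟩ := HL_natDegree hH (m := k + 1) (l := l ++ [0, J4c ζ]) (by simp; omega)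
      obtain ⟨r, hr, f⟩ := Hi_natDegree hH (m := k + 1) (l := l ++ [J4c ζ]) (by simp; omega)
      obtain ⟨r', hr', f'⟩ := HL_natDegree hH (m := k + 1) (l := l ++ [0, J3c ζ]) (by simp; omega)
      refine ⟨Polynomial.C (1 / 2 * ζ ^ (k + 1)) * (Polynomial.C (1 + ζ) * (q * q') +
        Polynomial.C (1 - ζ) * (r * r')), (Polynomial.natDegree_C_mul_le _ _).trans
        (Polynomial.natDegree_add_le_of_degree_le ((Polynomial.natDegree_C_mul_le _ _).trans
        (Polynomial.natDegree_mul_le.trans (by omega))) ((Polynomial.natDegree_C_mul_le _ _).trans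
        (Polynomial.natDegree_mul_le.trans (by omega)))), fun y => ?_⟩
      rw [candUp_even (k := k + 1) (by simp; omega), List.cons_append, List.cons_append,
        List.cons_append, List.cons_append, e, e', f, f']
      simp
  · have fin (L R : ℂ) (h : L = R * (c * (1 / c))) : L = R := by
      rw [h, mul_one_div_cancel (ne_zero_of_mul_eq ht hp), mul_one]
    obtain ⟨k, hk | hk⟩ := Nat.even_or_odd' l.length
    · rw [candUp_even (k := k + 1) (by simp; omega), candUp_even hk]
      simp only [List.cons_append]
      rw [Hi_rec hH ht hs hp (m := k) (by simp; omega), Hi_rec hH ht hs hp (m := k) (by simp; omega),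
        HL_rec hH ht hs hp (m := k + 1) (by simp; omega),
        HL_rec hH ht hs hp (m := k + 1) (by simp; omega), hk]
      simp only [List.map_append, List.prod_append, List.map_cons, List.map_nil, List.prod_cons,
        List.prod_nil, zero_sub]
      apply fin
      ring
    · rw [candUp_odd (k := k + 1) (by simp; omega), candUp_odd hk]
      simp only [List.cons_append]
      rw [Hi_rec hH ht hs hp (m := k) hk, Hi_rec hH ht hs hp (m := k + 1) (by simp; omega),
        HL_rec hH ht hs hp (m := k + 1) (by simp; omega),
        HL_rec hH ht hs hp (m := k + 2) (by simp; omega), hk]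
      simp only [List.map_append, List.prod_append, List.map_cons, List.map_nil, List.prod_cons,
        List.prod_nil, zero_sub]
      apply fin
      ring
  · rw [candUp_even (k := 0) rfl]
    simp only [List.nil_append, Hi_single hH, HL_pair hH]
    ring
  · rw [one, J3c]
    field_simp
    ring
  · rw [one, J4c]
    field_simp
    ring
  · rw [one, candUp_even (k := 1) rfl]
    simp only [List.cons_append, List.nil_append]
    rw [Hi_triple hH ht, Hi_triple hH ht, HL_four hH, HL_four hH, J3c, J4c,
      show 1 - ζ ^ 2 = (1 + ζ) * (1 - ζ) by ring]
    field_simp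
    ring

/-- `Ψ_n` as a function of lists of length `2n+1`. -/
def PsiL (Ψ : PsiFam) (us : List ℂ) (αs : List (Fin 2)) : ℂ :=
  if us.length % 2 = 1 then
    Ψ (us.length / 2) (fun j => us.getD j 0) (fun j => αs.getD j 0)
  else 0

lemma PsiL_eq (Ψ : PsiFam) {us : List ℂ} {n : ℕ} (h : us.length = 2 * n + 1)
    (αs : List (Fin 2)) :
    PsiL Ψ us αs = Ψ n (fun j => us.getD j 0) (fun j => αs.getD j 0) := by
  obtain rfl : n = us.length / 2 := by omega
  rw [PsiL, if_pos (by omega)]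

lemma PsiL_eq_zero (Ψ : PsiFam) {us : List ℂ} (h : us.length % 2 = 0) (αs : List (Fin 2)) :
    PsiL Ψ us αs = 0 := by
  rw [PsiL, if_neg (by omega)]

lemma getD_middle {α : Type*} (pre post : List α) (a d : α) :
    (pre ++ a :: post).getD pre.length d = a := by
  simp

lemma update_getD {α : Type*} {n : ℕ} (pre post : List α) (a b d : α) (i : Fin n)
    (hi : (i : ℕ) = pre.length) :
    Function.update (fun j : Fin n => (pre ++ a :: post).getD j d) i b =
      fun j : Fin n => (pre ++ b :: post).getD j d := by
  funext j
  by_cases h : j = i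
  · rw [h, Function.update_self, hi, getD_middle]
  · rw [Function.update_of_ne h]
    have h' : (j : ℕ) ≠ pre.length := fun e => h (Fin.ext (e.trans hi.symm))
    rcases lt_or_gt_of_ne h' with h' | h'
    · rw [List.getD_append _ _ _ _ h', List.getD_append _ _ _ _ h']
    · obtain ⟨k, hk⟩ : ∃ k, (j : ℕ) = pre.length + (k + 1) := ⟨j - pre.length - 1, by omega⟩
      rw [hk, List.getD_append_right _ _ _ _ (by omega), List.getD_append_right _ _ _ _ (by omega),
        Nat.add_sub_cancel_left]
      rfl

/-- The exchange relations for functions of lists. -/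
def Exch (τ : ℂ) (Φ : List ℂ → List (Fin 2) → ℂ) : Prop :=
  ∀ (pre post : List ℂ) (αp αq : List (Fin 2)) (u v : ℂ) (s t : Fin 2), pre.length = αp.length →
    ∑ s' : Fin 2, ∑ t' : Fin 2, Rcheckent τ (v - u) (s, t) (s', t') *
      Φ (pre ++ u :: v :: post) (αp ++ s' :: t' :: αq) =
    rv τ (v - u) * Φ (pre ++ v :: u :: post) (αp ++ s :: t :: αq)

lemma exch_PsiL {τ : ℂ} {Ψ : PsiFam} (h1 : PsiP1 τ Ψ) : Exch τ (PsiL Ψ) := by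
  intro pre post αp αq u v s t hlen
  obtain ⟨n, hn | hn⟩ := Nat.even_or_odd' (pre ++ u :: v :: post).length
  · have hn' : (pre ++ v :: u :: post).length = 2 * n := by simpa using hn
    simp only [PsiL_eq_zero Ψ (show (pre ++ u :: v :: post).length % 2 = 0 by omega),
      PsiL_eq_zero Ψ (show (pre ++ v :: u :: post).length % 2 = 0 by omega)]
    simp
  · have hn' : (pre ++ v :: u :: post).length = 2 * n + 1 := by simpa using hn
    have hl : pre.length + 1 < 2 * n + 1 := by simp at hn; omega
    simp only [PsiL_eq Ψ hn, PsiL_eq Ψ hn']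
    have key := congrFun (h1 n (fun j => (pre ++ u :: v :: post).getD j 0) ⟨pre.length, by omega⟩
      ⟨pre.length + 1, hl⟩ rfl) fun j => (αp ++ s :: t :: αq).getD j 0
    have e1 : (pre ++ u :: v :: post).getD (pre.length + 1) 0 = v := by
      rw [show pre ++ u :: v :: post = (pre ++ [u]) ++ v :: post by simp]
      simp
    have e0 : (αp ++ s :: t :: αq).getD pre.length 0 = s := by rw [hlen, getD_middle]
    have e2 : (αp ++ s :: t :: αq).getD (pre.length + 1) 0 = t := by
      rw [show αp ++ s :: t :: αq = (αp ++ [s]) ++ t :: αq by simp]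
      simp [hlen]
    have e3 (s' t' : Fin 2) : Function.update (Function.update
        (fun j : Fin (2 * n + 1) => (αp ++ s :: t :: αq).getD j 0) ⟨pre.length, by omega⟩ s')
        ⟨pre.length + 1, hl⟩ t' = fun j : Fin (2 * n + 1) => (αp ++ s' :: t' :: αq).getD j 0 := by
      rw [update_getD _ _ _ _ _ _ (by simpa using hlen)]
      have := update_getD (n := 2 * n + 1) (αp ++ [s']) αq t t' 0 ⟨pre.length + 1, hl⟩
        (by simp [hlen])
      simpa using this
    rw [applyRc] at key
    simp only [e0, e1, e2, e3, getD_middle] at key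
    rw [key]
    congr 2
    funext j
    rw [swap_val]
    exact (getD_swap pre post u v 0 j).symm

/-- Boundary weights: `D` for the spin `e` and `A` for the opposite spin. -/
def Kw (τ : ℂ) (e s : Fin 2) (x : ℂ) : ℂ := if s = e then Dw τ x else Aw τ x

/-- Contraction of the first two sites. -/
def contr (τ : ℂ) (e : Fin 2) (x : ℂ) (Φ : List ℂ → List (Fin 2) → ℂ) (us : List ℂ)
    (αs : List (Fin 2)) : ℂ :=
  Kw τ e 0 x * Φ (x :: -x :: us) (0 :: 0 :: αs) + Kw τ e 1 x * Φ (x :: -x :: us) (1 :: 1 :: αs)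

lemma Exch.contr {τ : ℂ} {Φ : List ℂ → List (Fin 2) → ℂ} (h : Exch τ Φ) (e : Fin 2) (x : ℂ) :
    Exch τ (contr τ e x Φ) := by
  intro pre post αp αq u v s t hlen
  have a0 := h (x :: -x :: pre) post (0 :: 0 :: αp) αq u v s t (by simp [hlen])
  have a1 := h (x :: -x :: pre) post (1 :: 1 :: αp) αq u v s t (by simp [hlen])
  simp only [Fin.sum_univ_two, List.cons_append, EightVertex.contr] at a0 a1 ⊢
  linear_combination Kw τ e 0 x * a0 + Kw τ e 1 x * a1

lemma Exch.same {τ : ℂ} {Φ : List ℂ → List (Fin 2) → ℂ} (h : Exch τ Φ) (pre post : List ℂ)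
    (αp αq : List (Fin 2)) (u v : ℂ) (s : Fin 2) (hl : pre.length = αp.length) :
    rv τ (v - u) * Φ (pre ++ v :: u :: post) (αp ++ s :: s :: αq) =
      av τ (v - u) * Φ (pre ++ u :: v :: post) (αp ++ s :: s :: αq) +
      dv τ (v - u) * Φ (pre ++ u :: v :: post) (αp ++ (1 - s) :: (1 - s) :: αq) := by
  rw [← h pre post αp αq u v s s hl]
  fin_cases s <;> simp [Fin.sum_univ_two, Rcheckent, Rent] <;> ring

lemma Exch.diff {τ : ℂ} {Φ : List ℂ → List (Fin 2) → ℂ} (h : Exch τ Φ) (pre post : List ℂ)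
    (αp αq : List (Fin 2)) (u v : ℂ) (s : Fin 2) (hl : pre.length = αp.length) :
    rv τ (v - u) * Φ (pre ++ v :: u :: post) (αp ++ s :: (1 - s) :: αq) =
      cv τ (v - u) * Φ (pre ++ u :: v :: post) (αp ++ s :: (1 - s) :: αq) +
      bv τ (v - u) * Φ (pre ++ u :: v :: post) (αp ++ (1 - s) :: s :: αq) := by
  rw [← h pre post αp αq u v s (1 - s) hl]
  fin_cases s <;> simp [Fin.sum_univ_two, Rcheckent, Rent] <;> ring

lemma contr_neg {τ : ℂ} (hτ : 0 < τ.im) {Φ : List ℂ → List (Fin 2) → ℂ} (h : Exch τ Φ)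
    (e : Fin 2) (x : ℂ) (us : List ℂ) (αs : List (Fin 2)) :
    rv τ (-2 * x) * contr τ e (-x) Φ us αs =
      th1 (2 * ηc - 2 * x) (2 * τ) * th4 0 (2 * τ) * th4 (2 * x + 2 * ηc) (2 * τ) *
        contr τ e x Φ us αs := by
  have a0 := h.same [] us [] αs x (-x) 0 rfl
  have a1 := h.same [] us [] αs x (-x) 1 rfl
  obtain ⟨wA, wD⟩ := weights_reflect hτ x
  have ea : av τ (-2 * x) = th4 (2 * ηc) (2 * τ) * th1 (2 * ηc - 2 * x) (2 * τ) *
      th4 (2 * x) (2 * τ) := by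
    rw [av, show -2 * x = -(2 * x) by ring, th4_neg, show -(2 * x) + 2 * ηc = 2 * ηc - 2 * x by ring]
  have ed : dv τ (-2 * x) = -(th1 (2 * ηc) (2 * τ) * th1 (2 * ηc - 2 * x) (2 * τ) *
      th1 (2 * x) (2 * τ)) := by
    rw [dv, show -2 * x = -(2 * x) by ring, th1_neg, show -(2 * x) + 2 * ηc = 2 * ηc - 2 * x by ring]
    ring
  rw [show -x - x = -2 * x by ring, ea, ed] at a0 a1
  simp only [List.nil_append, sub_self, sub_zero] at a0 a1
  rw [contr, contr, neg_neg]
  generalize th1 (2 * ηc - 2 * x) (2 * τ) = T at *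
  have hK (s : Fin 2) : th4 (2 * ηc) (2 * τ) * th4 (2 * x) (2 * τ) * Kw τ e s (-x) -
      th1 (2 * ηc) (2 * τ) * th1 (2 * x) (2 * τ) * Kw τ e (1 - s) (-x) =
      th4 0 (2 * τ) * th4 (2 * x + 2 * ηc) (2 * τ) * Kw τ e s x := by
    fin_cases e <;> fin_cases s <;> simp only [Kw] <;> simpa using by assumption
  have k0 := hK 0
  have k1 := hK 1
  simp only [sub_self, sub_zero] at k0 k1
  linear_combination Kw τ e 0 (-x) * a0 + Kw τ e 1 (-x) * a1 +
    T * Φ (x :: -x :: us) (0 :: 0 :: αs) * k0 + T * Φ (x :: -x :: us) (1 :: 1 :: αs) * k1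

lemma contr_comm {τ : ℂ} (hτ : 0 < τ.im) {Φ : List ℂ → List (Fin 2) → ℂ} (h : Exch τ Φ)
    (e : Fin 2) {x y : ℂ} (h0 : rv τ (-x - y) ≠ 0) (h1 : rv τ (x - y) ≠ 0) (us : List ℂ)
    (αs : List (Fin 2)) :
    contr τ e y (contr τ e x Φ) us αs = contr τ e x (contr τ e y Φ) us αs := by
  have E : th4 (x - y) (2 * τ) * th4 (-x - y + 2 * ηc) (2 * τ) *
        (Kw τ e 0 x * Kw τ e 1 y - Kw τ e 0 y * Kw τ e 1 x) =
      th1 (x - y) (2 * τ) * th1 (-x - y + 2 * ηc) (2 * τ) *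
        (Kw τ e 0 x * Kw τ e 0 y - Kw τ e 1 x * Kw τ e 1 y) := by
    have w := weights_exchange hτ y x
    rw [show 2 * ηc - y - x = -x - y + 2 * ηc by ring] at w
    fin_cases e
    · simp [Kw]
      linear_combination -w
    · simp [Kw]
      linear_combination w
  have p0 (s : Fin 2) := h.same [x] (-y :: us) [s] (s :: αs) y (-x) s rfl
  have p1 (s : Fin 2) := h.diff [x] (-y :: us) [s] ((1 - s) :: αs) y (-x) s rfl
  have q0 (s : Fin 2) := h.same [y] (-x :: us) [s] (s :: αs) x (-y) s rfl
  have q1 (s : Fin 2) := h.diff [y] (-x :: us) [s] ((1 - s) :: αs) x (-y) s rfl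
  have u0 (s t : Fin 2) := h.same [] (-x :: -y :: us) [] (t :: t :: αs) y x s rfl
  have u1 (s t : Fin 2) := h.diff [] (-x :: -y :: us) [] (t :: (1 - t) :: αs) y x s rfl
  have v0 (s t : Fin 2) := h.same [y, x] us [t, t] αs (-x) (-y) s rfl
  have v1 (s t : Fin 2) := h.diff [y, x] us [t, 1 - t] αs (-x) (-y) s rfl
  simp only [List.nil_append, List.cons_append] at p0 p1 q0 q1 u0 u1 v0 v1
  rw [show -y - x = -x - y by ring] at q0 q1
  rw [show -y - -x = x - y by ring] at v0 v1
  have i1 : cv τ (-x - y) * av τ (x - y) *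
        (Kw τ e 0 x * Kw τ e 1 y - Kw τ e 0 y * Kw τ e 1 x) =
      av τ (-x - y) * dv τ (x - y) *
        (Kw τ e 0 x * Kw τ e 0 y - Kw τ e 1 x * Kw τ e 1 y) := by
    simp only [cv, av, dv]
    linear_combination th1 (2 * ηc) (2 * τ) * th4 (-x - y) (2 * τ) * th4 (2 * ηc) (2 * τ) *
      th1 (x - y + 2 * ηc) (2 * τ) * E
  have i2 : bv τ (-x - y) * cv τ (x - y) *
        (Kw τ e 0 x * Kw τ e 1 y - Kw τ e 0 y * Kw τ e 1 x) =
      dv τ (-x - y) * bv τ (x - y) *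
        (Kw τ e 0 x * Kw τ e 0 y - Kw τ e 1 x * Kw τ e 1 y) := by
    simp only [cv, bv, dv]
    linear_combination th1 (2 * ηc) (2 * τ) * th1 (-x - y) (2 * τ) * th4 (2 * ηc) (2 * τ) *
      th4 (x - y + 2 * ηc) (2 * τ) * E
  refine mul_left_cancel₀ (mul_ne_zero h0 h1) ?_
  simp only [contr]
  have p00 := p0 0
  have p01 := p0 1
  have p10 := p1 0
  have p11 := p1 1
  have q00 := q0 0
  have q01 := q0 1
  have q10 := q1 0
  have q11 := q1 1
  have u000 := u0 0 0
  have u001 := u0 0 1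
  have u010 := u0 1 0
  have u011 := u0 1 1
  have u100 := u1 0 0
  have u101 := u1 0 1
  have u110 := u1 1 0
  have u111 := u1 1 1
  have v000 := v0 0 0
  have v001 := v0 0 1
  have v010 := v0 1 0
  have v011 := v0 1 1
  have v100 := v1 0 0
  have v101 := v1 0 1
  have v110 := v1 1 0
  have v111 := v1 1 1
  clear p0 p1 q0 q1 u0 u1 v0 v1
  simp only [sub_self, sub_zero] at *
  generalize rv τ (-x - y) = R0 at *
  generalize rv τ (x - y) = R1 at *
  linear_combination R1 * (Kw τ e 0 y * Kw τ e 0 x * (p00 - q00) +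
      Kw τ e 1 y * Kw τ e 1 x * (p01 - q01) +
      Kw τ e 1 y * Kw τ e 0 x * (p10 - q11) + Kw τ e 0 y * Kw τ e 1 x * (p11 - q10)) +
    Kw τ e 0 y * Kw τ e 0 x * (av τ (-x - y) * (u000 - v000) + dv τ (-x - y) * (u101 - v110)) +
    Kw τ e 1 y * Kw τ e 1 x * (av τ (-x - y) * (u011 - v011) + dv τ (-x - y) * (u110 - v101)) +
    Kw τ e 1 y * Kw τ e 0 x * (cv τ (-x - y) * (u001 - v001) + bv τ (-x - y) * (u100 - v111)) +
    Kw τ e 0 y * Kw τ e 1 x * (cv τ (-x - y) * (u010 - v010) + bv τ (-x - y) * (u111 - v100)) +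
    (Φ (y :: x :: -x :: -y :: us) (0 :: 0 :: 1 :: 1 :: αs) -
      Φ (y :: x :: -x :: -y :: us) (1 :: 1 :: 0 :: 0 :: αs)) * i1 +
    (Φ (y :: x :: -x :: -y :: us) (0 :: 1 :: 0 :: 1 :: αs) -
      Φ (y :: x :: -x :: -y :: us) (1 :: 0 :: 1 :: 0 :: αs)) * i2

lemma prod_getD_one {L : List ℂ} {m : ℕ} (h : L.length = m) :
    ∏ j : Fin m, L.getD j 1 = L.prod := by
  subst h
  rw [← List.prod_ofFn]
  congr 1
  apply List.ext_getElem <;> simp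

lemma sum_getD {L : List ℂ} {m : ℕ} (h : L.length = m) : ∑ j : Fin m, L.getD j 0 = L.sum := by
  subst h
  rw [← List.sum_ofFn]
  congr 1
  apply List.ext_getElem <;> simp

lemma getD_map_one {α : Type*} (l : List α) (f : α → ℂ) (d : α) {j : ℕ} (hj : j < l.length) :
    f (l.getD j d) = (l.map f).getD j 1 := by
  rw [List.getD_eq_getElem _ _ hj, List.getD_eq_getElem _ _ (by simpa using hj), List.getElem_map]

lemma prod_erase_getD {α : Type*} (pre post : List α) (a d : α) (f : α → ℂ) {m : ℕ} (i : Fin m)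
    (hi : (i : ℕ) = pre.length) (hm : (pre ++ a :: post).length = m) :
    ∏ j ∈ Finset.univ.erase i, f ((pre ++ a :: post).getD j d) = ((pre ++ post).map f).prod := by
  have e : ∏ j : Fin m, Function.update (fun j : Fin m => f ((pre ++ a :: post).getD j d)) i 1 j =
      ((pre ++ post).map f).prod := by
    have : (fun j : Fin m => f ((pre ++ a :: post).getD j d)) =
        fun j : Fin m => (pre.map f ++ f a :: post.map f).getD j 1 := by
      funext j
      rw [getD_map_one _ f d (j.2.trans_eq hm.symm)]
      simp
    rw [this, update_getD _ _ _ _ _ _ (by simpa using hi), prod_getD_one (by simpa using hm)]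
    simp
  rw [← e, Finset.prod_update_of_mem (Finset.mem_univ i), one_mul, Finset.sdiff_singleton_eq_erase]

lemma prod_erase_erase_getD {α : Type*} (pre post : List α) (a b d : α) (f : α → ℂ) {m : ℕ}
    (i j : Fin m) (hi : (i : ℕ) = pre.length) (hj : (j : ℕ) = pre.length + 1)
    (hm : (pre ++ a :: b :: post).length = m) :
    ∏ k ∈ (Finset.univ.erase i).erase j, f ((pre ++ a :: b :: post).getD k d) =
      ((pre ++ post).map f).prod := by
  have hij : j ≠ i := fun h => by subst h; omega
  have e : ∏ k : Fin m, Function.update (Function.update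
      (fun j : Fin m => f ((pre ++ a :: b :: post).getD j d)) i 1) j 1 k =
      ((pre ++ post).map f).prod := by
    have : (fun j : Fin m => f ((pre ++ a :: b :: post).getD j d)) =
        fun j : Fin m => (pre.map f ++ f a :: f b :: post.map f).getD j 1 := by
      funext j
      rw [getD_map_one _ f d (j.2.trans_eq hm.symm)]
      simp
    rw [this, update_getD _ _ _ _ _ _ (by simpa using hi)]
    have := update_getD (n := m) (pre.map f ++ [1]) (post.map f) (f b) 1 1 j (by simpa using hj)
    rw [List.append_assoc, List.append_assoc, List.singleton_append, List.singleton_append] at this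
    rw [this, prod_getD_one (by simpa using hm)]
    simp
  rw [← e, Finset.prod_update_of_mem (Finset.mem_univ j), one_mul,
    Finset.sdiff_singleton_eq_erase, Finset.erase_right_comm,
    Finset.prod_update_of_mem (by simpa using hij.symm), one_mul, Finset.sdiff_singleton_eq_erase]

lemma delTwo_getD {α : Type*} {n : ℕ} (pre post : List α) (a b d : α) :
    delTwo (n := n) pre.length (fun j => (pre ++ a :: b :: post).getD j d) =
      fun j : Fin (2 * n + 1) => (pre ++ post).getD j d := by
  funext j
  rw [delTwo]
  split_ifs with h
  · rw [List.getD_append _ _ _ _ h, List.getD_append _ _ _ _ h]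
  · rw [List.getD_append_right _ _ _ _ (by simp; omega), List.getD_append_right _ _ _ _ (by omega)]
    simp only
    rw [show (j : ℕ) + 2 - pre.length = (j - pre.length) + 1 + 1 by omega, List.getD_cons_succ,
      List.getD_cons_succ]

lemma PsiL_reduce {τ : ℂ} {Ψ : PsiFam} (h5 : PsiP5 τ Ψ) (pre post : List ℂ)
    (αp αq : List (Fin 2)) (u : ℂ) (s t : Fin 2) (hlen : pre.length = αp.length) :
    PsiL Ψ (pre ++ u :: (u + 2 * ηc) :: post) (αp ++ s :: t :: αq) =
      ((pre ++ post).map fun v => th1 (u - v - 2 * ηc) τ).prod * singletC s t *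
        PsiL Ψ (pre ++ post) (αp ++ αq) := by
  obtain ⟨n, hn | hn⟩ := Nat.even_or_odd' (pre ++ post).length
  · rw [PsiL_eq_zero Ψ (us := pre ++ post) (by omega), PsiL_eq_zero Ψ (by simp at hn ⊢; omega),
      mul_zero]
  · have hn' : (pre ++ u :: (u + 2 * ηc) :: post).length = 2 * (n + 1) + 1 := by
      simp at hn ⊢; omega
    have hl : pre.length + 1 < 2 * (n + 1) + 1 := by simp at hn; omega
    rw [PsiL_eq Ψ hn, PsiL_eq Ψ hn']
    have e1 : (pre ++ u :: (u + 2 * ηc) :: post).getD (pre.length + 1) 0 = u + 2 * ηc := by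
      rw [show pre ++ u :: (u + 2 * ηc) :: post = (pre ++ [u]) ++ (u + 2 * ηc) :: post by simp]
      simp
    have e0 : (αp ++ s :: t :: αq).getD pre.length 0 = s := by rw [hlen, getD_middle]
    have e2 : (αp ++ s :: t :: αq).getD (pre.length + 1) 0 = t := by
      rw [show αp ++ s :: t :: αq = (αp ++ [s]) ++ t :: αq by simp]
      simp [hlen]
    rw [h5 n _ pre.length hl (by simp only [e1, getD_middle])]
    simp only [getD_middle, e0, e2]
    rw [delTwo_getD, prod_erase_erase_getD pre post u (u + 2 * ηc) 0
      (fun v => th1 (u - v - 2 * ηc) τ) _ _ rfl rfl hn']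
    congr 2
    rw [hlen, delTwo_getD]

/-- The sign of a spin. -/
def sgnS (s : Fin 2) : ℂ := if s = 0 then 1 else -1

lemma PsiL_flip {τ : ℂ} {Ψ : PsiFam} (h2 : PsiP2 τ Ψ) (pre post : List ℂ)
    (αp αq : List (Fin 2)) (u : ℂ) (s : Fin 2) (hlen : pre.length = αp.length) {n : ℕ}
    (hn : pre.length + post.length = 2 * n) :
    PsiL Ψ (pre ++ u :: post) (αp ++ (1 - s) :: αq) =
      (-pnome τ) ^ n * exp (-I * (pre.sum + post.sum - 2 * n * u)) *
        PsiL Ψ (pre ++ (u + Real.pi * τ) :: post) (αp ++ s :: αq) := by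
  have hm : (pre ++ u :: post).length = 2 * n + 1 := by simp; omega
  rw [PsiL_eq Ψ hm, PsiL_eq Ψ (n := n) (by simp; omega)]
  have key := h2 n (fun j => (pre ++ u :: post).getD j 0) ⟨pre.length, by omega⟩
    fun j => (αp ++ s :: αq).getD j 0
  have e0 : (αp ++ s :: αq).getD pre.length 0 = s := by rw [hlen, getD_middle]
  rw [update_getD pre post _ _ _ _ rfl, update_getD αp αq _ _ _ _ (by simpa using hlen)] at key
  simp only [getD_middle, e0] at key
  rw [Finset.sum_sub_distrib, sum_getD hm] at key
  rw [show (1 : Fin 2) - s = flipS s by fin_cases s <;> rfl, key]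
  congr 3
  simp
  ring

lemma PsiL_add_pi {τ : ℂ} {Ψ : PsiFam} (h3 : PsiP3 τ Ψ) (pre post : List ℂ)
    (αp αq : List (Fin 2)) (u : ℂ) (s : Fin 2) (hp : pre.length = αp.length)
    (hq : post.length = αq.length) :
    PsiL Ψ (pre ++ (u + Real.pi) :: post) (αp ++ s :: αq) =
      ((αp ++ αq).map sgnS).prod * PsiL Ψ (pre ++ u :: post) (αp ++ s :: αq) := by
  obtain ⟨n, hn | hn⟩ := Nat.even_or_odd' (pre ++ u :: post).length
  · rw [PsiL_eq_zero Ψ (us := pre ++ u :: post) (by omega), PsiL_eq_zero Ψ (by simp at hn ⊢; omega),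
      mul_zero]
  · rw [PsiL_eq Ψ hn, PsiL_eq Ψ (n := n) (by simp at hn ⊢; omega)]
    have key := congrFun (h3 n (fun j => (pre ++ u :: post).getD j 0)
      ⟨pre.length, by simp at hn; omega⟩).1 fun j => (αp ++ s :: αq).getD j 0
    rw [update_getD _ _ _ _ _ _ rfl] at key
    simp only [getD_middle] at key
    rw [key]
    congr 1
    exact prod_erase_getD αp αq s 0 sgnS _ hp (by simp at hn ⊢; omega)

lemma PsiL_add_two_pi_tau {τ : ℂ} {Ψ : PsiFam} (h3 : PsiP3 τ Ψ) (pre post : List ℂ)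
    (αs : List (Fin 2)) (u : ℂ) {n : ℕ} (hn : pre.length + post.length = 2 * n) :
    PsiL Ψ (pre ++ (u + 2 * Real.pi * τ) :: post) αs =
      (pnome τ ^ (4 * n))⁻¹ * exp (-2 * I * (2 * n * u - pre.sum - post.sum)) *
        PsiL Ψ (pre ++ u :: post) αs := by
  have hm : (pre ++ u :: post).length = 2 * n + 1 := by simp; omega
  rw [PsiL_eq Ψ hm, PsiL_eq Ψ (n := n) (by simp; omega)]
  have key := congrFun (h3 n (fun j => (pre ++ u :: post).getD j 0)
      ⟨pre.length, by omega⟩).2 fun j => αs.getD j 0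
  rw [update_getD _ _ _ _ _ _ rfl] at key
  simp only [getD_middle] at key
  rw [Finset.sum_sub_distrib, sum_getD hm] at key
  rw [key]
  congr 3
  simp
  ring

lemma differentiable_PsiL {Ψ : PsiFam} (hΨ : PsiEntire Ψ) (pre post : List ℂ)
    (αs : List (Fin 2)) : Differentiable ℂ fun z => PsiL Ψ (pre ++ z :: post) αs := by
  obtain ⟨n, hn | hn⟩ := Nat.even_or_odd' (pre ++ (0 : ℂ) :: post).length
  · have : (fun z => PsiL Ψ (pre ++ z :: post) αs) = fun _ => 0 := by
      funext z
      exact PsiL_eq_zero Ψ (by simp at hn ⊢; omega) _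
    rw [this]
    fun_prop
  · have : (fun z => PsiL Ψ (pre ++ z :: post) αs) = fun z => Ψ n (Function.update
        (fun j => (pre ++ 0 :: post).getD j 0) ⟨pre.length, by simp at hn; omega⟩ z)
        fun j => αs.getD j 0 := by
      funext z
      rw [PsiL_eq Ψ (n := n) (by simp at hn ⊢; omega), update_getD _ _ _ _ _ _ rfl]
    rw [this]
    exact hΨ n _ _ _

lemma differentiable_PsiL_pair {τ : ℂ} (hτ : 0 < τ.im) {Ψ : PsiFam} (hΨ : PsiEntire Ψ)
    (h3 : PsiP3 τ Ψ) (us : List ℂ) (s t : Fin 2) (αs : List (Fin 2))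
    (hl : us.length = αs.length) :
    Differentiable ℂ fun z => PsiL Ψ (z :: -z :: us) (s :: t :: αs) := by
  obtain ⟨n, hn | hn⟩ := Nat.even_or_odd' (us.length + 1)
  swap
  · have : (fun z => PsiL Ψ (z :: -z :: us) (s :: t :: αs)) = fun _ => 0 := by
      funext z
      exact PsiL_eq_zero Ψ (by simp at hn ⊢; omega) _
    rw [this]
    fun_prop
  · have h2 := two_mul_im hτ
    let σ : ℂ := -((t :: αs).map sgnS).prod
    have hσ : ‖σ‖ = 1 := by
      have (l : List (Fin 2)) : ‖(l.map sgnS).prod‖ = 1 := by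
        induction l with
        | nil => simp
        | cons a l ih =>
          rw [List.map_cons, List.prod_cons, norm_mul, ih, sgnS]
          split_ifs <;> simp
      rw [norm_neg, this]
    obtain ⟨c, L, hL, hf⟩ := exists_interpolation h2 (2 * n + 1) (σ := σ)
      (C := -((pnome τ ^ (4 * n))⁻¹ * exp (-(2 * Real.pi * I * τ)) *
        exp (2 * I * us.sum - 2 * I * ηc))) hσ
    have dth := differentiable_th1 h2
    have key (b z : ℂ) := hf (fun u => PsiL Ψ (u :: b :: us) (s :: t :: αs) *
      th1 (u + b + ηc) (2 * τ)) (by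
        have := differentiable_PsiL hΨ [] (b :: us) (s :: t :: αs)
        simp only [List.nil_append] at this
        fun_prop) (by
        intro u
        have := PsiL_add_pi h3 [] (b :: us) [] (t :: αs) u s rfl (by simp [hl])
        simp only [List.nil_append] at this
        rw [this, add_right_comm u, add_right_comm, th1_add_pi]
        simp only [σ]
        ring) (by
        intro u
        have := PsiL_add_two_pi_tau h3 [] (b :: us) (s :: t :: αs) u (n := n) (by simpa using hn)
        simp only [List.nil_append] at this
        rw [show Real.pi * (2 * τ) = 2 * Real.pi * τ by ring, this, add_right_comm u,
          add_right_comm, show 2 * Real.pi * τ = Real.pi * (2 * τ) by ring, th1_add_pi_tau]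
        have e : exp (-2 * I * (2 * n * u - List.sum [] - (b :: us).sum)) *
            exp (-(Real.pi * I * (2 * τ)) - 2 * I * (u + b + ηc)) =
            exp (-(2 * Real.pi * I * τ)) * exp (2 * I * us.sum - 2 * I * ηc) *
              exp (-2 * I * ((2 * n + 1 : ℕ) * u)) := by
          rw [← exp_add, ← exp_add, ← exp_add]
          congr 1
          simp
          ring
        linear_combination (-(pnome τ ^ (4 * n))⁻¹ * PsiL Ψ (u :: b :: us) (s :: t :: αs) *
          th1 (u + b + ηc) (2 * τ)) * e) z
    have e : (fun z => PsiL Ψ (z :: -z :: us) (s :: t :: αs)) = fun z =>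
        (∑ k, (PsiL Ψ (c k :: -z :: us) (s :: t :: αs) * th1 (c k + -z + ηc) (2 * τ)) * L k z) *
          (th1 ηc (2 * τ))⁻¹ := by
      funext z
      rw [← key (-z) z, add_neg_cancel, zero_add, mul_assoc, mul_inv_cancel₀ (th1_eta_ne h2),
        mul_one]
    rw [e]
    refine (Differentiable.fun_sum fun k _ => ?_).mul_const _
    have := (differentiable_PsiL hΨ [c k] us (s :: t :: αs)).comp differentiable_neg
    simp only [List.singleton_append] at this
    refine (Differentiable.mul this ?_).mul (hL k)
    fun_prop

lemma Aw_add_pi (τ x : ℂ) : Aw τ (x + Real.pi) = Aw τ x := by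
  rw [Aw, Aw, add_sub_right_comm, th1_add_pi, th1_add_pi]
  ring

lemma Dw_add_pi (τ x : ℂ) : Dw τ (x + Real.pi) = Dw τ x := by
  rw [Dw, Dw, add_sub_right_comm, th4_add_pi, th4_add_pi]

lemma exp_half_mul (τ x : ℂ) : exp (-(Real.pi * I * τ / 2) - I * x) *
    exp (-(Real.pi * I * τ / 2) - I * (x - 2 * ηc)) =
    exp (-(Real.pi * I * τ) - 2 * I * x + 2 * I * ηc) := by
  rw [← exp_add]
  congr 1
  ring

lemma Aw_add_pi_tau (τ x : ℂ) : Aw τ (x + Real.pi * τ) =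
    -exp (-(Real.pi * I * τ) - 2 * I * x + 2 * I * ηc) * Dw τ x := by
  rw [Aw, Dw, add_sub_right_comm, th1_add_half, th1_add_half, ← exp_half_mul]
  linear_combination exp (-(Real.pi * I * τ / 2) - I * x) *
    exp (-(Real.pi * I * τ / 2) - I * (x - 2 * ηc)) * th4 x (2 * τ) * th4 (x - 2 * ηc) (2 * τ) * I_sq

lemma Dw_add_pi_tau (τ x : ℂ) : Dw τ (x + Real.pi * τ) =
    -exp (-(Real.pi * I * τ) - 2 * I * x + 2 * I * ηc) * Aw τ x := by
  rw [Aw, Dw, add_sub_right_comm, th4_add_half, th4_add_half, ← exp_half_mul]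
  linear_combination exp (-(Real.pi * I * τ / 2) - I * x) *
    exp (-(Real.pi * I * τ / 2) - I * (x - 2 * ηc)) * th1 x (2 * τ) * th1 (x - 2 * ηc) (2 * τ) * I_sq

lemma Kw_add_pi (τ : ℂ) (e s : Fin 2) (x : ℂ) : Kw τ e s (x + Real.pi) = Kw τ e s x := by
  rw [Kw, Kw, Aw_add_pi, Dw_add_pi]

lemma Kw_add_pi_tau (τ : ℂ) (e s : Fin 2) (x : ℂ) : Kw τ e s (x + Real.pi * τ) =
    -exp (-(Real.pi * I * τ) - 2 * I * x + 2 * I * ηc) * Kw τ e (1 - s) x := by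
  rw [Kw, Kw, Aw_add_pi_tau, Dw_add_pi_tau]
  fin_cases e <;> fin_cases s <;> simp

lemma Kw_two_eta_sub (τ : ℂ) (e s : Fin 2) (x : ℂ) : Kw τ e s (-x + 2 * ηc) = Kw τ e s x := by
  rw [Kw, Kw, Aw, Aw, Dw, Dw, add_sub_cancel_right, th1_neg, th4_neg,
    show -x + 2 * ηc = -(x - 2 * ηc) by ring, th1_neg, th4_neg]
  congr 1 <;> ring

lemma differentiable_Kw {τ : ℂ} (hτ : 0 < τ.im) (e s : Fin 2) : Differentiable ℂ (Kw τ e s) := by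
  have a := differentiable_th1 (two_mul_im hτ)
  have b := differentiable_th4 (two_mul_im hτ)
  have : Kw τ e s = if s = e then (fun x => th4 x (2 * τ) * th4 (x - 2 * ηc) (2 * τ))
      else fun x => th1 x (2 * τ) * th1 (x - 2 * ηc) (2 * τ) := by
    funext x
    rw [Kw]
    split_ifs <;> rfl
  rw [this]
  split_ifs <;> fun_prop

lemma contr_add_pi {τ : ℂ} {Ψ : PsiFam} (h3 : PsiP3 τ Ψ) (e : Fin 2) (x : ℂ) (us : List ℂ)
    (αs : List (Fin 2)) (hl : us.length = αs.length) :
    contr τ e (x + Real.pi) (PsiL Ψ) us αs = contr τ e x (PsiL Ψ) us αs := by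
  have key (s : Fin 2) : PsiL Ψ ((x + Real.pi) :: -(x + Real.pi) :: us) (s :: s :: αs) =
      PsiL Ψ (x :: -x :: us) (s :: s :: αs) := by
    have a := PsiL_add_pi h3 [] (-(x + Real.pi) :: us) [] (s :: αs) x s rfl (by simp [hl])
    have b := PsiL_add_pi h3 [x] us [s] αs (-(x + Real.pi)) s rfl hl
    simp only [List.nil_append, List.singleton_append] at a b
    rw [a, ← b]
    congr 3
    ring
  rw [contr, contr, Kw_add_pi, Kw_add_pi, key, key]

lemma pnome_ne (τ : ℂ) : pnome τ ≠ 0 := exp_ne_zero _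

lemma contr_add_pi_tau {τ : ℂ} {Ψ : PsiFam} (h2 : PsiP2 τ Ψ) (e : Fin 2) (x : ℂ) (us : List ℂ)
    (αs : List (Fin 2)) {n : ℕ} (hn : 1 + us.length = 2 * n) :
    contr τ e (x + Real.pi * τ) (PsiL Ψ) us αs =
      -exp (-(Real.pi * I * τ) + 2 * I * ηc - I * (2 * n + 1) * (Real.pi * τ)) *
        exp (-2 * I * ((2 * n + 2 : ℕ) * x)) * contr τ e x (PsiL Ψ) us αs := by
  have hp : (-pnome τ) ^ n ≠ 0 := pow_ne_zero _ (neg_ne_zero.2 (pnome_ne τ))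
  have key (s : Fin 2) :
      PsiL Ψ ((x + Real.pi * τ) :: -(x + Real.pi * τ) :: us) (s :: s :: αs) =
      exp (-I * (2 * n + 1) * (2 * x + Real.pi * τ)) *
        PsiL Ψ (x :: -x :: us) ((1 - s) :: (1 - s) :: αs) := by
    have a := PsiL_flip h2 [] (-(x + Real.pi * τ) :: us) [] (s :: αs) x s rfl
      (by simp; omega) (n := n)
    have b := PsiL_flip h2 [x] us [1 - s] αs (-(x + Real.pi * τ)) (1 - s) rfl
      (by simpa using hn) (n := n)
    simp only [List.nil_append, List.singleton_append, sub_sub_cancel] at a b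
    rw [b, show -(x + Real.pi * τ) + Real.pi * τ = -x by ring] at a
    refine mul_left_cancel₀ (mul_ne_zero hp (exp_ne_zero _)) (a.symm.trans ?_)
    rw [← mul_assoc, mul_assoc ((-pnome τ) ^ n) (exp _) (exp _), ← exp_add]
    congr 3
    simp
    ring
  have E : exp (-(Real.pi * I * τ) - 2 * I * x + 2 * I * ηc) *
      exp (-I * (2 * n + 1) * (2 * x + Real.pi * τ)) =
      exp (-(Real.pi * I * τ) + 2 * I * ηc - I * (2 * n + 1) * (Real.pi * τ)) *
        exp (-2 * I * ((2 * n + 2 : ℕ) * x)) := by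
    rw [← exp_add, ← exp_add]
    congr 1
    push_cast
    ring
  rw [contr, contr, Kw_add_pi_tau, Kw_add_pi_tau, key, key]
  simp only [sub_self, sub_zero]
  linear_combination (-(Kw τ e 0 x * PsiL Ψ (x :: -x :: us) (0 :: 0 :: αs)) -
    Kw τ e 1 x * PsiL Ψ (x :: -x :: us) (1 :: 1 :: αs)) * E

lemma contr_contr {τ : ℂ} (hτ : 0 < τ.im) {Ψ : PsiFam} (h1 : PsiP1 τ Ψ) (h5 : PsiP5 τ Ψ)
    (e : Fin 2) (x : ℂ) (us : List ℂ) (αs : List (Fin 2)) :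
    contr τ e (-x + 2 * ηc) (contr τ e x (PsiL Ψ)) us αs =
      -(Aw τ x * Dw τ x * (th1 (-x - x - 2 * ηc) τ * th1 (-2 * x) τ) *
        ((us.map fun u => th1 (-x - u - 2 * ηc) τ).prod *
          (us.map fun u => th1 (x - 2 * ηc - u - 2 * ηc) τ).prod)) * PsiL Ψ us αs := by
  have a (s t : Fin 2) := PsiL_reduce h5 [x] ((x - 2 * ηc) :: us) [s] (t :: αs) (-x) s t rfl
  have b := PsiL_reduce h5 [] us [] αs (x - 2 * ηc) 0 1 rfl
  have c := (exch_PsiL h1).diff [] us [] αs x (x - 2 * ηc) 0 rfl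
  have hc : cv τ (-(2 * ηc)) ≠ 0 := by
    have h2 := two_mul_im hτ
    rw [cv, neg_add_cancel, th4_neg, th1_two_eta, th4_two_eta]
    exact mul_ne_zero (mul_ne_zero (th1_eta_ne h2) (th4_zero_ne h2)) (th4_eta_ne h2)
  have hb : bv τ (-(2 * ηc)) = -cv τ (-(2 * ηc)) := by
    rw [cv, bv, neg_add_cancel, th4_neg, th1_neg]
    ring
  have hr : rv τ (-(2 * ηc)) = -cv τ (-(2 * ηc)) := by
    rw [rv, hb, av, neg_add_cancel, th1_zero]
    ring
  simp only [List.nil_append, List.cons_append, sub_zero] at a b c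
  rw [sub_add_cancel] at b
  rw [show x - 2 * ηc - x = -(2 * ηc) by ring, hr, hb, b] at c
  have d : PsiL Ψ (x :: (x - 2 * ηc) :: us) (0 :: 1 :: αs) -
      PsiL Ψ (x :: (x - 2 * ηc) :: us) (1 :: 0 :: αs) =
      -((us.map fun u => th1 (x - 2 * ηc - u - 2 * ηc) τ).prod * PsiL Ψ us αs) := by
    refine mul_left_cancel₀ hc ?_
    simp [singletC] at c
    linear_combination -c
  have hAD : Kw τ e 0 x * Kw τ e 1 x = Aw τ x * Dw τ x := by
    fin_cases e <;> simp [Kw, mul_comm]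
  have a01 := a 0 1
  have a10 := a 1 0
  have a00 := a 0 0
  have a11 := a 1 1
  simp only [List.map_cons, List.prod_cons] at a01 a10 a00 a11
  rw [show -x - (x - 2 * ηc) - 2 * ηc = -2 * x by ring] at a01 a10
  simp only [contr]
  rw [Kw_two_eta_sub, Kw_two_eta_sub, show -(-x + 2 * ηc) = x - 2 * ηc by ring, a01, a10, a00, a11]
  simp only [singletC, Fin.isValue, and_self, if_true, if_false, one_ne_zero, zero_ne_one,
    and_false, and_true]
  linear_combination Kw τ e 0 x * Kw τ e 1 x * (th1 (-x - x - 2 * ηc) τ * th1 (-2 * x) τ) *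
    (us.map fun u => th1 (-x - u - 2 * ηc) τ).prod * d -
    (th1 (-x - x - 2 * ηc) τ * th1 (-2 * x) τ) *
    (us.map fun u => th1 (-x - u - 2 * ηc) τ).prod *
    ((us.map fun u => th1 (x - 2 * ηc - u - 2 * ηc) τ).prod * PsiL Ψ us αs) * hAD

lemma contr_neg_β4 {τ : ℂ} {Ψ : PsiFam} (h2 : PsiP2 τ Ψ) (h5 : PsiP5 τ Ψ) (e : Fin 2)
    (us : List ℂ) (αs : List (Fin 2)) {n : ℕ} (hn : 1 + us.length = 2 * n) :
    (-pnome τ) ^ n * exp (-I * (-β4c τ + us.sum - 2 * n * (-β4c τ + 2 * ηc))) *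
        contr τ e (-β4c τ) (PsiL Ψ) us αs =
      (us.map fun u => th1 (-β4c τ - u - 2 * ηc) τ).prod *
        (Kw τ e 0 (-β4c τ) - Kw τ e 1 (-β4c τ)) * PsiL Ψ us αs := by
  have key (s : Fin 2) := (PsiL_flip h2 [-β4c τ] us [s] αs (-β4c τ + 2 * ηc) s rfl
      (by simpa using hn) (n := n)).symm.trans
      (PsiL_reduce h5 [] us [] αs (-β4c τ) s (1 - s) rfl)
  have k0 := key 0
  have k1 := key 1
  have e0 : -β4c τ + 2 * ηc + Real.pi * τ = β4c τ := by rw [β4c]; ring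
  rw [e0] at k0 k1
  simp only [List.nil_append, List.singleton_append, List.sum_singleton, sub_zero, sub_self,
    singletC, Fin.isValue, and_self, if_true, if_false, one_ne_zero, zero_ne_one] at k0 k1
  rw [contr, neg_neg]
  linear_combination Kw τ e 0 (-β4c τ) * k0 + Kw τ e 1 (-β4c τ) * k1

lemma contr_neg_β3 {τ : ℂ} {Ψ : PsiFam} (h2 : PsiP2 τ Ψ) (h3 : PsiP3 τ Ψ) (h5 : PsiP5 τ Ψ)
    (e : Fin 2) (us : List ℂ) (αs : List (Fin 2)) (hl : us.length = αs.length) {n : ℕ}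
    (hn : 1 + us.length = 2 * n) :
    (-pnome τ) ^ n * exp (-I * (-β3c τ + us.sum - 2 * n * (-β3c τ + 2 * ηc))) *
        contr τ e (-β3c τ) (PsiL Ψ) us αs =
      (αs.map sgnS).prod * (us.map fun u => th1 (-β3c τ - u - 2 * ηc) τ).prod *
        (Kw τ e 0 (-β3c τ) + Kw τ e 1 (-β3c τ)) * PsiL Ψ us αs := by
  have key (s : Fin 2) := (PsiL_flip h2 [-β3c τ] us [s] αs (-β3c τ + 2 * ηc) s rfl
      (by simpa using hn) (n := n)).symm.trans
      (PsiL_reduce h5 [] us [] αs (-β3c τ) s (1 - s) rfl)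
  have shift (s : Fin 2) := PsiL_add_pi h3 [-β3c τ] us [s] αs (-β3c τ + 2 * ηc + Real.pi * τ) s
    rfl hl
  have k0 := key 0
  have k1 := key 1
  have s0 := shift 0
  have s1 := shift 1
  have e0 : -β3c τ + 2 * ηc + Real.pi * τ + Real.pi = β3c τ := by rw [β3c]; ring
  rw [e0] at s0 s1
  simp only [List.nil_append, List.singleton_append, List.sum_singleton, sub_zero, sub_self,
    singletC, Fin.isValue, and_self, if_true, if_false, one_ne_zero, zero_ne_one, List.map_cons,
    List.prod_cons, sgnS] at k0 k1 s0 s1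
  rw [contr, neg_neg, s0, s1]
  linear_combination Kw τ e 0 (-β3c τ) * (αs.map sgnS).prod * k0 -
    Kw τ e 1 (-β3c τ) * (αs.map sgnS).prod * k1

/-- Successive contractions of pairs of sites, evaluated on the remaining site. -/
def Zc (τ : ℂ) (e : Fin 2) : List ℂ → (List ℂ → List (Fin 2) → ℂ) → ℂ
  | [], Φ => Φ [0] [1]
  | x :: xs, Φ => Zc τ e xs (contr τ e x Φ)

/-- The list `x₁, -x₁, …, xₙ, -xₙ, 0`. -/
def inter : List ℂ → List ℂ
  | [] => [0]
  | x :: xs => x :: -x :: inter xs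

lemma length_inter (xs : List ℂ) : (inter xs).length = 2 * xs.length + 1 := by
  induction xs with
  | nil => rfl
  | cons x xs ih => rw [inter, List.length_cons, List.length_cons, ih, List.length_cons]; ring

lemma sum_inter (xs : List ℂ) : (inter xs).sum = 0 := by
  induction xs with
  | nil => simp [inter]
  | cons x xs ih => simp [inter, ih]

lemma prod_map_inter (xs : List ℂ) (f : ℂ → ℂ) :
    ((inter xs).map f).prod = (xs.map fun x => f x * f (-x)).prod * f 0 := by
  induction xs with
  | nil => simp [inter]
  | cons x xs ih => simp [inter, ih]; ring

lemma Zc_factor (τ : ℂ) (e : Fin 2) (xs : List ℂ) (g : ℂ) {Φ Φ' : List ℂ → List (Fin 2) → ℂ}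
    (h : ∀ αs, (inter xs).length = αs.length → Φ (inter xs) αs = g * Φ' (inter xs) αs) :
    Zc τ e xs Φ = g * Zc τ e xs Φ' := by
  induction xs generalizing Φ Φ' with
  | nil => exact h _ rfl
  | cons x xs ih =>
    refine ih fun αs hα => ?_
    have a (s : Fin 2) := h (s :: s :: αs) (by simp [inter, hα])
    simp only [inter] at a
    rw [contr, contr, a, a]
    ring

lemma differentiable_Zc (τ : ℂ) (e : Fin 2) (xs : List ℂ) {Φ : ℂ → List ℂ → List (Fin 2) → ℂ}
    (h : ∀ αs, (inter xs).length = αs.length → Differentiable ℂ fun z => Φ z (inter xs) αs) :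
    Differentiable ℂ fun z => Zc τ e xs (Φ z) := by
  induction xs generalizing Φ with
  | nil => exact h _ rfl
  | cons x xs ih =>
    refine ih fun αs hα => ?_
    have a (s : Fin 2) := h (s :: s :: αs) (by simp [inter, hα])
    simp only [inter] at a
    simp only [contr]
    have a0 := a 0
    have a1 := a 1
    fun_prop

lemma differentiable_Zc_head {τ : ℂ} (hτ : 0 < τ.im) {Ψ : PsiFam} (hΨ : PsiEntire Ψ)
    (h3 : PsiP3 τ Ψ) (e : Fin 2) (xs : List ℂ) :
    Differentiable ℂ fun z => Zc τ e (z :: xs) (PsiL Ψ) := by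
  refine differentiable_Zc τ e xs fun αs hα => ?_
  have a (s : Fin 2) := differentiable_PsiL_pair hτ hΨ h3 (inter xs) s s αs hα
  have b (s : Fin 2) := differentiable_Kw hτ e s
  exact ((b 0).mul (a 0)).add ((b 1).mul (a 1))

lemma Zc_add_pi {τ : ℂ} {Ψ : PsiFam} (h3 : PsiP3 τ Ψ) (e : Fin 2) (xs : List ℂ) (z : ℂ) :
    Zc τ e ((z + Real.pi) :: xs) (PsiL Ψ) = Zc τ e (z :: xs) (PsiL Ψ) := by
  rw [← one_mul (Zc τ e (z :: xs) (PsiL Ψ))]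
  refine Zc_factor τ e xs 1 fun αs hα => ?_
  rw [one_mul, contr_add_pi h3 e z _ _ hα]

lemma Zc_add_pi_tau {τ : ℂ} {Ψ : PsiFam} (h2 : PsiP2 τ Ψ) (e : Fin 2) (xs : List ℂ) (z : ℂ) {n : ℕ}
    (hn : xs.length + 1 = n) :
    Zc τ e ((z + Real.pi * τ) :: xs) (PsiL Ψ) =
      -exp (-(Real.pi * I * τ) + 2 * I * ηc - I * (2 * n + 1) * (Real.pi * τ)) *
        exp (-2 * I * ((2 * n + 2 : ℕ) * z)) * Zc τ e (z :: xs) (PsiL Ψ) := by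
  refine Zc_factor τ e xs _ fun αs _ => ?_
  exact contr_add_pi_tau h2 e z _ _ (by rw [length_inter]; omega)

/-- The factor in the reflection relation. -/
def kap (τ x : ℂ) : ℂ :=
  th1 (2 * ηc - 2 * x) (2 * τ) * th4 0 (2 * τ) * th4 (2 * x + 2 * ηc) (2 * τ)

lemma Zc_neg {τ : ℂ} (hτ : 0 < τ.im) {Φ : List ℂ → List (Fin 2) → ℂ} (h : Exch τ Φ) (e : Fin 2)
    (xs : List ℂ) (z : ℂ) :
    rv τ (-2 * z) * Zc τ e (-z :: xs) Φ = kap τ z * Zc τ e (z :: xs) Φ := by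
  rw [Zc, Zc, ← Zc_factor τ e xs (rv τ (-2 * z)) (Φ := fun us αs => rv τ (-2 * z) *
    contr τ e (-z) Φ us αs) fun αs _ => rfl]
  exact Zc_factor τ e xs _ fun αs _ => contr_neg hτ h e z _ _

/-- The contractions at `x` and `y` commute. -/
def Sep (τ x y : ℂ) : Prop := rv τ (-x - y) ≠ 0 ∧ rv τ (x - y) ≠ 0 ∧ rv τ (y - x) ≠ 0

lemma Sep.symm {τ x y : ℂ} (h : Sep τ x y) : Sep τ y x :=
  ⟨by rw [show -y - x = -x - y by ring]; exact h.1, h.2.2, h.2.1⟩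

lemma Zc_perm {τ : ℂ} (hτ : 0 < τ.im) (e : Fin 2) {xs ys : List ℂ} (hp : xs.Perm ys)
    (hx : xs.Pairwise (Sep τ)) {Φ : List ℂ → List (Fin 2) → ℂ} (h : Exch τ Φ) :
    Zc τ e xs Φ = Zc τ e ys Φ := by
  induction hp generalizing Φ with
  | nil => rfl
  | cons x _ ih => exact ih hx.of_cons (h.contr e x)
  | swap x y l =>
    rw [Zc, Zc, Zc, Zc]
    congr 1
    funext us αs
    have := List.rel_of_pairwise_cons hx (List.mem_cons_self)
    exact (contr_comm hτ h e this.1 this.2.1 us αs)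
  | trans a _ ih1 ih2 =>
    rw [ih1 hx h, ih2 (a.pairwise hx Sep.symm) h]

/-- The rational span of the periods. -/
def ratS (τ : ℂ) : Submodule ℚ ℂ := Submodule.span ℚ {(Real.pi : ℂ), Real.pi * τ}

lemma mem_ratS {τ z : ℂ} (a b : ℚ) (h : z = a * Real.pi + b * (Real.pi * τ)) : z ∈ ratS τ :=
  Submodule.mem_span_pair.2 ⟨a, b, by rw [h, Rat.smul_def, Rat.smul_def]⟩

lemma InLat.mem_ratS {τ z : ℂ} (h : InLat τ z) : z ∈ ratS τ := by
  obtain ⟨m, n, h⟩ := h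
  exact EightVertex.mem_ratS m n (by rw [h]; push_cast; ring)

lemma InLat.mem_ratS_two {τ z : ℂ} (h : InLat (2 * τ) z) : z ∈ ratS τ := by
  obtain ⟨m, n, h⟩ := h
  exact EightVertex.mem_ratS m (2 * n) (by rw [h]; push_cast; ring)

lemma eta_mem_ratS (τ : ℂ) : ηc ∈ ratS τ := mem_ratS (1 / 3) 0 (by rw [ηc]; push_cast; ring)

lemma tau_mem_ratS (τ : ℂ) : Real.pi * τ ∈ ratS τ := mem_ratS 0 1 (by push_cast; ring)

lemma half_mem_ratS {τ z : ℂ} (h : 2 * z ∈ ratS τ) : z ∈ ratS τ := by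
  have := (ratS τ).smul_mem (1 / 2 : ℚ) h
  rw [Rat.smul_def] at this
  convert this using 1
  push_cast
  ring

lemma two_mem_ratS {τ z : ℂ} (h : z ∈ ratS τ) : 2 * z ∈ ratS τ := by
  rw [two_mul]; exact add_mem h h

lemma countable_ratS (τ : ℂ) : (ratS τ : Set ℂ).Countable := by
  refine (Set.countable_range fun q : ℚ × ℚ => q.1 • (Real.pi : ℂ) + q.2 • (Real.pi * τ)).mono ?_
  intro z hz
  obtain ⟨a, b, h⟩ := Submodule.mem_span_pair.1 hz
  exact ⟨(a, b), h⟩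

lemma th1_ne_of_ratS {τ z : ℂ} (hτ : 0 < τ.im) (h : z ∉ ratS τ) : th1 z τ ≠ 0 := fun h0 =>
  h ((th1_eq_zero_iff hτ).1 h0).mem_ratS

lemma th1_two_ne_of_ratS {τ z : ℂ} (hτ : 0 < τ.im) (h : z ∉ ratS τ) : th1 z (2 * τ) ≠ 0 := fun h0 =>
  h ((th1_eq_zero_iff (two_mul_im hτ)).1 h0).mem_ratS_two

lemma th4_two_ne_of_ratS {τ z : ℂ} (hτ : 0 < τ.im) (h : z ∉ ratS τ) : th4 z (2 * τ) ≠ 0 := fun h0 => by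
  have a := ((th4_eq_zero_iff (two_mul_im hτ)).1 h0).mem_ratS_two
  have := add_mem a (tau_mem_ratS τ)
  exact h (by convert this using 1; ring)

lemma rhoF_ne_of_ratS {τ z : ℂ} (hτ : 0 < τ.im) (h : z ∉ ratS τ) : rhoF τ z ≠ 0 := by
  refine mul_ne_zero (th1_ne_of_ratS hτ fun a => h ?_) (th1_ne_of_ratS hτ fun a => h ?_)
  · convert add_mem a (eta_mem_ratS τ) using 1; ring
  · convert sub_mem a (eta_mem_ratS τ) using 1; ring

lemma kap_ne_of_ratS {τ z : ℂ} (hτ : 0 < τ.im) (h : z ∉ ratS τ) : kap τ z ≠ 0 := by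
  have t := two_mem_ratS (eta_mem_ratS τ)
  refine mul_ne_zero (mul_ne_zero (th1_two_ne_of_ratS hτ fun a => h ?_) (th4_zero_ne (two_mul_im hτ)))
    (th4_two_ne_of_ratS hτ fun a => h ?_)
  · refine half_mem_ratS ?_
    convert sub_mem t a using 1; ring
  · refine half_mem_ratS ?_
    convert sub_mem a t using 1; ring

lemma rv_ne {τ u : ℂ} (hτ : 0 < τ.im) (h : th1 (u + ηc) τ ≠ 0) : rv τ u ≠ 0 := by
  rw [rv_eq hτ, th4_two_eta]
  exact mul_ne_zero (th4_eta_ne (two_mul_im hτ)) (mul_ne_zero h (th2_eta_ne hτ))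

lemma rv_ne_of_ratS {τ u : ℂ} (hτ : 0 < τ.im) (h : u ∉ ratS τ) : rv τ u ≠ 0 :=
  rv_ne hτ (th1_ne_of_ratS hτ fun a => h (by convert sub_mem a (eta_mem_ratS τ) using 1; ring))

/-- Genericity of a list of inhomogeneities. -/
def Gen (τ : ℂ) (xs : List ℂ) : Prop :=
  (∀ x ∈ xs, x ∉ ratS τ) ∧ xs.Pairwise fun x y => x - y ∉ ratS τ ∧ x + y ∉ ratS τ

lemma Gen.nil (τ : ℂ) : Gen τ [] := ⟨by simp, List.Pairwise.nil⟩

lemma Gen.of_cons {τ x : ℂ} {xs : List ℂ} (h : Gen τ (x :: xs)) : Gen τ xs :=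
  ⟨fun y hy => h.1 y (List.mem_cons_of_mem _ hy), h.2.of_cons⟩

lemma Gen.head {τ x : ℂ} {xs : List ℂ} (h : Gen τ (x :: xs)) : x ∉ ratS τ :=
  h.1 x List.mem_cons_self

lemma Gen.perm {τ : ℂ} {xs ys : List ℂ} (h : Gen τ xs) (hp : xs.Perm ys) : Gen τ ys := by
  refine ⟨fun x hx => h.1 x (hp.mem_iff.2 hx), hp.pairwise h.2 ?_⟩
  intro x y hxy
  exact ⟨fun a => hxy.1 (by convert neg_mem a using 1; ring),
    fun a => hxy.2 (by convert a using 1; ring)⟩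

lemma sep_of_ratS {τ x y : ℂ} (hτ : 0 < τ.im) (h : x - y ∉ ratS τ ∧ x + y ∉ ratS τ) : Sep τ x y := by
  refine ⟨rv_ne_of_ratS hτ fun a => h.2 ?_, rv_ne_of_ratS hτ h.1, rv_ne_of_ratS hτ fun a => h.1 ?_⟩
  · convert neg_mem a using 1; ring
  · convert neg_mem a using 1; ring

lemma Gen.sep {τ : ℂ} (hτ : 0 < τ.im) {xs : List ℂ} (h : Gen τ xs) : xs.Pairwise (Sep τ) :=
  h.2.imp fun a => sep_of_ratS hτ a

lemma Gen.sep_replicate {τ : ℂ} (hτ : 0 < τ.im) {xs : List ℂ} (h : Gen τ xs) (j : ℕ) :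
    (List.replicate j 0 ++ xs).Pairwise (Sep τ) := by
  rw [List.pairwise_append]
  refine ⟨List.pairwise_replicate.2 (Or.inr ?_), h.sep hτ, ?_⟩
  · have : rv τ 0 ≠ 0 := rv_ne hτ (by rw [zero_add]; exact th1_eta_ne hτ)
    refine ⟨?_, ?_, ?_⟩ <;> simpa using this
  · intro a ha b hb
    rw [List.eq_of_mem_replicate ha]
    have := h.1 b hb
    exact sep_of_ratS hτ ⟨fun c => this (by simpa using neg_mem c), fun c => this (by simpa using c)⟩

lemma dense_gen (τ : ℂ) {xs : List ℂ} (h : Gen τ xs) : Dense {z | Gen τ (z :: xs)} := by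
  have hc : (⋃ y ∈ (0 :: xs), ({z | z - y ∈ ratS τ} ∪ {z | z + y ∈ ratS τ}) : Set ℂ).Countable := by
    refine Set.Countable.biUnion (Set.Finite.countable (List.finite_toSet _)) fun y _ => ?_
    refine Set.Countable.union ?_ ?_
    · exact (countable_ratS τ).preimage (sub_left_injective)
    · exact (countable_ratS τ).preimage (add_left_injective y)
  refine (hc.dense_compl ℝ).mono ?_
  intro z hz
  simp only [Set.mem_compl_iff, Set.mem_iUnion, not_exists, Set.mem_union, Set.mem_ofPred_eq,
    not_or] at hz
  refine ⟨?_, List.pairwise_cons.2 ⟨fun y hy => hz y (List.mem_cons_of_mem _ hy), h.2⟩⟩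
  intro x hx
  rcases List.mem_cons.1 hx with rfl | hx
  · simpa using (hz 0 List.mem_cons_self).1
  · exact h.1 x hx

/-- `ϑ₁(η−2x,p²)`. -/
def thR (τ x : ℂ) : ℂ := th1 (ηc - 2 * x) (2 * τ)

lemma th4_eta_mul_th2_eta {τ : ℂ} (hτ : 0 < τ.im) :
    2 * (th4 ηc (2 * τ) * th2 ηc τ) = th2 0 τ * th4 0 (2 * τ) := by
  have a := th1_mul_th2 hτ ηc ηc
  rw [sub_self, th1_zero, mul_zero, add_zero, ← two_mul, th1_two_eta] at a
  have b := th1_double hτ ηc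
  have n := th1_eta_ne hτ
  refine mul_left_cancel₀ n ?_
  linear_combination 2 * th4 ηc (2 * τ) * a - th4 0 (2 * τ) * b

lemma thR_reflect {τ : ℂ} (hτ : 0 < τ.im) (x : ℂ) :
    rv τ (-2 * x) * thR τ (-x) = kap τ x * thR τ x := by
  have b := th1_double hτ (ηc - 2 * x)
  have c := th4_eta_mul_th2_eta hτ
  have n := th2_zero_ne hτ
  have e1 : th1 (2 * ηc - 2 * x) (2 * τ) = thR τ (-x) := by
    rw [thR, ← neg_neg (th1 (2 * ηc - 2 * x) (2 * τ)), ← th1_neg, ← th1_add_pi, ← three_ηc]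
    congr 1; ring
  have e2 : th4 (2 * x + 2 * ηc) (2 * τ) = th4 (ηc - 2 * x) (2 * τ) := by
    rw [← th4_neg, ← th4_add_pi, ← three_ηc]
    congr 1; ring
  rw [rv_eq hτ, th4_two_eta, kap, e1, e2, show -2 * x + ηc = ηc - 2 * x by ring]
  refine mul_left_cancel₀ n ?_
  change _ = 2 * (thR τ x * _) at b
  linear_combination (th4 ηc (2 * τ) * th2 ηc τ * thR τ (-x)) * b +
    thR τ x * th4 (ηc - 2 * x) (2 * τ) * thR τ (-x) * c

lemma thR_add_pi (τ z : ℂ) : thR τ (z + Real.pi) = thR τ z := by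
  rw [thR, thR, ← neg_neg (th1 (ηc - 2 * z) (2 * τ)), ← th1_add_pi,
    show ηc - 2 * z = ηc - 2 * (z + Real.pi) + Real.pi + Real.pi by ring, th1_add_pi, th1_add_pi,
    th1_add_pi]
  ring

lemma thR_add_pi_tau (τ z : ℂ) : thR τ (z + Real.pi * τ) =
    -exp (-(2 * Real.pi * I * τ) + 2 * I * ηc - 4 * I * z) * thR τ z := by
  have h := th1_add_pi_tau (ηc - 2 * (z + Real.pi * τ)) (2 * τ)
  rw [show ηc - 2 * (z + Real.pi * τ) + Real.pi * (2 * τ) = ηc - 2 * z by ring] at h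
  rw [thR, thR, h, ← mul_assoc, neg_mul_neg, ← exp_add]
  ring_nf
  simp

lemma rhoF_add_pi (τ z : ℂ) : rhoF τ (z + Real.pi) = rhoF τ z := by
  rw [rhoF, rhoF, add_sub_right_comm, add_right_comm, th1_add_pi, th1_add_pi]
  ring

lemma th1_sq_add_pi_tau (τ z : ℂ) : th1 (z + Real.pi * τ) τ ^ 2 =
    exp (-(2 * Real.pi * I * τ) - 4 * I * z) * th1 z τ ^ 2 := by
  rw [th1_add_pi_tau, mul_pow, neg_sq, ← exp_nat_mul]
  congr 2
  push_cast
  ring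

lemma rhoF_add_pi_tau (τ z : ℂ) : rhoF τ (z + Real.pi * τ) =
    exp (-(2 * Real.pi * I * τ) - 4 * I * z) * rhoF τ z := by
  rw [rhoF, rhoF, add_sub_right_comm, add_right_comm, th1_add_pi_tau, th1_add_pi_tau]
  rw [show exp (-(2 * Real.pi * I * τ) - 4 * I * z) = exp (-(Real.pi * I * τ) - 2 * I * (z - ηc)) *
    exp (-(Real.pi * I * τ) - 2 * I * (z + ηc)) by rw [← exp_add]; congr 1; ring]
  ring

/-- Normalisation of the right-hand side. -/
def Kc (τ : ℂ) : ℕ → ℂ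
  | 0 => 1
  | 1 => Dw τ 0 * Cc τ / (th1 ηc (2 * τ) * th1 ηc τ)
  | n + 2 => -(Cc τ ^ (2 * n + 3) * th4 0 (2 * τ) ^ 2 / (zet τ * th1 ηc τ ^ (4 * n + 4))) * Kc τ n

/-- The candidate for the contracted vector. -/
def Rhs (τ : ℂ) (F : List ℂ → ℂ) (zs : List ℂ) : ℂ :=
  Kc τ zs.length * (zs.map fun x => thR τ x * rhoF τ x ^ zs.length).prod * F (zs.map (wfun τ))

lemma Rhs_perm {τ : ℂ} {ζ ε : ℂ} {F : List ℂ → ℂ} (hF : IsCandidate ζ ε F) {xs ys : List ℂ}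
    (hp : xs.Perm ys) : Rhs τ F xs = Rhs τ F ys := by
  rw [Rhs, Rhs, hF.perm (hp.map _), hp.length_eq, (hp.map _).prod_eq]

lemma Rhs_reflect {τ : ℂ} (hτ : 0 < τ.im) (F : List ℂ → ℂ) (z : ℂ) (xs : List ℂ) :
    rv τ (-2 * z) * Rhs τ F (-z :: xs) = kap τ z * Rhs τ F (z :: xs) := by
  rw [Rhs, Rhs, List.map_cons, List.map_cons, List.map_cons, List.map_cons, wfun_neg,
    List.prod_cons, List.prod_cons, rhoF_neg, List.length_cons, List.length_cons]
  linear_combination Kc τ (xs.length + 1) * rhoF τ z ^ (xs.length + 1) *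
    (xs.map fun x => thR τ x * rhoF τ x ^ (xs.length + 1)).prod *
    F (wfun τ z :: xs.map (wfun τ)) * thR_reflect hτ z

lemma exists_Rhs_head {τ : ℂ} (hτ : 0 < τ.im) {ζ ε : ℂ} {F : List ℂ → ℂ} (hF : IsCandidate ζ ε F)
    (xs : List ℂ) {n : ℕ} (hn : xs.length + 1 = n) :
    ∃ g : ℂ → ℂ, Differentiable ℂ g ∧ (∀ z, g (z + Real.pi) = g z) ∧
      (∀ z, g (z + Real.pi * τ) =
        -exp (-(Real.pi * I * τ) + 2 * I * ηc - I * (2 * n + 1) * (Real.pi * τ)) *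
          exp (-2 * I * ((2 * n + 2 : ℕ) * z)) * g z) ∧
      (∀ z, rv τ (-2 * z) * g (-z) = kap τ z * g z) ∧
      ∀ z, rhoF τ z ≠ 0 → g z = Rhs τ F (z :: xs) := by
  obtain ⟨q, hq, e⟩ := hF.natDegree (xs.map (wfun τ))
  rw [List.length_map, hn] at hq
  let c := Kc τ n * (xs.map fun x => thR τ x * rhoF τ x ^ n).prod
  let S : ℂ → ℂ := fun z => ∑ j ∈ Finset.range (n + 1),
    q.coeff j * (Cc τ * th1 z τ ^ 2) ^ j * rhoF τ z ^ (n - j)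
  have dθ := differentiable_th1 hτ
  have dθ2 := differentiable_th1 (two_mul_im hτ)
  have dρ : Differentiable ℂ (rhoF τ) := by
    unfold rhoF; fun_prop
  have dR : Differentiable ℂ (thR τ) := by
    unfold thR; fun_prop
  refine ⟨fun z => c * (thR τ z * S z), by fun_prop, fun z => ?_, fun z => ?_, fun z => ?_,
    fun z hz => ?_⟩
  · have : S (z + Real.pi) = S z := by
      simp only [S, th1_add_pi, rhoF_add_pi, neg_sq]
    change c * (thR τ (z + Real.pi) * S (z + Real.pi)) = c * (thR τ z * S z)
    rw [this, thR_add_pi]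
  · have : S (z + Real.pi * τ) = exp (-(2 * Real.pi * I * τ) - 4 * I * z) ^ n * S z := by
      simp only [S, th1_sq_add_pi_tau, rhoF_add_pi_tau, Finset.mul_sum]
      refine Finset.sum_congr rfl fun j hj => ?_
      have hj' : j + (n - j) = n := by have := Finset.mem_range.1 hj; omega
      rw [← congrArg (fun k => exp (-(2 * Real.pi * I * τ) - 4 * I * z) ^ k) hj']
      change _ = exp (-(2 * Real.pi * I * τ) - 4 * I * z) ^ (j + (n - j)) * _
      rw [pow_add]
      ring
    change c * (thR τ (z + Real.pi * τ) * S (z + Real.pi * τ)) = _ * (c * (thR τ z * S z))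
    rw [this, thR_add_pi_tau, ← exp_nat_mul]
    have : exp (-(2 * Real.pi * I * τ) + 2 * I * ηc - 4 * I * z) *
        exp (n * (-(2 * Real.pi * I * τ) - 4 * I * z)) =
        exp (-(Real.pi * I * τ) + 2 * I * ηc - I * (2 * n + 1) * (Real.pi * τ)) *
          exp (-2 * I * ((2 * n + 2 : ℕ) * z)) := by
      rw [← exp_add, ← exp_add]
      congr 1
      push_cast
      ring
    linear_combination -c * thR τ z * S z * this
  · have : S (-z) = S z := by
      simp only [S, th1_neg, rhoF_neg, neg_sq]
    change rv τ (-2 * z) * (c * (thR τ (-z) * S (-z))) = kap τ z * (c * (thR τ z * S z))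
    rw [this]
    linear_combination c * S z * thR_reflect hτ z
  · have : S z = rhoF τ z ^ n * F (wfun τ z :: xs.map (wfun τ)) := by
      rw [e, Polynomial.eval_eq_sum_range' (n := n + 1) (by omega), Finset.mul_sum]
      refine Finset.sum_congr rfl fun j hj => ?_
      have hj' : n = j + (n - j) := by have := Finset.mem_range.1 hj; omega
      have : rhoF τ z ^ n = rhoF τ z ^ j * rhoF τ z ^ (n - j) := by
        rw [← pow_add, ← hj']
      rw [this, wfun_eq, div_pow]
      have := pow_ne_zero j hz
      field_simp
    change c * (thR τ z * S z) = _
    rw [this, Rhs, List.map_cons, List.map_cons, List.prod_cons, List.length_cons, hn]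
    ring

/-- The contracted vector equals its candidate. -/
def Claim (τ : ℂ) (e : Fin 2) (Ψ : PsiFam) (F : List ℂ → ℂ) (xs : List ℂ) : Prop :=
  Zc τ e xs (PsiL Ψ) = Rhs τ F xs

lemma Claim.neg {τ : ℂ} (hτ : 0 < τ.im) {Ψ : PsiFam} (h1 : PsiP1 τ Ψ) {e : Fin 2} {F : List ℂ → ℂ}
    {x : ℂ} {xs : List ℂ} (hx : kap τ x ≠ 0) (h : Claim τ e Ψ F (-x :: xs)) :
    Claim τ e Ψ F (x :: xs) := by
  refine mul_left_cancel₀ hx ?_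
  rw [← Zc_neg hτ (exch_PsiL h1), ← Rhs_reflect hτ, h]

lemma exists_head_diff {τ : ℂ} (hτ : 0 < τ.im) {Ψ : PsiFam} (hΨ : PsiEntire Ψ) (h1 : PsiP1 τ Ψ)
    (h2 : PsiP2 τ Ψ) (h3 : PsiP3 τ Ψ) (e : Fin 2) {ζ ε : ℂ} {F : List ℂ → ℂ}
    (hF : IsCandidate ζ ε F) (xs : List ℂ) {n : ℕ} (hn : xs.length + 1 = n) :
    ∃ f : ℂ → ℂ, Differentiable ℂ f ∧ (∀ z, f (z + Real.pi) = f z) ∧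
      (∀ z, f (z + Real.pi * τ) =
        -exp (-(Real.pi * I * τ) + 2 * I * ηc - I * (2 * n + 1) * (Real.pi * τ)) *
          exp (-2 * I * ((2 * n + 2 : ℕ) * z)) * f z) ∧
      (∀ z, rv τ (-2 * z) * f (-z) = kap τ z * f z) ∧
      ∀ z, rhoF τ z ≠ 0 → (f z = 0 ↔ Claim τ e Ψ F (z :: xs)) := by
  obtain ⟨g, g1, g2, g3, g4, g5⟩ := exists_Rhs_head hτ hF xs hn
  refine ⟨fun z => Zc τ e (z :: xs) (PsiL Ψ) - g z, (differentiable_Zc_head hτ hΨ h3 e xs).sub g1,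
    fun z => ?_, fun z => ?_, fun z => ?_, fun z hz => ?_⟩
  · change Zc τ e ((z + Real.pi) :: xs) (PsiL Ψ) - g (z + Real.pi) = _
    rw [Zc_add_pi h3, g2]
  · change Zc τ e ((z + Real.pi * τ) :: xs) (PsiL Ψ) - g (z + Real.pi * τ) = _
    rw [Zc_add_pi_tau h2 e xs z hn, g3]
    ring
  · change rv τ (-2 * z) * (Zc τ e (-z :: xs) (PsiL Ψ) - g (-z)) = _
    rw [mul_sub, Zc_neg hτ (exch_PsiL h1), g4]
    ring
  · change Zc τ e (z :: xs) (PsiL Ψ) - g z = 0 ↔ _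
    rw [g5 z hz, sub_eq_zero, Claim]

lemma claim_of_zeros {τ : ℂ} (hτ : 0 < τ.im) {Ψ : PsiFam} (hΨ : PsiEntire Ψ) (h1 : PsiP1 τ Ψ)
    (h2 : PsiP2 τ Ψ) (h3 : PsiP3 τ Ψ) (e : Fin 2) {ζ ε : ℂ} {F : List ℂ → ℂ}
    (hF : IsCandidate ζ ε F) (xs l : List ℂ) (hl : 2 * (xs.length + 1) < l.length)
    (hp : ((Real.pi / 6 : ℂ) :: 2 * ηc :: l).Pairwise fun a b => ¬InLat τ (a - b))
    (hz : ∀ a ∈ l, rhoF τ a ≠ 0 ∧ Claim τ e Ψ F (a :: xs)) {z : ℂ} (hρ : rhoF τ z ≠ 0) :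
    Claim τ e Ψ F (z :: xs) := by
  obtain ⟨f, f1, f2, f3, f4, f5⟩ := exists_head_diff hτ hΨ h1 h2 h3 e hF xs rfl
  rw [← f5 z hρ]
  have h := eq_zero_of_theta_like hτ _ _ f1 (norm_one (α := ℂ)) (fun z => by rw [f2, one_mul]) f3
    (by simp only [List.length_cons]; omega) hp ?_
  · rw [h]; rfl
  have n2 := two_mul_im hτ
  have key : ∀ a, rv τ (-2 * a) = 0 → kap τ a ≠ 0 → f a = 0 := by
    intro a hr hk
    have := f4 a
    rw [hr, zero_mul, eq_comm, mul_eq_zero] at this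
    exact this.resolve_left hk
  intro a ha
  rcases List.mem_cons.1 ha with rfl | ha
  · refine key _ ?_ ?_
    · rw [rv_eq hτ, show -2 * ((Real.pi : ℂ) / 6) + ηc = 0 by rw [ηc]; ring, th1_zero]
      ring
    · rw [kap, show 2 * ηc - 2 * ((Real.pi : ℂ) / 6) = ηc by rw [ηc]; ring,
        show 2 * ((Real.pi : ℂ) / 6) + 2 * ηc = 0 + Real.pi by rw [ηc]; ring, th4_add_pi]
      exact mul_ne_zero (mul_ne_zero (th1_eta_ne n2) (th4_zero_ne n2)) (th4_zero_ne n2)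
  rcases List.mem_cons.1 ha with rfl | ha
  · refine key _ ?_ ?_
    · rw [rv_eq hτ, show -2 * (2 * ηc) + ηc = -(0 + Real.pi) by rw [ηc]; ring, th1_neg, th1_add_pi,
        th1_zero]
      ring
    · rw [kap, show 2 * ηc - 2 * (2 * ηc) = -(2 * ηc) by ring, th1_neg, th1_two_eta,
        show 2 * (2 * ηc) + 2 * ηc = 0 + Real.pi + Real.pi by rw [ηc]; ring, th4_add_pi, th4_add_pi]
      exact mul_ne_zero (mul_ne_zero (neg_ne_zero.2 (th1_eta_ne n2)) (th4_zero_ne n2))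
        (th4_zero_ne n2)
  · exact (f5 a (hz a ha).1).2 (hz a ha).2

lemma rhoF_β4 (τ : ℂ) : rhoF τ (β4c τ) =
    -exp (-(Real.pi * I * τ / 2) - 2 * I * ηc) * (th4 0 τ * th4 ηc τ) := by
  rw [rhoF, β4c, show ηc + Real.pi * τ / 2 - ηc = 0 + Real.pi * τ / 2 by ring,
    show ηc + Real.pi * τ / 2 + ηc = 2 * ηc + Real.pi * τ / 2 by ring, th1_add_quarter,
    th1_add_quarter, th4_two_eta]
  rw [show -(Real.pi * I * τ / 2) - 2 * I * ηc = (-(Real.pi * I * τ / 4) - I * 0) +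
    (-(Real.pi * I * τ / 4) - I * (2 * ηc)) by ring, exp_add]
  linear_combination exp (-(Real.pi * I * τ / 4) - I * 0) *
    exp (-(Real.pi * I * τ / 4) - I * (2 * ηc)) * th4 0 τ * th4 ηc τ * I_mul_I

lemma rhoF_β3 (τ : ℂ) : rhoF τ (β3c τ) =
    exp (-(Real.pi * I * τ / 2) - 2 * I * ηc) * (th3 0 τ * th3 ηc τ) := by
  rw [rhoF, β3c, show ηc + (Real.pi : ℂ) / 2 + Real.pi * τ / 2 - ηc = 0 + Real.pi / 2 + Real.pi * τ / 2
    by ring, show ηc + (Real.pi : ℂ) / 2 + Real.pi * τ / 2 + ηc = 2 * ηc + Real.pi / 2 + Real.pi * τ / 2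
    by ring, th1_add_quarter, th1_add_quarter, th4_add_half_pi, th4_add_half_pi, th3_two_eta]
  have : exp (-(Real.pi * I * τ / 4) - I * (0 + Real.pi / 2)) *
      exp (-(Real.pi * I * τ / 4) - I * (2 * ηc + Real.pi / 2)) =
      -exp (-(Real.pi * I * τ / 2) - 2 * I * ηc) := by
    rw [← exp_add, ← mul_neg_one (exp (_ - 2 * I * ηc)), ← exp_neg_pi_mul_I, ← exp_add]
    congr 1
    ring
  linear_combination I * I * th3 0 τ * th3 ηc τ * this -
    exp (-(Real.pi * I * τ / 2) - 2 * I * ηc) * (th3 0 τ * th3 ηc τ) * I_mul_I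

lemma rhoF_β4_ne {τ : ℂ} (hτ : 0 < τ.im) : rhoF τ (β4c τ) ≠ 0 := by
  rw [rhoF_β4]
  exact mul_ne_zero (neg_ne_zero.2 (exp_ne_zero _)) (mul_ne_zero (th4_zero_ne hτ) (th4_eta_ne hτ))

lemma th3_eta_ne {τ : ℂ} (hτ : 0 < τ.im) : th3 ηc τ ≠ 0 := by
  rw [th3_eta_eq hτ]
  exact mul_ne_zero (mul_ne_zero (pow_ne_zero _ (Cc_ne hτ)) (one_sub_zet_ne hτ)) (th3_zero_ne hτ)

lemma rhoF_β3_ne {τ : ℂ} (hτ : 0 < τ.im) : rhoF τ (β3c τ) ≠ 0 := by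
  rw [rhoF_β3]
  exact mul_ne_zero (exp_ne_zero _) (mul_ne_zero (th3_zero_ne hτ) (th3_eta_ne hτ))

lemma J4c_sub {τ : ℂ} (hτ : 0 < τ.im) {z : ℂ} (hz : rhoF τ z ≠ 0) :
    (J4c (zet τ) - wfun τ z) * rhoF τ z * (th4 0 τ * th4 ηc τ) =
      -(Cc τ * th1 ηc τ ^ 2 * (th4 (z - ηc) τ * th4 (z + ηc) τ)) := by
  have nb := rhoF_β4_ne hτ
  have ne : exp (-(Real.pi * I * τ / 2) - 2 * I * ηc) ≠ 0 := exp_ne_zero _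
  have h := wfun_sub hτ nb hz
  rw [wfun_β4 hτ, eq_div_iff (mul_ne_zero nb hz), rhoF_β4] at h
  have p : th1 (β4c τ - z) τ * th1 (β4c τ + z) τ =
      -exp (-(Real.pi * I * τ / 2) - 2 * I * ηc) * (th4 (z - ηc) τ * th4 (z + ηc) τ) := by
    rw [β4c, show ηc + Real.pi * τ / 2 - z = -(z - ηc) + Real.pi * τ / 2 by ring,
      show ηc + Real.pi * τ / 2 + z = (z + ηc) + Real.pi * τ / 2 by ring, th1_add_quarter,
      th1_add_quarter, th4_neg]
    rw [show -(Real.pi * I * τ / 2) - 2 * I * ηc = (-(Real.pi * I * τ / 4) - I * -(z - ηc)) +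
      (-(Real.pi * I * τ / 4) - I * (z + ηc)) by ring, exp_add]
    linear_combination exp (-(Real.pi * I * τ / 4) - I * -(z - ηc)) *
      exp (-(Real.pi * I * τ / 4) - I * (z + ηc)) * th4 (z - ηc) τ * th4 (z + ηc) τ * I_mul_I
  rw [p] at h
  refine mul_left_cancel₀ ne ?_
  linear_combination -h

lemma J3c_sub {τ : ℂ} (hτ : 0 < τ.im) {z : ℂ} (hz : rhoF τ z ≠ 0) :
    (J3c (zet τ) - wfun τ z) * rhoF τ z * (th3 0 τ * th3 ηc τ) =
      -(Cc τ * th1 ηc τ ^ 2 * (th3 (z - ηc) τ * th3 (z + ηc) τ)) := by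
  have nb := rhoF_β3_ne hτ
  have ne : exp (-(Real.pi * I * τ / 2) - 2 * I * ηc) ≠ 0 := exp_ne_zero _
  have h := wfun_sub hτ nb hz
  rw [wfun_β3 hτ, eq_div_iff (mul_ne_zero nb hz), rhoF_β3] at h
  have p : th1 (β3c τ - z) τ * th1 (β3c τ + z) τ =
      exp (-(Real.pi * I * τ / 2) - 2 * I * ηc) * (th3 (z - ηc) τ * th3 (z + ηc) τ) := by
    rw [β3c, show ηc + (Real.pi : ℂ) / 2 + Real.pi * τ / 2 - z =
      -(z - ηc) + Real.pi / 2 + Real.pi * τ / 2 by ring,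
      show ηc + (Real.pi : ℂ) / 2 + Real.pi * τ / 2 + z = (z + ηc) + Real.pi / 2 + Real.pi * τ / 2
      by ring, th1_add_quarter, th1_add_quarter, th4_add_half_pi, th4_add_half_pi, th3_neg]
    have : exp (-(Real.pi * I * τ / 4) - I * (-(z - ηc) + Real.pi / 2)) *
        exp (-(Real.pi * I * τ / 4) - I * (z + ηc + Real.pi / 2)) =
        -exp (-(Real.pi * I * τ / 2) - 2 * I * ηc) := by
      rw [← exp_add, ← mul_neg_one (exp (_ - 2 * I * ηc)), ← exp_neg_pi_mul_I, ← exp_add]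
      congr 1
      ring
    linear_combination I * I * th3 (z - ηc) τ * th3 (z + ηc) τ * this -
      exp (-(Real.pi * I * τ / 2) - 2 * I * ηc) * (th3 (z - ηc) τ * th3 (z + ηc) τ) * I_mul_I
  rw [p] at h
  refine mul_left_cancel₀ ne ?_
  linear_combination h

lemma th4_mul_th3_self {τ : ℂ} (hτ : 0 < τ.im) (x : ℂ) :
    th4 x τ * th3 x τ = th4 (2 * x) (2 * τ) * th4 0 (2 * τ) := by
  rw [th4_mul_th3 hτ, sub_self, th1_zero, ← two_mul]
  ring

lemma J3c_sub_mul_J4c_sub {τ : ℂ} (hτ : 0 < τ.im) {x : ℂ} (hx : rhoF τ (x - ηc) ≠ 0) :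
    rhoF τ (x - ηc) ^ 2 * ((J3c (zet τ) - wfun τ (x - ηc)) * (J4c (zet τ) - wfun τ (x - ηc))) *
      th4 0 (2 * τ) ^ 2 =
      Cc τ * th1 ηc τ ^ 4 * (th4 (2 * x) (2 * τ) * th4 (2 * x + 2 * ηc) (2 * τ)) := by
  have a := J3c_sub hτ hx
  have b := J4c_sub hτ hx
  rw [sub_sub, ← two_mul, sub_add_cancel] at a b
  have c := th4_mul_th3_self hτ x
  have d := th4_mul_th3_self hτ (x - 2 * ηc)
  have f := th4_mul_th3_self hτ ηc
  have g := th4_mul_th3_self hτ 0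
  rw [mul_zero] at g
  have n0 := th4_zero_ne (two_mul_im hτ)
  have nC := Cc_ne hτ
  rw [th4_two_eta, show th4 ηc (2 * τ) = Cc τ * th4 0 (2 * τ) by rw [Cc]; field_simp] at f
  have e : th4 (2 * (x - 2 * ηc)) (2 * τ) = th4 (2 * x + 2 * ηc) (2 * τ) := by
    rw [show 2 * x + 2 * ηc = 2 * (x - 2 * ηc) + Real.pi + Real.pi by rw [ηc]; ring, th4_add_pi,
      th4_add_pi]
  rw [e] at d
  refine mul_left_cancel₀ (mul_ne_zero nC (pow_ne_zero 2 n0)) ?_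
  have ab := congrArg₂ (· * ·) a b
  have L : (J3c (zet τ) - wfun τ (x - ηc)) * rhoF τ (x - ηc) * (th3 0 τ * th3 ηc τ) *
      ((J4c (zet τ) - wfun τ (x - ηc)) * rhoF τ (x - ηc) * (th4 0 τ * th4 ηc τ)) =
      (J3c (zet τ) - wfun τ (x - ηc)) * (J4c (zet τ) - wfun τ (x - ηc)) * rhoF τ (x - ηc) ^ 2 *
      ((th4 0 τ * th3 0 τ) * (th4 ηc τ * th3 ηc τ)) := by ring
  have R : -(Cc τ * th1 ηc τ ^ 2 * (th3 (x - 2 * ηc) τ * th3 x τ)) *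
      -(Cc τ * th1 ηc τ ^ 2 * (th4 (x - 2 * ηc) τ * th4 x τ)) =
      Cc τ ^ 2 * th1 ηc τ ^ 4 * ((th4 (x - 2 * ηc) τ * th3 (x - 2 * ηc) τ) * (th4 x τ * th3 x τ)) := by
    ring
  rw [L, R, c, d, f, g] at ab
  linear_combination ab

lemma Aw_mul_Dw {τ : ℂ} (hτ : 0 < τ.im) (x : ℂ) :
    4 * (Aw τ x * Dw τ x) = th2 0 τ ^ 2 * rhoF τ (x - ηc) := by
  have a := th1_double hτ x
  have b := th1_double hτ (x - 2 * ηc)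
  rw [rhoF, sub_sub, ← two_mul, sub_add_cancel, Aw, Dw]
  linear_combination -(th2 0 τ * th1 (x - 2 * ηc) τ) * a - 2 * (th1 x (2 * τ) * th4 x (2 * τ)) * b

lemma rhoF_mul_rhoF_add_eta (τ x : ℂ) :
    rhoF τ x * rhoF τ (x + ηc) = rhoF τ (x - ηc) * th1 (x - ηc) τ ^ 2 := by
  rw [rhoF_add_eta, rhoF_sub_eta, rhoF]
  ring

lemma contr_contr_scalar {τ : ℂ} (hτ : 0 < τ.im) {x : ℂ} (hx : rhoF τ (x - ηc) ≠ 0) :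
    Aw τ x * Dw τ x * (th1 (-x - x - 2 * ηc) τ * th1 (-2 * x) τ) * (Cc τ * th1 ηc τ ^ 4) =
      -(th4 0 (2 * τ) ^ 2 * thR τ x * thR τ (-x + 2 * ηc) * rhoF τ (x - ηc) ^ 3 *
        ((J3c (zet τ) - wfun τ (x - ηc)) * (J4c (zet τ) - wfun τ (x - ηc)))) := by
  have h := J3c_sub_mul_J4c_sub hτ hx
  have a := Aw_mul_Dw hτ x
  have b := th1_double hτ (2 * x)
  have c := th1_double hτ (2 * x + 2 * ηc)
  have n := th2_zero_ne hτ
  have e1 : th1 (2 * x + 2 * ηc) (2 * τ) = thR τ x := by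
    rw [th1_add_two_eta, ← th1_neg, thR]; congr 1; ring
  have e2 : th1 (2 * x) (2 * τ) = -thR τ (-x + 2 * ηc) := by
    rw [thR, ← th1_add_pi, ← three_ηc]; congr 1; ring
  rw [show -x - x - 2 * ηc = -(2 * x + 2 * ηc) by ring, show -2 * x = -(2 * x) by ring, th1_neg,
    th1_neg]
  rw [e1] at c
  rw [e2] at b
  refine mul_left_cancel₀ (mul_ne_zero (show (4 : ℂ) ≠ 0 by norm_num) (pow_ne_zero 2 n)) ?_
  have bc : th2 0 τ ^ 2 * (th1 (2 * x) τ * th1 (2 * x + 2 * ηc) τ) =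
      -4 * (thR τ x * thR τ (-x + 2 * ηc)) *
      (th4 (2 * x) (2 * τ) * th4 (2 * x + 2 * ηc) (2 * τ)) := by
    linear_combination th2 0 τ * th1 (2 * x + 2 * ηc) τ * b +
      2 * (-thR τ (-x + 2 * ηc) * th4 (2 * x) (2 * τ)) * c
  linear_combination th2 0 τ ^ 2 * (th1 (2 * x) τ * th1 (2 * x + 2 * ηc) τ) *
    (Cc τ * th1 ηc τ ^ 4) * a + th2 0 τ ^ 2 * rhoF τ (x - ηc) * (Cc τ * th1 ηc τ ^ 4) * bc +
    4 * th2 0 τ ^ 2 * rhoF τ (x - ηc) * (thR τ x * thR τ (-x + 2 * ηc)) * h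

lemma map_sub_prod_eq {τ : ℂ} (hτ : 0 < τ.im) {X : ℂ} (hX : rhoF τ X ≠ 0) (zs : List ℂ)
    (hz : ∀ z ∈ zs, rhoF τ z ≠ 0) :
    (Cc τ * th1 ηc τ ^ 2) ^ zs.length * (zs.map fun z => th1 (X + z) τ * th1 (X - z) τ).prod =
      ((zs.map (wfun τ)).map fun w => w - wfun τ X).prod * (zs.map (rhoF τ)).prod *
        rhoF τ X ^ zs.length := by
  induction zs with
  | nil => simp
  | cons z zs ih =>
    have i := ih fun y hy => hz y (List.mem_cons_of_mem _ hy)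
    have nz := hz z List.mem_cons_self
    have h := wfun_sub hτ nz hX
    rw [eq_div_iff (mul_ne_zero nz hX), show z - X = -(X - z) by ring, th1_neg, add_comm z X] at h
    simp only [List.map_cons, List.prod_cons, List.length_cons, pow_succ]
    linear_combination (Cc τ * th1 ηc τ ^ 2) * (th1 (X + z) τ * th1 (X - z) τ) * i -
      ((zs.map (wfun τ)).map fun w => w - wfun τ X).prod * (zs.map (rhoF τ)).prod *
        rhoF τ X ^ zs.length * h

lemma prod_thR_rhoF (τ : ℂ) (zs : List ℂ) (m : ℕ) :
    (zs.map fun z => thR τ z * rhoF τ z ^ (m + 2)).prod =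
      (zs.map fun z => thR τ z * rhoF τ z ^ m).prod * (zs.map (rhoF τ)).prod ^ 2 := by
  induction zs with
  | nil => simp
  | cons z zs ih =>
    simp only [List.map_cons, List.prod_cons, ih]
    ring

lemma claim_two_step {τ : ℂ} (hτ : 0 < τ.im) {Ψ : PsiFam} (h1 : PsiP1 τ Ψ) (h5 : PsiP5 τ Ψ)
    {e : Fin 2} {ε : ℂ} {F : List ℂ → ℂ} (hF : IsCandidate (zet τ) ε F) {x : ℂ} (hx : x ∉ ratS τ)
    {zs : List ℂ} (hz : ∀ z ∈ zs, rhoF τ z ≠ 0) (h : Claim τ e Ψ F zs) :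
    Claim τ e Ψ F (x :: (-x + 2 * ηc) :: zs) := by
  have hxm : x - ηc ∉ ratS τ := fun a => hx (by
    convert add_mem a (eta_mem_ratS τ) using 1; ring)
  have hxp : x + ηc ∉ ratS τ := fun a => hx (by
    convert sub_mem a (eta_mem_ratS τ) using 1; ring)
  have t0 := th1_ne_of_ratS hτ hx
  have tp := th1_ne_of_ratS hτ hxp
  have tm := th1_ne_of_ratS hτ hxm
  have nX := rhoF_ne_of_ratS hτ hxm
  have nC := Cc_ne hτ
  have nη := th1_eta_ne hτ
  have nζ := zet_ne hτ
  have nt := one_sub_zet_sq_ne hτ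
  have cube := Cc_cube hτ
  have hs := wfun_sum hτ t0 tp tm
  have hp := wfun_prod hτ t0 tp tm
  have hr := hF.recurrence (zs.map (wfun τ)) hs hp
  have hy : wfun τ (-x + 2 * ηc) = wfun τ (x + ηc) := by
    rw [wfun_add_two_eta, ← wfun_neg]; congr 1; ring
  have hρy : rhoF τ (-x + 2 * ηc) = rhoF τ (x + ηc) := by
    rw [← rhoF_neg, ← rhoF_add_pi, ← three_ηc]; congr 1; ring
  have hprod := map_sub_prod_eq hτ nX zs hz
  have hsc := contr_contr_scalar hτ nX
  have hρ := rhoF_mul_rhoF_add_eta τ x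
  have hw : wfun τ (x - ηc) * rhoF τ (x - ηc) = Cc τ * th1 (x - ηc) τ ^ 2 := by
    rw [wfun_eq]; field_simp
  have nc : wfun τ (x - ηc) ≠ 0 := by
    rw [wfun_eq]; exact div_ne_zero (mul_ne_zero nC (pow_ne_zero _ tm)) nX
  rw [Claim, Zc, Zc, Zc_factor τ e zs _ fun αs _ => contr_contr hτ h1 h5 e x (inter zs) αs, h, Rhs,
    Rhs]
  have q1 : ((inter zs).map fun u => th1 (-x - u - 2 * ηc) τ).prod =
      (zs.map fun z => th1 (x - ηc + z) τ * th1 (x - ηc - z) τ).prod * th1 (x - ηc) τ := by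
    rw [prod_map_inter]
    congr 1
    · congr 1
      refine List.map_congr_left fun z _ => ?_
      rw [th1_sub_two_eta, th1_sub_two_eta, neg_mul_neg, ← neg_mul_neg, ← th1_neg, ← th1_neg]
      congr 2 <;> ring
    · rw [th1_sub_two_eta, ← th1_neg]; congr 1; ring
  have q2 : ((inter zs).map fun u => th1 (x - 2 * ηc - u - 2 * ηc) τ).prod =
      -((zs.map fun z => th1 (x - ηc + z) τ * th1 (x - ηc - z) τ).prod * th1 (x - ηc) τ) := by
    have k : ∀ u, th1 (x - 2 * ηc - u - 2 * ηc) τ = -th1 (x - ηc - u) τ := by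
      intro u
      rw [th1_sub_two_eta]; congr 2; ring
    simp only [k]
    rw [prod_map_inter, ← mul_neg]
    congr 1
    · congr 1
      refine List.map_congr_left fun z _ => ?_
      rw [neg_mul_neg, mul_comm, sub_neg_eq_add]
    · rw [sub_zero]
  rw [q1, q2, List.map_cons, List.map_cons, List.map_cons, List.map_cons, hy, hr, List.prod_cons,
    List.prod_cons, hρy, List.length_cons, List.length_cons, List.length_map]
  generalize hm : zs.length = m at *
  change _ = Kc τ (m + 2) * _ * _
  rw [show (zs.map fun z => thR τ z * rhoF τ z ^ (m + 1 + 1)) =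
    zs.map fun z => thR τ z * rhoF τ z ^ (m + 2) from rfl, prod_thR_rhoF, Kc]
  generalize (zs.map fun z => th1 (x - ηc + z) τ * th1 (x - ηc - z) τ).prod = P at *
  generalize ((zs.map (wfun τ)).map fun w => w - wfun τ (x - ηc)).prod = Q at *
  generalize (zs.map (rhoF τ)).prod = R at *
  generalize (zs.map fun z => thR τ z * rhoF τ z ^ m).prod = T
  generalize F (zs.map (wfun τ)) = f
  generalize Kc τ m = K
  generalize Aw τ x * Dw τ x * (th1 (-x - x - 2 * ηc) τ * th1 (-2 * x) τ) = G at *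
  generalize J3c (zet τ) - wfun τ (x - ηc) = j3 at *
  generalize J4c (zet τ) - wfun τ (x - ηc) = j4 at *
  generalize thR τ x = r1 at *
  generalize thR τ (-x + 2 * ηc) = r2 at *
  have hbase : rhoF τ x * rhoF τ (x + ηc) * ((1 - zet τ ^ 2) / wfun τ (x - ηc)) * Cc τ ^ 4 =
      rhoF τ (x - ηc) ^ 2 := by
    rw [hρ]
    field_simp
    linear_combination (th1 (x - ηc) τ ^ 2 * Cc τ) * cube - hw
  have hpow : (rhoF τ x * rhoF τ (x + ηc) * ((1 - zet τ ^ 2) / wfun τ (x - ηc)) * Cc τ ^ 4) ^ (m + 1) =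
      (rhoF τ (x - ηc) ^ 2) ^ (m + 1) := by rw [hbase]
  generalize (1 - zet τ ^ 2) / wfun τ (x - ηc) = tc at *
  generalize rhoF τ (x + ηc) = ρy at *
  generalize rhoF τ x = ρx at *
  generalize rhoF τ (x - ηc) = ρX at *
  generalize th1 (x - ηc) τ = tX at *
  generalize Cc τ = C at *
  generalize th1 ηc τ = θ at *
  generalize th4 0 (2 * τ) = Θ at *
  generalize zet τ = ζ at *
  have hP : C ^ (2 * m) * θ ^ (4 * m) * P ^ 2 = Q ^ 2 * R ^ 2 * ρX ^ (2 * m) := by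
    have := congrArg (· ^ 2) hprod
    change ((C * θ ^ 2) ^ m * P) ^ 2 = (Q * R * ρX ^ m) ^ 2 at this
    calc _ = ((C * θ ^ 2) ^ m * P) ^ 2 := by ring
      _ = _ := this
      _ = _ := by ring
  have hS : (ρx * ρy) ^ (m + 1) * tc ^ (m + 1) * C ^ (4 * m + 4) = ρX ^ (2 * m + 2) := by
    calc _ = (ρx * ρy * tc * C ^ 4) ^ (m + 1) := by ring
      _ = _ := hpow
      _ = _ := by ring
  have n1 : C * θ ^ 4 * (C ^ (2 * m) * θ ^ (4 * m)) ≠ 0 :=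
    mul_ne_zero (mul_ne_zero nC (pow_ne_zero _ nη))
      (mul_ne_zero (pow_ne_zero _ nC) (pow_ne_zero _ nη))
  have hD : C ^ (2 * m + 3) * Θ ^ 2 / (ζ * θ ^ (4 * m + 4)) * ζ *
      (C * θ ^ 4 * (C ^ (2 * m) * θ ^ (4 * m))) = C ^ (4 * m + 4) * Θ ^ 2 := by
    rw [show C * θ ^ 4 * (C ^ (2 * m) * θ ^ (4 * m)) = C ^ (2 * m + 1) * θ ^ (4 * m + 4) by ring]
    have := pow_ne_zero (4 * m + 4) nη
    field_simp
    ring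
  refine mul_left_cancel₀ n1 ?_
  generalize C ^ (2 * m + 3) * Θ ^ 2 / (ζ * θ ^ (4 * m + 4)) = D at *
  calc _ = (G * (C * θ ^ 4)) * (C ^ (2 * m) * θ ^ (4 * m) * P ^ 2) * tX ^ 2 * (K * T * f) := by ring
    _ = -(Θ ^ 2 * r1 * r2 * j3 * j4 * Q ^ 2 * R ^ 2 * K * T * f) * (ρX * tX ^ 2) *
        ρX ^ (2 * m + 2) := by rw [hsc, hP]; ring
    _ = -(Θ ^ 2 * r1 * r2 * j3 * j4 * Q ^ 2 * R ^ 2 * K * T * f) * (ρx * ρy) *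
        ((ρx * ρy) ^ (m + 1) * tc ^ (m + 1) * C ^ (4 * m + 4)) := by rw [hS, hρ]
    _ = -(C ^ (4 * m + 4) * Θ ^ 2) * (r1 * r2 * j3 * j4 * Q ^ 2 * R ^ 2 * K * T * f) * (ρx * ρy) *
        ((ρx * ρy) ^ (m + 1) * tc ^ (m + 1)) := by ring
    _ = _ := by
      rw [← hD]
      ring

lemma th2_two_eta (τ : ℂ) : th2 (2 * ηc) τ = -th2 ηc τ := by
  rw [← th2_neg, ← neg_neg (th2 (-(2 * ηc)) τ), ← th2_add_pi, ← three_ηc]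
  congr 2; ring

lemma Dw_zero (τ : ℂ) : Dw τ 0 = th4 0 (2 * τ) * th4 ηc (2 * τ) := by
  rw [Dw, zero_sub, th4_neg, th4_two_eta]

lemma th1_eta_mul_th2_eta {τ : ℂ} (hτ : 0 < τ.im) :
    th1 ηc τ * th2 ηc τ = th1 ηc (2 * τ) * th4 0 (2 * τ) := by
  rw [th1_mul_th2 hτ ηc ηc, sub_self, th1_zero, mul_zero, add_zero, ← two_mul, th1_two_eta]

lemma th2_eta_eq {τ : ℂ} (hτ : 0 < τ.im) : th2 ηc τ = Kc τ 1 * th4 0 (2 * τ) * zet τ := by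
  have a := th1_eta_mul_th2_eta hτ
  have n1 := th1_eta_ne hτ
  have n2 := th1_eta_ne (two_mul_im hτ)
  have n3 := th4_eta_ne (two_mul_im hτ)
  have n4 := th4_zero_ne (two_mul_im hτ)
  rw [Kc, Dw_zero, zet, Cc]
  field_simp
  linear_combination a

lemma Kc_one_mul {τ : ℂ} (hτ : 0 < τ.im) :
    Kc τ 1 * th2 ηc τ * th1 ηc τ ^ 2 = Cc τ ^ 2 * th4 0 (2 * τ) ^ 3 := by
  have a := th1_eta_mul_th2_eta hτ
  have n1 := th1_eta_ne hτ
  have n2 := th1_eta_ne (two_mul_im hτ)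
  have n4 := th4_zero_ne (two_mul_im hτ)
  rw [Kc, Dw_zero, Cc]
  field_simp
  linear_combination th4 ηc (2 * τ) ^ 2 * a

/-- The spin label of the contraction is compatible with the sign in a candidate. -/
def SignCompat (τ : ℂ) (e : Fin 2) (ε : ℂ) : Prop :=
  ∀ x, Kw τ e 0 x - Kw τ e 1 x = -ε * (Dw τ x - Aw τ x)

lemma signCompat_one (τ : ℂ) : SignCompat τ 1 1 := fun x => by
  simp [Kw]

lemma signCompat_zero (τ : ℂ) : SignCompat τ 0 (-1) := fun x => by
  simp [Kw]

lemma Kw_add (τ : ℂ) (e : Fin 2) (x : ℂ) : Kw τ e 0 x + Kw τ e 1 x = Dw τ x + Aw τ x := by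
  fin_cases e <;> simp [Kw, add_comm]

/-- `e^{-iπτ/4}`. -/
def qE (τ : ℂ) : ℂ := exp (-(Real.pi * I * τ / 4))

/-- `e^{-iη}`. -/
def hE : ℂ := exp (-(I * ηc))

lemma hE_cube : hE ^ 3 = -1 := by
  have := exp_eta
  rw [hE, exp_neg, inv_pow, this]
  norm_num

lemma exp_eq_qE_hE (τ : ℂ) (m k : ℤ) {z : ℂ} (hz : z = -(m * (Real.pi * I * τ / 4)) - k * (I * ηc)) :
    exp z = qE τ ^ m * hE ^ k := by
  rw [qE, hE, ← exp_int_mul, ← exp_int_mul, ← exp_add, hz]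
  congr 1; ring

lemma qE_ne (τ : ℂ) : qE τ ≠ 0 := exp_ne_zero _
lemma hE_ne : hE ≠ 0 := exp_ne_zero _

lemma th1_quarter (τ y : ℂ) : th1 (y + Real.pi * τ / 2) τ = I * qE τ * exp (-(I * y)) * th4 y τ := by
  rw [th1_add_quarter, sub_eq_add_neg, exp_add, qE]
  ring

lemma pnome_mul_qE (τ : ℂ) : pnome τ * qE τ ^ 4 = 1 := by
  rw [pnome, qE, ← exp_nat_mul, ← exp_add, ← exp_zero]
  congr 1; push_cast; ring

lemma th1_neg_β4_sub (τ u : ℂ) : th1 (-β4c τ - u - 2 * ηc) τ = th1 (u + Real.pi * τ / 2) τ := by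
  rw [show -β4c τ - u - 2 * ηc = -(u + Real.pi * τ / 2 + Real.pi) by rw [β4c, ← three_ηc]; ring,
    th1_neg, th1_add_pi, neg_neg]

lemma thR_neg_β4 (τ : ℂ) : thR τ (-β4c τ) = -I * qE τ ^ 2 * th4 0 (2 * τ) := by
  rw [thR, show ηc - 2 * -β4c τ = 0 + Real.pi * τ + Real.pi by rw [β4c, ← three_ηc]; ring,
    th1_add_pi, th1_add_half, exp_eq_qE_hE τ 2 0 (by push_cast; ring)]
  simp

lemma rhoF_neg_β4 (τ : ℂ) : rhoF τ (-β4c τ) = -(qE τ ^ 2 * hE ^ 2 * (th4 0 τ * th4 ηc τ)) := by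
  rw [rhoF_neg, rhoF_β4, exp_eq_qE_hE τ 2 2 (by push_cast; ring)]
  norm_cast
  ring

lemma Kw_diff_neg_β4 {τ : ℂ} (hτ : 0 < τ.im) {e : Fin 2} {ε : ℂ} (he : SignCompat τ e ε) :
    Kw τ e 0 (-β4c τ) - Kw τ e 1 (-β4c τ) = ε * (th4 ηc τ * qE τ * hE ^ 2 * th2 ηc τ) := by
  rw [he, Dw_sub_Aw hτ, show -β4c τ - ηc = -(2 * ηc + Real.pi * τ / 2) by rw [β4c]; ring, th3_neg,
    th3_add_quarter, th2_two_eta, exp_eq_qE_hE τ 1 2 (by push_cast; ring)]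
  norm_cast
  ring

lemma thR_neg_β3 (τ : ℂ) : thR τ (-β3c τ) = I * qE τ ^ 2 * th4 0 (2 * τ) := by
  rw [thR, show ηc - 2 * -β3c τ = 0 + Real.pi * τ + Real.pi + Real.pi by
    rw [β3c, ← three_ηc]; ring,
    th1_add_pi, th1_add_pi, th1_add_half, exp_eq_qE_hE τ 2 0 (by push_cast; ring)]
  simp

lemma rhoF_neg_β3 (τ : ℂ) : rhoF τ (-β3c τ) = qE τ ^ 2 * hE ^ 2 * (th3 0 τ * th3 ηc τ) := by
  rw [rhoF_neg, rhoF_β3, exp_eq_qE_hE τ 2 2 (by push_cast; ring)]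
  norm_cast

lemma exp_half_pi : exp (-(I * (Real.pi / 2))) = -I := by
  rw [exp_neg, show I * (Real.pi / 2) = Real.pi / 2 * I by ring, exp_pi_div_two_mul_I, inv_I]

lemma Kw_sum_neg_β3 {τ : ℂ} (hτ : 0 < τ.im) (e : Fin 2) :
    Kw τ e 0 (-β3c τ) + Kw τ e 1 (-β3c τ) = -(qE τ * hE ^ 2 * th2 ηc τ * th3 ηc τ) := by
  rw [Kw_add, Dw_add_Aw hτ, show -β3c τ - ηc =
    -(2 * ηc + Real.pi * τ / 2 + Real.pi / 2) by rw [β3c]; ring, th4_neg, th4_add_half_pi,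
    th3_add_quarter, th2_two_eta, exp_eq_qE_hE τ 1 2 (by push_cast; ring)]
  norm_cast
  ring

lemma th1_neg_β3_sub (τ : ℂ) : th1 (-β3c τ - 0 - 2 * ηc) τ = qE τ * th3 0 τ := by
  rw [show -β3c τ - 0 - 2 * ηc = -(0 + Real.pi / 2 + Real.pi * τ / 2 + Real.pi) by
    rw [β3c, ← three_ηc]; ring, th1_neg, th1_add_pi, neg_neg, th1_quarter, th4_add_half_pi, zero_add,
    exp_half_pi]
  linear_combination -(qE τ * th3 0 τ) * I_sq

section
variable {τ : ℂ} {Ψ : PsiFam} {e : Fin 2} {ε : ℂ} {F : List ℂ → ℂ}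

lemma PsiL_singleton (h6 : PsiP6 Ψ) (u : ℂ) (s : Fin 2) : PsiL Ψ [u] [s] = 1 := by
  rw [PsiL_eq Ψ (n := 0) rfl, h6]

lemma claim_nil (h6 : PsiP6 Ψ) (hF : IsCandidate (zet τ) ε F) : Claim τ e Ψ F [] := by
  simp [Claim, Zc, Rhs, PsiL_singleton h6, hF.nil, Kc]

lemma claim_neg_β4 (hτ : 0 < τ.im) (h2 : PsiP2 τ Ψ) (h5 : PsiP5 τ Ψ) (h6 : PsiP6 Ψ)
    (he : SignCompat τ e ε) (hF : IsCandidate (zet τ) ε F) : Claim τ e Ψ F [-β4c τ] := by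
  have h := contr_neg_β4 h2 h5 e [0] [1] (n := 1) rfl
  rw [Kw_diff_neg_β4 hτ he, PsiL_singleton h6] at h
  have q := pnome_mul_qE τ
  have h3 := hE_cube
  have hx : exp (-I * (-β4c τ + [(0 : ℂ)].sum - 2 * (1 : ℕ) * (-β4c τ + 2 * ηc))) = -qE τ ^ 2 := by
    rw [exp_eq_qE_hE τ 2 (-3) (by rw [β4c]; push_cast; simp; ring)]
    rw [zpow_neg]
    norm_cast
    rw [h3]
    norm_num
  rw [hx] at h
  simp only [List.map_cons, List.map_nil, List.prod_cons, List.prod_nil, th1_neg_β4_sub,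
    th1_quarter, mul_zero, neg_zero, exp_zero] at h
  rw [Claim, Zc, Zc, Rhs]
  simp only [List.length_singleton, List.map_cons, List.map_nil, List.prod_cons, List.prod_nil,
    wfun_neg, wfun_β4 hτ, hF.J4, thR_neg_β4, rhoF_neg_β4]
  have k := th2_eta_eq hτ
  linear_combination qE τ ^ 2 * h - contr τ e (-β4c τ) (PsiL Ψ) [0] [1] * q +
    qE τ ^ 4 * hE ^ 2 * I * th4 0 τ * th4 ηc τ * ε * k

lemma claim_neg_β3 (hτ : 0 < τ.im) (h2 : PsiP2 τ Ψ) (h3 : PsiP3 τ Ψ) (h5 : PsiP5 τ Ψ)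
    (h6 : PsiP6 Ψ) (hF : IsCandidate (zet τ) ε F) : Claim τ e Ψ F [-β3c τ] := by
  have h := contr_neg_β3 h2 h3 h5 e [0] [1] rfl (n := 1) rfl
  rw [Kw_sum_neg_β3 hτ, PsiL_singleton h6] at h
  have q := pnome_mul_qE τ
  have h3 := hE_cube
  have hx : exp (-I * (-β3c τ + [(0 : ℂ)].sum - 2 * (1 : ℕ) * (-β3c τ + 2 * ηc))) =
      I * qE τ ^ 2 := by
    rw [show -I * (-β3c τ + [(0 : ℂ)].sum - 2 * (1 : ℕ) * (-β3c τ + 2 * ηc)) =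
      (-(2 * (Real.pi * I * τ / 4)) + 3 * (I * ηc)) + -(I * (Real.pi / 2)) by
        rw [β3c]; push_cast; simp; ring, exp_add, exp_half_pi,
      exp_eq_qE_hE τ 2 (-3) (by push_cast; ring), zpow_neg]
    norm_cast
    rw [h3]
    ring
  rw [hx] at h
  simp only [List.map_cons, List.map_nil, List.prod_cons, List.prod_nil, th1_neg_β3_sub, sgnS,
    one_ne_zero, if_false] at h
  rw [Claim, Zc, Zc, Rhs]
  simp only [List.length_singleton, List.map_cons, List.map_nil, List.prod_cons, List.prod_nil,
    wfun_neg, wfun_β3 hτ, hF.J3, thR_neg_β3, rhoF_neg_β3]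
  have k := th2_eta_eq hτ
  linear_combination I * qE τ ^ 2 * h - contr τ e (-β3c τ) (PsiL Ψ) [0] [1] * q +
    contr τ e (-β3c τ) (PsiL Ψ) [0] [1] * pnome τ * qE τ ^ 4 * I_sq +
    qE τ ^ 4 * hE ^ 2 * I * th3 0 τ * th3 ηc τ * k

lemma wfun_sub_half_period (hτ : 0 < τ.im) {y : ℂ} (hy : rhoF τ y ≠ 0) :
    (wfun τ y - (1 - zet τ) / (1 + zet τ)) * (rhoF τ y * th4 ηc τ ^ 2) =
      Cc τ * th1 ηc τ ^ 2 * th4 y τ ^ 2 := by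
  have r : rhoF τ (Real.pi * τ / 2) = -(qE τ ^ 2 * th4 ηc τ ^ 2) := by
    rw [rhoF, show Real.pi * τ / 2 - ηc = -ηc + Real.pi * τ / 2 by ring,
      show Real.pi * τ / 2 + ηc = ηc + Real.pi * τ / 2 by ring, th1_quarter, th1_quarter, th4_neg,
      show -(I * -ηc) = I * ηc by ring, exp_neg (I * ηc)]
    have := exp_ne_zero (I * ηc)
    field_simp
    linear_combination qE τ ^ 2 * th4 ηc τ ^ 2 * I_sq
  have nq := qE_ne τ
  have nr : rhoF τ (Real.pi * τ / 2) ≠ 0 := by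
    rw [r]
    exact neg_ne_zero.2 (mul_ne_zero (pow_ne_zero _ nq) (pow_ne_zero _ (th4_eta_ne hτ)))
  have h := wfun_sub hτ hy nr
  rw [wfun_half_period hτ, eq_div_iff (mul_ne_zero hy nr), r,
    show y - Real.pi * τ / 2 = -(-y + Real.pi * τ / 2) by ring, th1_neg, th1_quarter, th1_quarter,
    th4_neg, show -(I * -y) = I * y by ring, exp_neg (I * y)] at h
  have := exp_ne_zero (I * y)
  field_simp at h
  rw [I_sq] at h
  linear_combination -h

lemma claim_neg_β4_cons (hτ : 0 < τ.im) (h2 : PsiP2 τ Ψ) (h5 : PsiP5 τ Ψ)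
    (he : SignCompat τ e ε) (hF : IsCandidate (zet τ) ε F) {y : ℂ} (hy : rhoF τ y ≠ 0)
    (h : Claim τ e Ψ F [y]) : Claim τ e Ψ F [-β4c τ, y] := by
  have q := pnome_mul_qE τ
  have h3 := hE_cube
  have nh := hE_ne
  have hx : exp (-I * (-β4c τ + (inter [y]).sum - 2 * (2 : ℕ) * (-β4c τ + 2 * ηc))) =
      qE τ ^ 6 * hE := by
    rw [exp_eq_qE_hE τ 6 (-5) (by rw [β4c, sum_inter]; push_cast; ring)]
    rw [zpow_neg]
    norm_cast
    field_simp
    linear_combination qE τ ^ 6 * (1 - hE ^ 3) * h3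
  have hprod : ((inter [y]).map fun u => th1 (-β4c τ - u - 2 * ηc) τ).prod =
      -(qE τ ^ 3 * I * th4 y τ ^ 2 * th4 0 τ) := by
    rw [prod_map_inter]
    simp only [th1_neg_β4_sub, th1_quarter, List.map_cons, List.map_nil, List.prod_cons,
      List.prod_nil, mul_neg, neg_neg, mul_zero, neg_zero, exp_zero, exp_neg (I * y), th4_neg]
    have := exp_ne_zero (I * y)
    field_simp
    rw [I_sq]
    ring
  have key : Zc τ e [y] (contr τ e (-β4c τ) (PsiL Ψ)) = -(qE τ ^ 6 * hE * ε * I * th4 y τ ^ 2 *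
      th4 0 τ * th4 ηc τ * th2 ηc τ) * Zc τ e [y] (PsiL Ψ) := by
    refine Zc_factor τ e [y] _ fun αs _ => ?_
    have a := contr_neg_β4 h2 h5 e (inter [y]) αs (n := 2) rfl
    rw [hx, hprod, Kw_diff_neg_β4 hτ he] at a
    refine mul_left_cancel₀ nh ?_
    linear_combination qE τ ^ 2 * a - hE * contr τ e (-β4c τ) (PsiL Ψ) (inter [y]) αs *
      (pnome τ * qE τ ^ 4 + 1) * q
  rw [Claim, Zc, Zc] at h
  rw [Claim, Zc, key, Zc, Zc, h, Rhs, Rhs]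
  simp only [List.length_cons, List.length_nil, List.map_cons, List.map_nil, List.prod_cons,
    List.prod_nil, zero_add, Nat.reduceAdd, wfun_neg, wfun_β4 hτ, hF.J4_cons, thR_neg_β4,
    rhoF_neg_β4]
  have w := wfun_sub_half_period hτ hy
  have k := Kc_one_mul hτ
  have t := th4_eta_eq hτ
  have nζ := zet_ne hτ
  have nθ := th1_eta_ne hτ
  have k2 : Kc τ 2 * (zet τ * th1 ηc τ ^ 4) = -(Cc τ ^ 3 * th4 0 (2 * τ) ^ 2) := by
    rw [Kc, Kc]
    norm_num
    field_simp
  have main : th4 y τ ^ 2 * th4 ηc τ * th2 ηc τ * Kc τ 1 =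
      -(Kc τ 2 * th4 0 (2 * τ) * th4 0 τ * zet τ * (1 + zet τ) *
        ((wfun τ y - (1 - zet τ) / (1 + zet τ)) * (rhoF τ y * th4 ηc τ ^ 2))) := by
    rw [w, t]
    refine mul_right_cancel₀ (pow_ne_zero 2 nθ) ?_
    linear_combination th4 y τ ^ 2 * (Cc τ ^ 2 * (1 + zet τ) * th4 0 τ) * k +
      th4 0 (2 * τ) * th4 0 τ * (1 + zet τ) * Cc τ * th4 y τ ^ 2 * k2
  linear_combination -(qE τ ^ 6 * hE * ε * I * th4 0 τ * thR τ y * rhoF τ y * F [wfun τ y]) * main +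
    qE τ ^ 6 * hE * ε * I * th4 0 (2 * τ) * th4 0 τ ^ 2 * th4 ηc τ ^ 2 * Kc τ 2 * zet τ *
      (1 + zet τ) * thR τ y * rhoF τ y ^ 2 * (wfun τ y - (1 - zet τ) / (1 + zet τ)) *
      F [wfun τ y] * h3

end

section
variable {τ : ℂ} {Ψ : PsiFam} {e : Fin 2} {ε : ℂ} {F : List ℂ → ℂ}

lemma kap_β4_ne (hτ : 0 < τ.im) : kap τ (β4c τ) ≠ 0 := by
  refine mul_ne_zero (mul_ne_zero ?_ (th4_zero_ne (two_mul_im hτ))) ?_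
  · rw [Ne, th1_eq_zero_iff (two_mul_im hτ)]
    exact not_inLat_of_snd (two_mul_im hτ) 0 (-1) 2 (by norm_num) (by norm_num)
      (by rw [β4c]; push_cast; ring)
  · rw [Ne, th4_eq_zero_iff (two_mul_im hτ)]
    exact not_inLat_of_fst (two_mul_im hτ) 4 0 3 (by norm_num) (by norm_num)
      (by rw [β4c, ηc]; push_cast; ring)

lemma claim_singleton (hτ : 0 < τ.im) (hΨ : PsiEntire Ψ) (h1 : PsiP1 τ Ψ) (h2 : PsiP2 τ Ψ)
    (h3 : PsiP3 τ Ψ) (h5 : PsiP5 τ Ψ) (h6 : PsiP6 Ψ) (he : SignCompat τ e ε)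
    (hF : IsCandidate (zet τ) ε F) {z : ℂ} (hz : rhoF τ z ≠ 0) : Claim τ e Ψ F [z] := by
  have c4 := claim_neg_β4 hτ h2 h5 h6 he hF
  refine claim_of_zeros hτ hΨ h1 h2 h3 e hF [] [-β4c τ, β4c τ, -β3c τ] (by simp) ?_ ?_ hz
  · have p6 (a b : ℤ) (w : ℂ) (hb : ¬ (6 : ℤ) ∣ b)
        (h : 6 * w = a * (Real.pi : ℂ) + b * (Real.pi * τ)) : ¬InLat τ w :=
      not_inLat_of_snd hτ a b 6 (by norm_num) hb (by exact_mod_cast h)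
    have q6 (a b : ℤ) (w : ℂ) (hb : ¬ (6 : ℤ) ∣ a)
        (h : 6 * w = a * (Real.pi : ℂ) + b * (Real.pi * τ)) : ¬InLat τ w :=
      not_inLat_of_fst hτ a b 6 (by norm_num) hb (by exact_mod_cast h)
    simp only [List.pairwise_cons, List.mem_cons, List.not_mem_nil, or_false, forall_eq_or_imp,
      forall_eq, false_imp_iff, implies_true, List.Pairwise.nil, and_true, β4c, β3c, ηc]
    refine ⟨⟨?_, ?_, ?_, ?_⟩, ⟨?_, ?_, ?_⟩, ⟨?_, ?_⟩, ?_⟩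
    · exact q6 (-3) 0 _ (by norm_num) (by push_cast; ring)
    · exact p6 3 3 _ (by norm_num) (by push_cast; ring)
    · exact p6 (-1) (-3) _ (by norm_num) (by push_cast; ring)
    · exact p6 6 3 _ (by norm_num) (by push_cast; ring)
    · exact p6 6 3 _ (by norm_num) (by push_cast; ring)
    · exact p6 2 (-3) _ (by norm_num) (by push_cast; ring)
    · exact p6 9 3 _ (by norm_num) (by push_cast; ring)
    · exact q6 (-4) (-6) _ (by norm_num) (by push_cast; ring)
    · exact q6 3 0 _ (by norm_num) (by push_cast; ring)
    · exact q6 7 6 _ (by norm_num) (by push_cast; ring)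
  · have r4 := rhoF_β4_ne hτ
    have r3 := rhoF_β3_ne hτ
    simp only [List.mem_cons, List.not_mem_nil, or_false, forall_eq_or_imp, forall_eq, rhoF_neg]
    exact ⟨⟨r4, c4⟩, ⟨r4, c4.neg hτ h1 (kap_β4_ne hτ)⟩, r3, claim_neg_β3 hτ h2 h3 h5 h6 hF⟩

lemma Claim.cons_perm (hτ : 0 < τ.im) (h1 : PsiP1 τ Ψ) {ζ : ℂ} (hF : IsCandidate ζ ε F) {a : ℂ}
    {xs ys : List ℂ} (hp : xs.Perm ys) (hx : xs.Pairwise (Sep τ)) (h : Claim τ e Ψ F (a :: xs)) :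
    Claim τ e Ψ F (a :: ys) := by
  rw [Claim, Zc, ← Zc_perm hτ e hp hx ((exch_PsiL h1).contr e a), ← Rhs_perm hF (hp.cons a)]
  exact h

lemma Claim.neg_second (hτ : 0 < τ.im) (h1 : PsiP1 τ Ψ) {ζ : ℂ} (hF : IsCandidate ζ ε F)
    {a y : ℂ} {ys : List ℂ} (hy : kap τ y ≠ 0) (h : Claim τ e Ψ F (a :: -y :: ys)) :
    Claim τ e Ψ F (a :: y :: ys) := by
  have z := Zc_neg hτ ((exch_PsiL h1).contr e a) e ys y
  refine mul_left_cancel₀ hy ?_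
  rw [Rhs_perm hF (List.Perm.swap y a ys), ← Rhs_reflect hτ, Rhs_perm hF (List.Perm.swap a (-y) ys),
    ← h]
  exact z.symm

/-- Points at which the contracted vector is determined by the reduction relations. -/
def redPts (y : ℂ) : List ℂ := [2 * ηc - y, 2 * ηc + y, -(2 * ηc - y), -(2 * ηc + y)]

lemma two_eta_sub_notMem {y : ℂ} (h : y ∉ ratS τ) : 2 * ηc - y ∉ ratS τ := fun a =>
  h (by convert sub_mem (two_mem_ratS (eta_mem_ratS τ)) a using 1; ring)

lemma two_eta_add_notMem {y : ℂ} (h : y ∉ ratS τ) : 2 * ηc + y ∉ ratS τ := fun a =>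
  h (by convert sub_mem a (two_mem_ratS (eta_mem_ratS τ)) using 1; ring)

lemma redPts_notMem {y a : ℂ} (h : y ∉ ratS τ) (ha : a ∈ redPts y) : a ∉ ratS τ := by
  have m := two_eta_sub_notMem h
  have p := two_eta_add_notMem h
  simp only [redPts, List.mem_cons, List.not_mem_nil, or_false] at ha
  rcases ha with rfl | rfl | rfl | rfl
  · exact m
  · exact p
  · rwa [neg_mem_iff]
  · rwa [neg_mem_iff]

lemma redPts_mem {y a : ℂ} (ha : a ∈ redPts y) : a - y ∈ ratS τ ∨ a + y ∈ ratS τ := by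
  have t := two_mem_ratS (eta_mem_ratS τ)
  simp only [redPts, List.mem_cons, List.not_mem_nil, or_false] at ha
  rcases ha with rfl | rfl | rfl | rfl
  · right; convert t using 1; ring
  · left; convert t using 1; ring
  · left; convert neg_mem t using 1; ring
  · right; convert neg_mem t using 1; ring

lemma redPts_pairwise (hτ : 0 < τ.im) {y : ℂ} (h : y ∉ ratS τ) :
    (redPts y).Pairwise fun a b => ¬InLat τ (a - b) := by
  have t := two_mem_ratS (two_mem_ratS (eta_mem_ratS τ))
  have four (w : ℂ) (hw : w = 4 * ηc) : ¬InLat τ w :=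
    not_inLat_of_fst hτ 4 0 3 (by norm_num) (by norm_num) (by rw [hw, ηc]; push_cast; ring)
  have two (w : ℂ) (hw : 2 * y - w ∈ ratS τ ∨ 2 * y + w ∈ ratS τ) : ¬InLat τ w := fun l => by
    have l' := l.mem_ratS
    refine h (half_mem_ratS ?_)
    rcases hw with hw | hw
    · convert add_mem hw l' using 1; ring
    · convert sub_mem hw l' using 1; ring
  simp only [redPts, List.pairwise_cons, List.mem_cons, List.not_mem_nil, or_false,
    forall_eq_or_imp, forall_eq, false_imp_iff, implies_true, List.Pairwise.nil, and_true]
  refine ⟨⟨?_, ?_, ?_⟩, ⟨?_, ?_⟩, ?_⟩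
  · refine two _ (Or.inr ?_); convert zero_mem (ratS τ) using 1; ring
  · refine two _ (Or.inr ?_); convert t using 1; ring
  · exact four _ (by ring)
  · exact four _ (by ring)
  · refine two _ (Or.inl ?_); convert neg_mem t using 1; ring
  · refine two _ (Or.inl ?_); convert zero_mem (ratS τ) using 1; ring

lemma claim_redPts (hτ : 0 < τ.im) (h1 : PsiP1 τ Ψ) (h5 : PsiP5 τ Ψ)
    (hF : IsCandidate (zet τ) ε F) {y a : ℂ} {ys : List ℂ} (hy : Gen τ (y :: ys))
    (h : Claim τ e Ψ F ys) (ha : a ∈ redPts y) : Claim τ e Ψ F (a :: y :: ys) := by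
  have hz : ∀ z ∈ ys, rhoF τ z ≠ 0 := fun z hz => rhoF_ne_of_ratS hτ (hy.of_cons.1 z hz)
  have m := two_eta_sub_notMem hy.head
  have p := two_eta_add_notMem hy.head
  have cm : Claim τ e Ψ F ((2 * ηc - y) :: y :: ys) := by
    have := claim_two_step (e := e) hτ h1 h5 hF m hz h
    rwa [show -(2 * ηc - y) + 2 * ηc = y by ring] at this
  have cp : Claim τ e Ψ F ((2 * ηc + y) :: y :: ys) := by
    have := claim_two_step (e := e) hτ h1 h5 hF p hz h
    rw [show -(2 * ηc + y) + 2 * ηc = -y by ring] at this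
    exact this.neg_second hτ h1 hF (kap_ne_of_ratS hτ hy.head)
  simp only [redPts, List.mem_cons, List.not_mem_nil, or_false] at ha
  rcases ha with rfl | rfl | rfl | rfl
  · exact cm
  · exact cp
  · refine Claim.neg hτ h1 (kap_ne_of_ratS hτ ?_) ?_
    · rwa [neg_mem_iff]
    · rwa [neg_neg]
  · refine Claim.neg hτ h1 (kap_ne_of_ratS hτ ?_) ?_
    · rwa [neg_mem_iff]
    · rwa [neg_neg]

lemma pairwise_points (hτ : 0 < τ.im) {l : List ℂ} (hl : ∀ a ∈ l, a ∉ ratS τ)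
    (hp : l.Pairwise fun a b => ¬InLat τ (a - b)) :
    ((Real.pi / 6 : ℂ) :: 2 * ηc :: l).Pairwise fun a b => ¬InLat τ (a - b) := by
  have s : (Real.pi / 6 : ℂ) ∈ ratS τ := mem_ratS (1 / 6) 0 (by push_cast; ring)
  refine List.pairwise_cons.2 ⟨fun a ha => ?_, List.pairwise_cons.2 ⟨fun a ha i => hl a ha ?_, hp⟩⟩
  · rcases List.mem_cons.1 ha with rfl | ha
    · exact not_inLat_of_fst hτ (-1) 0 2 (by norm_num) (by norm_num) (by rw [ηc]; push_cast; ring)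
    · intro i
      refine hl a ha ?_
      convert sub_mem s i.mem_ratS using 1; ring
  · convert sub_mem (two_mem_ratS (eta_mem_ratS τ)) i.mem_ratS using 1; ring

lemma claim_pair (hτ : 0 < τ.im) (hΨ : PsiEntire Ψ) (h1 : PsiP1 τ Ψ) (h2 : PsiP2 τ Ψ)
    (h3 : PsiP3 τ Ψ) (h5 : PsiP5 τ Ψ) (h6 : PsiP6 Ψ) (he : SignCompat τ e ε)
    (hF : IsCandidate (zet τ) ε F) {z y : ℂ} (hz : z ∉ ratS τ) (hy : y ∉ ratS τ) :
    Claim τ e Ψ F [z, y] := by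
  have β : β4c τ ∈ ratS τ := mem_ratS (1 / 3) (1 / 2) (by rw [β4c, ηc]; push_cast; ring)
  have hn : Gen τ [y] := ⟨by simpa using hy, by simp⟩
  refine claim_of_zeros hτ hΨ h1 h2 h3 e hF [y] (redPts y ++ [-β4c τ]) (by simp [redPts]) ?_ ?_
    (rhoF_ne_of_ratS hτ hz)
  · rw [← List.cons_append, ← List.cons_append, List.pairwise_append]
    refine ⟨pairwise_points hτ (fun a => redPts_notMem hy) (redPts_pairwise hτ hy), by simp, ?_⟩
    intro a ha b hb
    rw [List.mem_singleton] at hb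
    subst hb
    rcases List.mem_cons.1 ha with rfl | ha
    · exact not_inLat_of_snd hτ 3 3 6 (by norm_num) (by norm_num)
        (by rw [β4c, ηc]; push_cast; ring)
    · rcases List.mem_cons.1 ha with rfl | ha
      · exact not_inLat_of_snd hτ 6 3 6 (by norm_num) (by norm_num)
          (by rw [β4c, ηc]; push_cast; ring)
      · intro i
        refine redPts_notMem hy ha ?_
        convert sub_mem i.mem_ratS β using 1; ring
  · intro a ha
    rcases List.mem_append.1 ha with ha | ha
    · exact ⟨rhoF_ne_of_ratS hτ (redPts_notMem hy ha),
        claim_redPts hτ h1 h5 hF hn (claim_nil h6 hF) ha⟩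
    · rw [List.mem_singleton] at ha
      subst ha
      have ry := rhoF_ne_of_ratS hτ hy
      exact ⟨by rw [rhoF_neg]; exact rhoF_β4_ne hτ, claim_neg_β4_cons hτ h2 h5 he hF ry
        (claim_singleton hτ hΨ h1 h2 h3 h5 h6 he hF ry)⟩

lemma length_flatMap_redPts (xs : List ℂ) : (xs.flatMap redPts).length = 4 * xs.length := by
  induction xs with
  | nil => rfl
  | cons x xs ih => simp [redPts, ih]; ring

lemma flatMap_redPts_pairwise (hτ : 0 < τ.im) {xs : List ℂ} (h : Gen τ xs) :
    (xs.flatMap redPts).Pairwise fun a b => ¬InLat τ (a - b) := by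
  refine List.pairwise_flatMap.2 ⟨fun y hy => redPts_pairwise hτ (h.1 y hy), ?_⟩
  refine h.2.imp fun {x y} hxy a ha b hb i => ?_
  have i := i.mem_ratS
  rcases redPts_mem (τ := τ) ha with ha | ha <;> rcases redPts_mem (τ := τ) hb with hb | hb
  · refine hxy.1 ?_; convert sub_mem (add_mem i hb) ha using 1; ring
  · refine hxy.2 ?_; convert sub_mem (add_mem i hb) ha using 1; ring
  · refine hxy.2 ?_; convert neg_mem (sub_mem (add_mem i hb) ha) using 1; ring
  · refine hxy.1 ?_; convert neg_mem (sub_mem (add_mem i hb) ha) using 1; ring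

theorem claim_of_gen (hτ : 0 < τ.im) (hΨ : PsiEntire Ψ) (h1 : PsiP1 τ Ψ) (h2 : PsiP2 τ Ψ)
    (h3 : PsiP3 τ Ψ) (h5 : PsiP5 τ Ψ) (h6 : PsiP6 Ψ) (he : SignCompat τ e ε)
    (hF : IsCandidate (zet τ) ε F) : ∀ (n : ℕ) (xs : List ℂ), xs.length = n → Gen τ xs →
      Claim τ e Ψ F xs := by
  intro n
  induction n using Nat.strong_induction_on with
  | _ n ih =>
  intro xs hn hg
  match xs, hn, hg with
  | [], _, _ => exact claim_nil h6 hF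
  | [z], _, hg =>
    exact claim_singleton hτ hΨ h1 h2 h3 h5 h6 he hF (rhoF_ne_of_ratS hτ hg.head)
  | [z, y], _, hg => exact claim_pair hτ hΨ h1 h2 h3 h5 h6 he hF hg.head hg.of_cons.head
  | z :: y :: y' :: ys, hn, hg =>
    have gx := hg.of_cons
    refine claim_of_zeros hτ hΨ h1 h2 h3 e hF (y :: y' :: ys) ((y :: y' :: ys).flatMap redPts)
      (by rw [length_flatMap_redPts]; simp; omega)
      (pairwise_points hτ ?_ (flatMap_redPts_pairwise hτ gx)) ?_ (rhoF_ne_of_ratS hτ hg.head)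
    · intro a ha
      obtain ⟨x, hx, hax⟩ := List.mem_flatMap.1 ha
      exact redPts_notMem (gx.1 x hx) hax
    · intro a ha
      obtain ⟨x, hx, hax⟩ := List.mem_flatMap.1 ha
      refine ⟨rhoF_ne_of_ratS hτ (redPts_notMem (gx.1 x hx) hax), ?_⟩
      have hp := List.perm_cons_erase hx
      have g' := gx.perm hp
      refine Claim.cons_perm hτ h1 hF hp.symm (g'.sep hτ) (claim_redPts hτ h1 h5 hF g' ?_ hax)
      have hl := hp.length_eq
      simp only [List.length_cons] at hl hn
      exact ih _ (by omega) _ rfl g'.of_cons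

end

section
variable {τ : ℂ} {Ψ : PsiFam} {e : Fin 2} {ε : ℂ} {F : List ℂ → ℂ}

lemma rhoF_zero (τ : ℂ) : rhoF τ 0 = -th1 ηc τ ^ 2 := by
  rw [rhoF, zero_sub, zero_add, th1_neg]; ring

lemma claim_replicate_append (hτ : 0 < τ.im) (hΨ : PsiEntire Ψ) (h1 : PsiP1 τ Ψ) (h2 : PsiP2 τ Ψ)
    (h3 : PsiP3 τ Ψ) (h5 : PsiP5 τ Ψ) (h6 : PsiP6 Ψ) (he : SignCompat τ e ε)
    (hF : IsCandidate (zet τ) ε F) (j : ℕ) {zs : List ℂ} (hz : Gen τ zs) :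
    Claim τ e Ψ F (List.replicate j 0 ++ zs) := by
  induction j generalizing zs with
  | zero => exact claim_of_gen hτ hΨ h1 h2 h3 h5 h6 he hF _ zs rfl hz
  | succ j ih =>
    obtain ⟨f, f1, -, -, -, f5⟩ :=
      exists_head_diff hτ hΨ h1 h2 h3 e hF (List.replicate j 0 ++ zs) rfl
    have hf : f = fun _ => 0 := by
      refine Continuous.ext_on (dense_gen τ hz) f1.continuous continuous_const fun z hg => ?_
      refine (f5 z (rhoF_ne_of_ratS hτ hg.head)).2 ?_
      have c := ih hg
      have hp : (List.replicate j 0 ++ z :: zs).Perm (z :: (List.replicate j 0 ++ zs)) :=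
        List.perm_middle
      rwa [Claim, Zc_perm hτ e hp (hg.sep_replicate hτ j) (exch_PsiL h1), Rhs_perm hF hp] at c
    refine (f5 0 ?_).1 (by rw [hf])
    rw [rhoF_zero]
    exact neg_ne_zero.2 (pow_ne_zero _ (th1_eta_ne hτ))

lemma Aw_zero (τ : ℂ) : Aw τ 0 = 0 := by
  rw [Aw, th1_zero, zero_mul]

lemma contr_zero (τ : ℂ) (e : Fin 2) (Φ : List ℂ → List (Fin 2) → ℂ) (us : List ℂ)
    (αs : List (Fin 2)) :
    contr τ e 0 Φ us αs = Dw τ 0 * Φ (0 :: 0 :: us) (e :: e :: αs) := by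
  fin_cases e <;> simp [contr, Kw, Aw_zero]

lemma Zc_replicate (τ : ℂ) (e : Fin 2) (n : ℕ) (Φ : List ℂ → List (Fin 2) → ℂ) :
    Zc τ e (List.replicate n 0) Φ =
      Dw τ 0 ^ n * Φ (List.replicate (2 * n + 1) 0) (List.replicate (2 * n) e ++ [1]) := by
  induction n generalizing Φ with
  | zero => simp [Zc]
  | succ n ih =>
    rw [List.replicate_succ, Zc, ih, contr_zero, pow_succ, mul_assoc]
    rfl

lemma Ncoef_add_two {τ : ℂ} (hτ : 0 < τ.im) (n : ℕ) :
    Ncoef τ (n + 2) * (th1 ηc τ ^ (4 * n + 4) * Cc τ ^ (2 * n + 3)) = -Ncoef τ n := by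
  have n1 := th1_eta_ne hτ
  have n3 := th4_eta_ne (two_mul_im hτ)
  have n4 := th4_zero_ne (two_mul_im hτ)
  have e1 : (n + 2 + 1) / 2 = (n + 1) / 2 + 1 := by omega
  have e2 : (n + 2) * (n + 2 + 1) / 2 = n * (n + 1) / 2 + (2 * n + 3) := by
    rw [show (n + 2) * (n + 2 + 1) = n * (n + 1) + (2 * n + 3) * 2 by ring,
      Nat.add_mul_div_right _ _ (by norm_num)]
  rw [Ncoef, Ncoef, e1, e2, show (n + 2) ^ 2 = n ^ 2 + (4 * n + 4) by ring, Cc, pow_add (th1 ηc τ),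
    pow_add _ (n * (n + 1) / 2), ← inv_div (th4 0 (2 * τ)), inv_pow, pow_succ]
  have := pow_ne_zero (2 * n + 3) (div_ne_zero n4 n3)
  field_simp

lemma norm_eq {τ : ℂ} (hτ : 0 < τ.im) (n : ℕ) :
    Ncoef τ n * Kc τ n * (th1 ηc (2 * τ) * (-th1 ηc τ ^ 2) ^ n) ^ n = Dw τ 0 ^ n := by
  have n1 := th1_eta_ne hτ
  have n2 := th1_eta_ne (two_mul_im hτ)
  have n3 := th4_eta_ne (two_mul_im hτ)
  have n4 := th4_zero_ne (two_mul_im hτ)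
  induction n using Nat.twoStepInduction with
  | zero => simp [Ncoef, Kc]
  | one =>
    rw [Kc, Ncoef, Cc]
    norm_num
    field_simp
  | more n ih _ =>
    have a := Ncoef_add_two hτ n
    have nζ := zet_ne hτ
    have z : zet τ * th4 ηc (2 * τ) ^ 2 = th1 ηc (2 * τ) ^ 2 := by
      rw [zet, div_pow, div_mul_cancel₀ _ (pow_ne_zero _ n3)]
    have e : (th1 ηc (2 * τ) * (-th1 ηc τ ^ 2) ^ (n + 2)) ^ (n + 2) =
        (th1 ηc (2 * τ) * (-th1 ηc τ ^ 2) ^ n) ^ n * th1 ηc (2 * τ) ^ 2 *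
          th1 ηc τ ^ (4 * n + 4) * th1 ηc τ ^ (4 * n + 4) := by
      rw [mul_pow, mul_pow, ← pow_mul, ← pow_mul,
        show (n + 2) * (n + 2) = n * n + 2 * (2 * n + 2) by ring, pow_add (-th1 ηc τ ^ 2),
        pow_mul (-th1 ηc τ ^ 2) 2, neg_sq, pow_add _ n 2]
      ring
    rw [Kc, e, pow_add (Dw τ 0), ← ih, Dw_zero]
    have K : Cc τ ^ (2 * n + 3) * th4 0 (2 * τ) ^ 2 / (zet τ * th1 ηc τ ^ (4 * n + 4)) *
        (zet τ * th1 ηc τ ^ (4 * n + 4)) = Cc τ ^ (2 * n + 3) * th4 0 (2 * τ) ^ 2 :=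
      div_mul_cancel₀ _ (mul_ne_zero nζ (pow_ne_zero _ n1))
    rw [← z]
    linear_combination (-Ncoef τ (n + 2) * Kc τ n * (th1 ηc (2 * τ) * (-th1 ηc τ ^ 2) ^ n) ^ n *
      th4 ηc (2 * τ) ^ 2 * th1 ηc τ ^ (4 * n + 4)) * K -
      Kc τ n * (th1 ηc (2 * τ) * (-th1 ηc τ ^ 2) ^ n) ^ n * th4 ηc (2 * τ) ^ 2 *
        th4 0 (2 * τ) ^ 2 * a

lemma Rhs_replicate (τ : ℂ) (F : List ℂ → ℂ) (n : ℕ) : Rhs τ F (List.replicate n 0) =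
    Kc τ n * (th1 ηc (2 * τ) * (-th1 ηc τ ^ 2) ^ n) ^ n * F (List.replicate n 0) := by
  rw [Rhs, List.length_replicate, List.map_replicate, List.map_replicate, List.prod_replicate,
    rhoF_zero, wfun_zero, thR, mul_zero, sub_zero]

/-- The component of `ψ_n` with spins `e` at all sites but the last, and spin `↓` there. -/
theorem psiH_eq (hτ : 0 < τ.im) (hΨ : PsiEntire Ψ) (h1 : PsiP1 τ Ψ) (h2 : PsiP2 τ Ψ)
    (h3 : PsiP3 τ Ψ) (h5 : PsiP5 τ Ψ) (h6 : PsiP6 Ψ) (he : SignCompat τ e ε)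
    (hF : IsCandidate (zet τ) ε F) (n : ℕ) :
    psiH τ Ψ n (fun j => if (j : ℕ) = 2 * n then 1 else e) = F (List.replicate n 0) := by
  have c := claim_replicate_append hτ hΨ h1 h2 h3 h5 h6 he hF n (Gen.nil τ)
  rw [List.append_nil, Claim, Zc_replicate, Rhs_replicate, PsiL_eq Ψ (n := n) (by simp)] at c
  have eu : (fun j : Fin (2 * n + 1) => (List.replicate (2 * n + 1) (0 : ℂ)).getD j 0) =
      fun _ => 0 := by
    funext j
    rw [List.getD_replicate _ j.2]
  have eα : (fun j : Fin (2 * n + 1) => (List.replicate (2 * n) e ++ [1]).getD j 0) =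
      fun j : Fin (2 * n + 1) => if (j : ℕ) = 2 * n then 1 else e := by
    funext j
    have := j.2
    split_ifs with h
    · rw [h, List.getD_append_right _ _ _ _ (by simp)]
      simp
    · rw [List.getD_append _ _ _ _ (by simp; omega), List.getD_replicate _ (by omega)]
  rw [eu, eα] at c
  have nD : Dw τ 0 ^ n ≠ 0 := by
    rw [Dw_zero]
    exact pow_ne_zero _ (mul_ne_zero (th4_zero_ne (two_mul_im hτ)) (th4_eta_ne (two_mul_im hτ)))
  refine mul_left_cancel₀ nD ?_
  rw [psiH, ← norm_eq hτ n]
  rw [← norm_eq hτ n] at c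
  linear_combination Ncoef τ n * c

lemma downConf_eq (n : ℕ) : (downConf : Fin (2 * n + 1) → Fin 2) =
    fun j : Fin (2 * n + 1) => if (j : ℕ) = 2 * n then 1 else 1 := by
  funext j; simp [downConf]

end

section
variable {H : (k : ℕ) → (Fin (2 * k) → ℂ) → ℂ} {ζ : ℂ}

lemma HL_replicate_append (hH : IsHFamily ζ H) {m k : ℕ} {l : List ℂ} (hl : m + l.length = 2 * k) :
    HL H (List.replicate m 0 ++ l) = H k (padded l) := by
  rw [HL_perm hH (k := k) List.perm_append_comm (by simpa using hl), HL]
  have : (l ++ List.replicate m (0 : ℂ)).length / 2 = k := by simp; omega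
  subst this
  congr 1
  funext j
  rw [padded, padded]
  rcases lt_or_ge (j : ℕ) l.length with h | h
  · rw [List.getD_append _ _ _ _ h]
  · rw [List.getD_append_right _ _ _ _ h, List.getD_eq_default l _ h]
    rcases lt_or_ge ((j : ℕ) - l.length) m with h' | h'
    · rw [List.getD_replicate _ h']
    · rw [List.getD_eq_default _ _ (by simpa using h')]

lemma padded_nil (n : ℕ) : (padded [] : Fin n → ℂ) = fun _ => 0 := by
  funext j; simp [padded]

lemma HL_replicate (hH : IsHFamily ζ H) (k : ℕ) :
    HL H (List.replicate (2 * k) 0) = H k (fun _ => 0) := by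
  have := HL_replicate_append hH (m := 2 * k) (k := k) (l := []) rfl
  rwa [List.append_nil, padded_nil] at this

lemma replicate_append_zero_cons (m : ℕ) (l : List ℂ) :
    List.replicate m 0 ++ 0 :: l = List.replicate (m + 1) 0 ++ l := by
  rw [List.append_cons, List.replicate_succ']

lemma Hi_replicate_append (hH : IsHFamily ζ H) (ht : 1 - ζ ^ 2 ≠ 0) {m k : ℕ} {l : List ℂ}
    (hl : m + l.length = 2 * k) : Hi H ζ (List.replicate (m + 1) 0 ++ l) = H k (padded l) := by
  rw [List.replicate_succ, List.cons_append, Hi_zero_cons hH ht (m := k) (by simpa using hl),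
    HL_replicate_append hH hl]

lemma Hi_replicate_append_singleton (hH : IsHFamily ζ H) (ht : 1 - ζ ^ 2 ≠ 0) (k : ℕ) (a : ℂ) :
    Hi H ζ (List.replicate (2 * k) 0 ++ [a]) = H k (padded [a]) := by
  cases k with
  | zero => rw [hH.1]; exact Hi_single hH a
  | succ k => exact Hi_replicate_append hH ht (m := 2 * k + 1) (by simp; ring)

end

end EightVertex

open EightVertex

theorem stmt19 (τ : ℂ) (hτ : 0 < τ.im) (hp : preal τ) (Ψ : PsiFam)
    (hent : PsiEntire Ψ) (h1 : PsiP1 τ Ψ) (h2 : PsiP2 τ Ψ) (h3 : PsiP3 τ Ψ)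
    (h4 : PsiP4 Ψ) (h5 : PsiP5 τ Ψ) (h6 : PsiP6 Ψ)
    (H : (k : ℕ) → (Fin (2*k) → ℂ) → ℂ) (hH : IsHFamily (zet τ) H) (k : ℕ) :
    psiH τ Ψ (2*k) downConf
        = (zet τ)^k * H k (fun _ => 0) * H (k+1) (padded [J3c (zet τ), J4c (zet τ)]) ∧
    psiH τ Ψ (2*k+1) downConf
        = (zet τ)^(k+1) * H (k+1) (padded [J3c (zet τ)]) * H (k+1) (padded [J4c (zet τ)]) ∧
    psiH τ Ψ (2*k) lastDownConf
        = (1/2) * (zet τ)^k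
          * ((1 + zet τ) * H k (padded [J3c (zet τ)]) * H (k+1) (padded [J4c (zet τ)])
            + (1 - zet τ) * H k (padded [J4c (zet τ)]) * H (k+1) (padded [J3c (zet τ)])) ∧
    psiH τ Ψ (2*k+1) lastDownConf
        = (1/2) * (zet τ)^k
          * ((1 - (zet τ)^2) * H (k+1) (fun _ => 0)
               * H (k+1) (padded [J3c (zet τ), J4c (zet τ)])
            + H k (fun _ => 0) * H (k+2) (padded [J3c (zet τ), J4c (zet τ)])) := by
  have n3 := one_add_zet_ne hτ
  have n4 := one_sub_zet_ne hτ
  have nt := one_sub_zet_sq_ne hτ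
  have down := psiH_eq hτ hent h1 h2 h3 h5 h6 (signCompat_one τ) (isCandidate_candDown hH n3 n4)
  have up := psiH_eq hτ hent h1 h2 h3 h5 h6 (signCompat_zero τ) (isCandidate_candUp hH n3 n4)
  have hz := HL_replicate hH k
  have hz' := HL_replicate hH (k + 1)
  have hiz := Hi_replicate_append hH nt (m := 2 * k) (k := k) (l := []) rfl
  rw [List.append_nil, padded_nil] at hiz
  refine ⟨?_, ?_, ?_, ?_⟩
  · rw [downConf_eq, down, candDown_even (k := k) (by simp), hz,
      HL_replicate_append hH (k := k + 1) (by simp; ring)]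
    ring
  · rw [downConf_eq, down, candDown_odd (k := k) (by simp),
      HL_replicate_append hH (k := k + 1) (by simp; ring),
      HL_replicate_append hH (k := k + 1) (by simp; ring)]
    ring
  · refine (up (2 * k)).trans ?_
    rw [candUp_even (k := k) (by simp), Hi_replicate_append_singleton hH nt,
      Hi_replicate_append_singleton hH nt, replicate_append_zero_cons, replicate_append_zero_cons,
      HL_replicate_append hH (k := k + 1) (by simp; ring),
      HL_replicate_append hH (k := k + 1) (by simp; ring)]
    ring
  · refine (up (2 * k + 1)).trans ?_
    rw [candUp_odd (k := k) (by simp), hiz, ← List.replicate_succ',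
      show 2 * k + 1 + 1 = 2 * (k + 1) by ring, hz',
      Hi_replicate_append hH nt (k := k + 1) (by simp; ring), replicate_append_zero_cons,
      HL_replicate_append hH (k := k + 2) (by simp; ring)]
    ring

end
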